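/- Let G be an affine reductive algebraic group over an algebraically closed field k of characteristic zero, X an affine G-variety, and x ∈ X. The following are equivalent: (1) x is stable; (2) x is properly stable for the reduced action of G/G_X on X; (3) x is 1PS stable for the reduced action of G/G_X on X; (4) x is 1PS stable for the G-action. -/

import Mathlib

open scoped MatrixGroups

namespace PaperGIT

variable {k : Type} [Field k]

/-- The zero locus in affine space `k^σ` of a set of polynomials. -/
def zeroLocus {σ : Type} (I : Set (MvPolynomial σ k)) : Set (σ → k) :=
  {x | ∀ f ∈ I, MvPolynomial.eval x f = 0}

/-- A subset of affine space is Zariski closed if it is the zero locus of a set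
of polynomials. -/
def IsZClosed {σ : Type} (S : Set (σ → k)) : Prop :=
  ∃ I : Set (MvPolynomial σ k), S = zeroLocus I

/-- The Zariski closure of a subset of affine space. -/
def zClosure {σ : Type} (S : Set (σ → k)) : Set (σ → k) :=
  ⋂₀ {C | IsZClosed C ∧ S ⊆ C}

/-- A matrix viewed as a point of affine space. -/
def mat2pt {n : ℕ} (A : Matrix (Fin n) (Fin n) k) : Fin n × Fin n → k :=
  fun p => A p.1 p.2

/-- An affine algebraic group over `k`, realized (as is always possible) as a
Zariski closed subgroup of some `GL n k`. -/
structure AlgGroup (k : Type) [Field k] where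
  n : ℕ
  toSubgroup : Subgroup (GL (Fin n) k)
  closed : ∃ I : Set (MvPolynomial (Fin n × Fin n) k),
    ∀ A : GL (Fin n) k, A ∈ toSubgroup ↔
      mat2pt (A : Matrix (Fin n) (Fin n) k) ∈ zeroLocus I

/-- A one-parameter subgroup (cocharacter) of `G`: a group homomorphism
`k^× → G` whose matrix entries are Laurent polynomials in the parameter. -/
structure OnePS (G : AlgGroup k) where
  toFun : kˣ →* GL (Fin G.n) k
  mem : ∀ t : kˣ, toFun t ∈ G.toSubgroup
  regular : ∃ p : Fin G.n × Fin G.n → MvPolynomial Bool k,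
    ∀ (t : kˣ) (ij : Fin G.n × Fin G.n),
      (toFun t : Matrix (Fin G.n) (Fin G.n) k) ij.1 ij.2 =
        MvPolynomial.eval (fun b => if b then (t : k) else ((t⁻¹ : kˣ) : k)) (p ij)

/-- `GLimit lam g h` says that the morphism `t ↦ lam(t) * g * lam(t)⁻¹` of `k^×`
into `G` extends to a morphism `k → G` with value `h` at `t = 0`; i.e. that
`lam⁺g = lim_{t→0} lam(t) g lam(t)⁻¹` exists and equals `h`. -/
def GLimit {G : AlgGroup k} (lam : OnePS G) (g h : GL (Fin G.n) k) : Prop :=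
  h ∈ G.toSubgroup ∧
  ∃ q : Fin G.n × Fin G.n → Polynomial k,
    (∀ (t : kˣ) (ij : Fin G.n × Fin G.n),
      ((lam.toFun t * g * (lam.toFun t)⁻¹ : GL (Fin G.n) k) :
          Matrix (Fin G.n) (Fin G.n) k) ij.1 ij.2 = (q ij).eval (t : k)) ∧
    ∀ ij : Fin G.n × Fin G.n,
      (h : Matrix (Fin G.n) (Fin G.n) k) ij.1 ij.2 = (q ij).eval 0

/-- The R-parabolic subgroup `P(λ) = {g ∈ G : lim_{t→0} λ(t) g λ(t)⁻¹ exists}`. -/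
def Pset {G : AlgGroup k} (lam : OnePS G) : Set (GL (Fin G.n) k) :=
  {g | g ∈ G.toSubgroup ∧ ∃ h, GLimit lam g h}

/-- The R-Levi subgroup `L(λ) = {g ∈ G : lim_{t→0} λ(t) g λ(t)⁻¹ = g}`. -/
def Lset {G : AlgGroup k} (lam : OnePS G) : Set (GL (Fin G.n) k) :=
  {g | g ∈ G.toSubgroup ∧ GLimit lam g g}

/-- `L` is an R-Levi subgroup of the R-parabolic subgroup `P`, i.e. `L = L(μ)`
for some one-parameter subgroup `μ` with `P(μ) = P`. -/
def IsRLeviOf {G : AlgGroup k} (L P : Set (GL (Fin G.n) k)) : Prop :=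
  ∃ mu : OnePS G, Pset mu = P ∧ Lset mu = L

/-- `P` is an R-parabolic subgroup of `G`. -/
def IsRParabolic {G : AlgGroup k} (P : Set (GL (Fin G.n) k)) : Prop :=
  ∃ lam : OnePS G, P = Pset lam

/-- Two one-parameter subgroups are opposite if `P(λ) ∩ P(λ')` is an R-Levi
subgroup of both `P(λ)` and `P(λ')`. -/
def AreOpposite {G : AlgGroup k} (lam lam' : OnePS G) : Prop :=
  IsRLeviOf (Pset lam ∩ Pset lam') (Pset lam) ∧
  IsRLeviOf (Pset lam ∩ Pset lam') (Pset lam')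

/-- A subgroup (given as a subset) `H ⊆ G` is completely reducible in `G` if
every R-parabolic subgroup of `G` containing `H` has an R-Levi subgroup
containing `H`. -/
def CompletelyReducible (G : AlgGroup k) (H : Set (GL (Fin G.n) k)) : Prop :=
  ∀ lam : OnePS G, H ⊆ Pset lam →
    ∃ L : Set (GL (Fin G.n) k), IsRLeviOf L (Pset lam) ∧ H ⊆ L

/-- A subgroup (given as a subset) `H ⊆ G` is irreducible in `G` if it is not
contained in any proper R-parabolic subgroup of `G`. -/
def IrreducibleIn (G : AlgGroup k) (H : Set (GL (Fin G.n) k)) : Prop :=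
  ∀ lam : OnePS G, H ⊆ Pset lam → Pset lam = (G.toSubgroup : Set (GL (Fin G.n) k))

/-- The center `Z(G)` of `G`, as a subset. -/
def centerSet (G : AlgGroup k) : Set (GL (Fin G.n) k) :=
  {g | g ∈ G.toSubgroup ∧ ∀ h ∈ G.toSubgroup, g * h = h * g}

/-- The centralizer `Z_G(H)` of a subset `H` in `G`. -/
def centralizerSet (G : AlgGroup k) (H : Set (GL (Fin G.n) k)) :
    Set (GL (Fin G.n) k) :=
  {g | g ∈ G.toSubgroup ∧ ∀ h ∈ H, g * h = h * g}

/-- A subset of `GL n k` which is Zariski closed in `GL n k` (with the subspace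
topology coming from the space of matrices). -/
def ClosedInGL {n : ℕ} (S : Set (GL (Fin n) k)) : Prop :=
  ∃ I : Set (MvPolynomial (Fin n × Fin n) k),
    S = {A : GL (Fin n) k | mat2pt (A : Matrix (Fin n) (Fin n) k) ∈ zeroLocus I}

/-- Zariski connectedness (preconnectedness) of a subset of `GL n k`. -/
def IsConnSet {n : ℕ} (T : Set (GL (Fin n) k)) : Prop :=
  ∀ V W : Set (GL (Fin n) k), ClosedInGL V → ClosedInGL W →
    T ⊆ V ∪ W → T ∩ V ∩ W = ∅ → T ⊆ V ∨ T ⊆ W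

/-- The connected component of the identity of `G`. -/
def idComponent (G : AlgGroup k) : Set (GL (Fin G.n) k) :=
  ⋃₀ {C | C ⊆ (G.toSubgroup : Set (GL (Fin G.n) k)) ∧
      (1 : GL (Fin G.n) k) ∈ C ∧ IsConnSet C}

/-- A unipotent element of `GL n k`. -/
def IsUnipotentEl {n : ℕ} (A : GL (Fin n) k) : Prop :=
  ((A : Matrix (Fin n) (Fin n) k) - 1) ^ n = 0

/-- `G` is reductive: the unipotent radical of the identity component `G⁰` is
trivial, i.e. every connected normal subgroup of `G⁰` consisting of unipotent
elements is trivial. -/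
def IsReductive (G : AlgGroup k) : Prop :=
  ∀ H : Set (GL (Fin G.n) k),
    H ⊆ idComponent G → (1 : GL (Fin G.n) k) ∈ H →
    (∀ a ∈ H, ∀ b ∈ H, a * b ∈ H) → (∀ a ∈ H, a⁻¹ ∈ H) →
    (∀ g ∈ idComponent G, ∀ h ∈ H, g * h * g⁻¹ ∈ H) →
    IsConnSet H → (∀ h ∈ H, IsUnipotentEl h) →
    H = {1}

/-- A semisimple (diagonalizable) element of `GL n k`. -/
def IsSemisimpleEl {n : ℕ} (A : GL (Fin n) k) : Prop :=
  ∃ P : GL (Fin n) k,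
    ((P * A * P⁻¹ : GL (Fin n) k) : Matrix (Fin n) (Fin n) k).IsDiag

/-- A torus in `G`: a Zariski closed connected commutative subgroup all of
whose elements are semisimple. -/
def IsTorusIn (G : AlgGroup k) (T : Set (GL (Fin G.n) k)) : Prop :=
  T ⊆ (G.toSubgroup : Set (GL (Fin G.n) k)) ∧ (1 : GL (Fin G.n) k) ∈ T ∧
  (∀ a ∈ T, ∀ b ∈ T, a * b ∈ T) ∧ (∀ a ∈ T, a⁻¹ ∈ T) ∧
  ClosedInGL T ∧ IsConnSet T ∧
  (∀ a ∈ T, ∀ b ∈ T, a * b = b * a) ∧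
  (∀ a ∈ T, IsSemisimpleEl a)

/-- A maximal torus of `G`. -/
def IsMaximalTorusIn (G : AlgGroup k) (T : Set (GL (Fin G.n) k)) : Prop :=
  IsTorusIn G T ∧ ∀ T' : Set (GL (Fin G.n) k), IsTorusIn G T' → T ⊆ T' → T' = T

/-- A morphism of affine algebraic groups: a group homomorphism on the points
of `G` whose matrix entries are regular functions on `G`. -/
structure AlgGroupHom (G G' : AlgGroup k) where
  toFun : GL (Fin G.n) k → GL (Fin G'.n) k
  mem : ∀ g ∈ G.toSubgroup, toFun g ∈ G'.toSubgroup
  map_one : toFun 1 = 1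
  map_mul : ∀ g ∈ G.toSubgroup, ∀ h ∈ G.toSubgroup, toFun (g * h) = toFun g * toFun h
  regular : ∃ p : Fin G'.n × Fin G'.n → MvPolynomial ((Fin G.n × Fin G.n) ⊕ Unit) k,
    ∀ g ∈ G.toSubgroup, ∀ ij : Fin G'.n × Fin G'.n,
      (toFun g : Matrix (Fin G'.n) (Fin G'.n) k) ij.1 ij.2 =
        MvPolynomial.eval
          (Sum.elim (mat2pt (g : Matrix (Fin G.n) (Fin G.n) k))
            (fun _ => ((g⁻¹ : GL (Fin G.n) k) : Matrix (Fin G.n) (Fin G.n) k).det))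
          (p ij)

/-- Surjectivity of a morphism of algebraic groups (onto the points of `G'`). -/
def AlgGroupHom.Surj {G G' : AlgGroup k} (f : AlgGroupHom G G') : Prop :=
  ∀ g' ∈ G'.toSubgroup, ∃ g ∈ G.toSubgroup, f.toFun g = g'

/-- An affine `G`-variety: a Zariski closed subset of affine space `k^m`
together with an algebraic (polynomially defined) action of `G`. -/
structure GVariety (G : AlgGroup k) (m : ℕ) where
  carrier : Set (Fin m → k)
  closed : IsZClosed carrier
  act : GL (Fin G.n) k → (Fin m → k) → (Fin m → k)
  act_mem : ∀ g ∈ G.toSubgroup, ∀ x ∈ carrier, act g x ∈ carrier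
  act_one : ∀ x ∈ carrier, act 1 x = x
  act_mul : ∀ g ∈ G.toSubgroup, ∀ h ∈ G.toSubgroup, ∀ x ∈ carrier,
    act (g * h) x = act g (act h x)
  regular : ∃ p : Fin m → MvPolynomial ((Fin G.n × Fin G.n) ⊕ (Unit ⊕ Fin m)) k,
    ∀ g ∈ G.toSubgroup, ∀ x ∈ carrier, ∀ i : Fin m,
      act g x i =
        MvPolynomial.eval
          (Sum.elim (mat2pt (g : Matrix (Fin G.n) (Fin G.n) k))
            (Sum.elim
              (fun _ => ((g⁻¹ : GL (Fin G.n) k) : Matrix (Fin G.n) (Fin G.n) k).det)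
              x))
          (p i)

/-- `XLimit X lam x y` : the `lam`-ray through `x`, `t ↦ lam(t)·x`, extends to
a morphism `k → X` with value `y` at `0`; i.e. `lam⁺x` exists and equals `y`. -/
def XLimit {G : AlgGroup k} {m : ℕ} (X : GVariety G m) (lam : OnePS G)
    (x y : Fin m → k) : Prop :=
  y ∈ X.carrier ∧
  ∃ q : Fin m → Polynomial k,
    (∀ (t : kˣ) (i : Fin m), X.act (lam.toFun t) x i = (q i).eval (t : k)) ∧
    ∀ i : Fin m, y i = (q i).eval 0

/-- `lam ∈ Λ_x` : the limit `lam⁺x` exists. -/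
def InLambda {G : AlgGroup k} {m : ℕ} (X : GVariety G m) (x : Fin m → k)
    (lam : OnePS G) : Prop :=
  ∃ y, XLimit X lam x y

/-- `H_x = ∩_{λ ∈ Λ_x} P(λ)`. -/
def Hx {G : AlgGroup k} {m : ℕ} (X : GVariety G m) (x : Fin m → k) :
    Set (GL (Fin G.n) k) :=
  {g | g ∈ G.toSubgroup ∧ ∀ lam : OnePS G, InLambda X x lam → g ∈ Pset lam}

/-- `Λ_x` is symmetric: every `λ ∈ Λ_x` admits an opposite `λ' ∈ Λ_x`. -/
def SymmetricLambda {G : AlgGroup k} {m : ℕ} (X : GVariety G m)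
    (x : Fin m → k) : Prop :=
  ∀ lam : OnePS G, InLambda X x lam →
    ∃ lam' : OnePS G, InLambda X x lam' ∧ AreOpposite lam lam'

/-- The map `η : X → S(G)`, `x ↦ H_x`, is proper: `H_x ⊆ P(λ)` implies `λ ∈ Λ_x`. -/
def EtaProper {G : AlgGroup k} {m : ℕ} (X : GVariety G m) : Prop :=
  ∀ x ∈ X.carrier, ∀ lam : OnePS G, Hx X x ⊆ Pset lam → InLambda X x lam

/-- The `G`-orbit of `x`. -/
def orbitSet {G : AlgGroup k} {m : ℕ} (X : GVariety G m) (x : Fin m → k) :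
    Set (Fin m → k) :=
  {y | ∃ g ∈ G.toSubgroup, y = X.act g x}

/-- `x` is polystable: its `G`-orbit is Zariski closed. -/
def Polystable {G : AlgGroup k} {m : ℕ} (X : GVariety G m) (x : Fin m → k) : Prop :=
  IsZClosed (orbitSet X x)

/-- The stabilizer `G_x` of `x`, as a subset of `G`. -/
def stabSet {G : AlgGroup k} {m : ℕ} (X : GVariety G m) (x : Fin m → k) :
    Set (GL (Fin G.n) k) :=
  {g | g ∈ G.toSubgroup ∧ X.act g x = x}

/-- The center of the action, `G_X = ∩_{x ∈ X} G_x`. -/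
def actionCenter {G : AlgGroup k} {m : ℕ} (X : GVariety G m) :
    Set (GL (Fin G.n) k) :=
  {g | g ∈ G.toSubgroup ∧ ∀ x ∈ X.carrier, X.act g x = x}

/-- `x` is stable: polystable and `G_x/G_X` is finite (finitely many cosets
`g·G_X` with `g ∈ G_x`). -/
def Stable {G : AlgGroup k} {m : ℕ} (X : GVariety G m) (x : Fin m → k) : Prop :=
  Polystable X x ∧
  Set.Finite ((fun g => (fun h => g * h) '' actionCenter X) '' stabSet X x)

/-- `x` is properly stable: polystable with finite stabilizer. -/
def ProperlyStable {G : AlgGroup k} {m : ℕ} (X : GVariety G m) (x : Fin m → k) : Prop :=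
  Polystable X x ∧ (stabSet X x).Finite

/-- `x` is equicentral: polystable and `G_x = G_X`. -/
def Equicentral {G : AlgGroup k} {m : ℕ} (X : GVariety G m) (x : Fin m → k) : Prop :=
  Polystable X x ∧ stabSet X x = actionCenter X

/-- `x` is 1PS stable: polystable, and for every one-parameter subgroup `λ`
of `G` with `λ(k^×) ⊄ G_X` the limit `λ⁺x` does not exist. -/
def OnePSStable {G : AlgGroup k} {m : ℕ} (X : GVariety G m) (x : Fin m → k) : Prop :=
  Polystable X x ∧
  ∀ lam : OnePS G, ¬ (∀ t : kˣ, lam.toFun t ∈ actionCenter X) → ¬ InLambda X x lam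

/-- The weight space of weight `n ∈ ℤ` for the 1PS `lam` acting on `k^m`. -/
def weightSpace {G : AlgGroup k} {m : ℕ} (X : GVariety G m) (lam : OnePS G)
    (n : ℤ) : Set (Fin m → k) :=
  {w | ∀ t : kˣ, X.act (lam.toFun t) w = (((t ^ n : kˣ) : k)) • w}

/-- `μ(v, lam) = μ0`: decomposing `v` into nonzero weight vectors for `lam`,
the minimal occurring weight equals `μ0`. -/
def MuIs {G : AlgGroup k} {m : ℕ} (X : GVariety G m) (lam : OnePS G)
    (v : Fin m → k) (μ0 : ℤ) : Prop :=
  ∃ (s : Finset ℤ) (c : ℤ → (Fin m → k)),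
    (∀ n ∈ s, c n ∈ weightSpace X lam n ∧ c n ≠ 0) ∧
    v = ∑ n ∈ s, c n ∧ μ0 ∈ s ∧ ∀ n ∈ s, μ0 ≤ n

/-- `GL n k` itself, as an affine algebraic group. -/
def fullGL (k : Type) [Field k] (n : ℕ) : AlgGroup k where
  n := n
  toSubgroup := ⊤
  closed := ⟨∅, by intro A; simp [zeroLocus]⟩

/-- A subset `X ⊆ G^N` which is Zariski closed in `G^N`. -/
def GNClosed (G : AlgGroup k) (N : ℕ)
    (S : Set (Fin N → GL (Fin G.n) k)) : Prop :=
  ∃ I : Set (MvPolynomial (Fin N × (Fin G.n × Fin G.n)) k),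
    S = {x | (∀ i, x i ∈ G.toSubgroup) ∧
          ∀ f ∈ I, MvPolynomial.eval
            (fun p => ((x p.1 : Matrix (Fin G.n) (Fin G.n) k) p.2.1 p.2.2)) f = 0}

/-- Limits of the `lam`-ray through `x ∈ X ⊆ G^N`, for the simultaneous
conjugation action. -/
def GNLimit {G : AlgGroup k} {N : ℕ} (X : Set (Fin N → GL (Fin G.n) k))
    (lam : OnePS G) (x y : Fin N → GL (Fin G.n) k) : Prop :=
  y ∈ X ∧
  ∃ q : Fin N → Fin G.n × Fin G.n → Polynomial k,
    (∀ (t : kˣ) (i : Fin N) (ij : Fin G.n × Fin G.n),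
      ((lam.toFun t * x i * (lam.toFun t)⁻¹ : GL (Fin G.n) k) :
          Matrix (Fin G.n) (Fin G.n) k) ij.1 ij.2 = (q i ij).eval (t : k)) ∧
    ∀ (i : Fin N) (ij : Fin G.n × Fin G.n),
      (y i : Matrix (Fin G.n) (Fin G.n) k) ij.1 ij.2 = (q i ij).eval 0

/-- `lam ∈ Λ_x` for `x ∈ X ⊆ G^N`. -/
def GNInLambda {G : AlgGroup k} {N : ℕ} (X : Set (Fin N → GL (Fin G.n) k))
    (x : Fin N → GL (Fin G.n) k) (lam : OnePS G) : Prop :=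
  ∃ y, GNLimit X lam x y

/-- `H_x` for `x ∈ X ⊆ G^N`. -/
def GNHx {G : AlgGroup k} {N : ℕ} (X : Set (Fin N → GL (Fin G.n) k))
    (x : Fin N → GL (Fin G.n) k) : Set (GL (Fin G.n) k) :=
  {g | g ∈ G.toSubgroup ∧ ∀ lam : OnePS G, GNInLambda X x lam → g ∈ Pset lam}

/-- `φ_x`: the subgroup of `G` generated by the components of `x ∈ G^N`. -/
def phiSet {G : AlgGroup k} {N : ℕ} (x : Fin N → GL (Fin G.n) k) :
    Set (GL (Fin G.n) k) :=
  (Subgroup.closure (Set.range x) : Subgroup (GL (Fin G.n) k))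

/-- The orbit of `x ∈ G^N` under simultaneous conjugation. -/
def GNOrbit {G : AlgGroup k} {N : ℕ} (x : Fin N → GL (Fin G.n) k) :
    Set (Fin N → GL (Fin G.n) k) :=
  {y | ∃ g ∈ G.toSubgroup, y = fun i => g * x i * g⁻¹}

/-- Polystability of `x ∈ X ⊆ G^N`: the conjugation orbit is Zariski closed. -/
def GNPolystable (G : AlgGroup k) {N : ℕ} (x : Fin N → GL (Fin G.n) k) : Prop :=
  GNClosed G N (GNOrbit x)

/-- The stabilizer of `x ∈ G^N` under simultaneous conjugation. -/
def GNStab (G : AlgGroup k) {N : ℕ} (x : Fin N → GL (Fin G.n) k) :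
    Set (GL (Fin G.n) k) :=
  {g | g ∈ G.toSubgroup ∧ ∀ i, g * x i * g⁻¹ = x i}

/-- `G_X` for `X ⊆ G^N` with the simultaneous conjugation action. -/
def GNActionCenter (G : AlgGroup k) {N : ℕ}
    (X : Set (Fin N → GL (Fin G.n) k)) : Set (GL (Fin G.n) k) :=
  {g | g ∈ G.toSubgroup ∧ ∀ x ∈ X, ∀ i, g * x i * g⁻¹ = x i}

/-- `x ∈ X ⊆ G^N` is stable: polystable and `G_x/G_X` finite. -/
def GNStable (G : AlgGroup k) {N : ℕ} (X : Set (Fin N → GL (Fin G.n) k))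
    (x : Fin N → GL (Fin G.n) k) : Prop :=
  GNPolystable G x ∧
  Set.Finite ((fun g => (fun h => g * h) '' GNActionCenter G X) '' GNStab G x)

/-- `x ∈ X ⊆ G^N` is equicentral: polystable and `G_x = G_X`. -/
def GNEquicentral (G : AlgGroup k) {N : ℕ} (X : Set (Fin N → GL (Fin G.n) k))
    (x : Fin N → GL (Fin G.n) k) : Prop :=
  GNPolystable G x ∧ GNStab G x = GNActionCenter G X

/-- A subgroup `H ⊆ G` is isotropic: completely reducible with `Z_G(H) = Z(G)`. -/
def IsIsotropic (G : AlgGroup k) (H : Set (GL (Fin G.n) k)) : Prop :=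
  CompletelyReducible G H ∧ centralizerSet G H = centerSet G



/-! ### The coordinate ring of `GL n` in the variables `X = g`, `Y = g⁻¹` -/

section Coord

set_option linter.unusedSimpArgs false

variable {n : ℕ}

/-- Polynomials in the entries of `g` and of `g⁻¹`. -/
abbrev CRing (n : ℕ) (k : Type) [Field k] : Type :=
  MvPolynomial ((Fin n × Fin n) ⊕ (Fin n × Fin n)) k

/-- The point of affine space attached to an invertible matrix. -/
def ptGL (g : GL (Fin n) k) : (Fin n × Fin n) ⊕ (Fin n × Fin n) → k :=
  Sum.elim (fun p => (g : Matrix (Fin n) (Fin n) k) p.1 p.2)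
    (fun p => ((g⁻¹ : GL (Fin n) k) : Matrix (Fin n) (Fin n) k) p.1 p.2)

/-- Evaluation at a group element. -/
noncomputable def ev (g : GL (Fin n) k) : CRing n k →ₐ[k] k := MvPolynomial.aeval (ptGL g)

/-- The left invariant derivation attached to a matrix. -/
noncomputable def Dv (A : Matrix (Fin n) (Fin n) k) : Derivation k (CRing n k) (CRing n k) :=
  MvPolynomial.mkDerivation k (Sum.elim
    (fun p => ∑ l, MvPolynomial.X (Sum.inl (p.1, l)) * MvPolynomial.C (A l p.2))
    (fun p => -∑ l, MvPolynomial.C (A p.1 l) * MvPolynomial.X (Sum.inr (l, p.2))))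

/-- Right translation. -/
noncomputable def Rt (g : GL (Fin n) k) : CRing n k →ₐ[k] CRing n k :=
  MvPolynomial.aeval (Sum.elim
    (fun p => ∑ l, MvPolynomial.X (Sum.inl (p.1, l)) *
      MvPolynomial.C ((g : Matrix (Fin n) (Fin n) k) l p.2))
    (fun p => ∑ l, MvPolynomial.C (((g⁻¹ : GL (Fin n) k) : Matrix (Fin n) (Fin n) k) p.1 l) *
      MvPolynomial.X (Sum.inr (l, p.2))))

/-- Left translation. -/
noncomputable def Lt (g : GL (Fin n) k) : CRing n k →ₐ[k] CRing n k :=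
  MvPolynomial.aeval (Sum.elim
    (fun p => ∑ l, MvPolynomial.C ((g : Matrix (Fin n) (Fin n) k) p.1 l) *
      MvPolynomial.X (Sum.inl (l, p.2)))
    (fun p => ∑ l, MvPolynomial.X (Sum.inr (p.1, l)) *
      MvPolynomial.C (((g⁻¹ : GL (Fin n) k) : Matrix (Fin n) (Fin n) k) l p.2)))

lemma ev_inl (g : GL (Fin n) k) (p : Fin n × Fin n) :
    ev g (MvPolynomial.X (Sum.inl p)) = (g : Matrix (Fin n) (Fin n) k) p.1 p.2 := by
  simp [ev, ptGL]

lemma ev_inr (g : GL (Fin n) k) (p : Fin n × Fin n) :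
    ev g (MvPolynomial.X (Sum.inr p)) =
      ((g⁻¹ : GL (Fin n) k) : Matrix (Fin n) (Fin n) k) p.1 p.2 := by
  simp [ev, ptGL]

lemma ev_C (g : GL (Fin n) k) (a : k) : ev g (MvPolynomial.C a) = a := by
  simp [ev]

lemma Dv_inl (A : Matrix (Fin n) (Fin n) k) (p : Fin n × Fin n) :
    Dv A (MvPolynomial.X (Sum.inl p)) =
      ∑ l, MvPolynomial.X (Sum.inl (p.1, l)) * MvPolynomial.C (A l p.2) := by
  simp [Dv, MvPolynomial.mkDerivation_X]

lemma Dv_inr (A : Matrix (Fin n) (Fin n) k) (p : Fin n × Fin n) :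
    Dv A (MvPolynomial.X (Sum.inr p)) =
      -∑ l, MvPolynomial.C (A p.1 l) * MvPolynomial.X (Sum.inr (l, p.2)) := by
  simp [Dv, MvPolynomial.mkDerivation_X]

lemma Rt_inl (g : GL (Fin n) k) (p : Fin n × Fin n) :
    Rt g (MvPolynomial.X (Sum.inl p)) =
      ∑ l, MvPolynomial.X (Sum.inl (p.1, l)) *
        MvPolynomial.C ((g : Matrix (Fin n) (Fin n) k) l p.2) := by
  simp [Rt]

lemma Rt_inr (g : GL (Fin n) k) (p : Fin n × Fin n) :
    Rt g (MvPolynomial.X (Sum.inr p)) =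
      ∑ l, MvPolynomial.C (((g⁻¹ : GL (Fin n) k) : Matrix (Fin n) (Fin n) k) p.1 l) *
        MvPolynomial.X (Sum.inr (l, p.2)) := by
  simp [Rt]

lemma Lt_inl (g : GL (Fin n) k) (p : Fin n × Fin n) :
    Lt g (MvPolynomial.X (Sum.inl p)) =
      ∑ l, MvPolynomial.C ((g : Matrix (Fin n) (Fin n) k) p.1 l) *
        MvPolynomial.X (Sum.inl (l, p.2)) := by
  simp [Lt]

lemma Lt_inr (g : GL (Fin n) k) (p : Fin n × Fin n) :
    Lt g (MvPolynomial.X (Sum.inr p)) =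
      ∑ l, MvPolynomial.X (Sum.inr (p.1, l)) *
        MvPolynomial.C (((g⁻¹ : GL (Fin n) k) : Matrix (Fin n) (Fin n) k) l p.2) := by
  simp [Lt]

lemma Dv_C (A : Matrix (Fin n) (Fin n) k) (a : k) :
    Dv A (MvPolynomial.C a : CRing n k) = 0 := by
  simp [Dv]

lemma Dv_mul (A : Matrix (Fin n) (Fin n) k) (f g : CRing n k) :
    Dv A (f * g) = f * Dv A g + g * Dv A f := by
  simp [Derivation.leibniz]

lemma alg_C (φ : CRing n k →ₐ[k] CRing n k) (a : k) :
    φ (MvPolynomial.C a) = MvPolynomial.C a := φ.commutes a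

lemma ev_Rt (g h : GL (Fin n) k) (f : CRing n k) : ev g (Rt h f) = ev (g * h) f := by
  have : (ev g).comp (Rt h) = ev (g * h) := by
    apply MvPolynomial.algHom_ext
    rintro (p | p)
    · simp [Rt_inl, ev_inl, ev_C, Matrix.mul_apply]
    · simp only [AlgHom.comp_apply, Rt_inr, ev_inr, map_sum, map_mul, ev_C, mul_inv_rev,
        Units.val_mul, Matrix.mul_apply]
  exact DFunLike.congr_fun this f

lemma ev_Lt (g h : GL (Fin n) k) (f : CRing n k) : ev g (Lt h f) = ev (h * g) f := by
  have : (ev g).comp (Lt h) = ev (h * g) := by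
    apply MvPolynomial.algHom_ext
    rintro (p | p)
    · simp [Lt_inl, ev_inl, ev_C, Matrix.mul_apply]
    · simp only [AlgHom.comp_apply, Lt_inr, ev_inr, map_sum, map_mul, ev_C, mul_inv_rev,
        Units.val_mul, Matrix.mul_apply]
  exact DFunLike.congr_fun this f

lemma Dv_add (A B : Matrix (Fin n) (Fin n) k) : Dv (A + B) = Dv A + Dv B := by
  apply MvPolynomial.derivation_ext
  rintro (p | p)
  · simp [Dv_inl, mul_add, Finset.sum_add_distrib]
  · simp [Dv_inr, add_mul, Finset.sum_add_distrib, add_comm]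

lemma Dv_smul (c : k) (A : Matrix (Fin n) (Fin n) k) : Dv (c • A) = c • Dv A := by
  apply MvPolynomial.derivation_ext
  rintro (p | p)
  · simp [Dv_inl, MvPolynomial.smul_eq_C_mul, Finset.mul_sum]
    refine Finset.sum_congr rfl fun l _ => by ring
  · simp [Dv_inr, MvPolynomial.smul_eq_C_mul, Finset.mul_sum]
    refine Finset.sum_congr rfl fun l _ => by ring

/-- `Dv` as a linear map. -/
noncomputable def DvL (n : ℕ) (k : Type) [Field k] :
    Matrix (Fin n) (Fin n) k →ₗ[k] Derivation k (CRing n k) (CRing n k) where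
  toFun := Dv
  map_add' := Dv_add
  map_smul' := Dv_smul

lemma Dv_zero : Dv (0 : Matrix (Fin n) (Fin n) k) = 0 := (DvL n k).map_zero

lemma Dv_neg (A : Matrix (Fin n) (Fin n) k) : Dv (-A) = -Dv A := (DvL n k).map_neg A

lemma Dv_sub (A B : Matrix (Fin n) (Fin n) k) : Dv (A - B) = Dv A - Dv B :=
  (DvL n k).map_sub A B

lemma Dv_lie (A B : Matrix (Fin n) (Fin n) k) : Dv (A * B - B * A) = ⁅Dv A, Dv B⁆ := by
  have key : ∀ (A B : Matrix (Fin n) (Fin n) k) p,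
      Dv A (Dv B (MvPolynomial.X (Sum.inl p))) =
        ∑ l, MvPolynomial.X (Sum.inl (p.1, l)) * MvPolynomial.C ((A * B) l p.2) := by
    intro A B p
    rw [Dv_inl, map_sum]
    simp only [Dv_mul, Dv_C, Dv_inl, mul_zero, zero_add, Matrix.mul_apply, map_sum, map_mul,
      Finset.mul_sum]
    rw [Finset.sum_comm]
    refine Finset.sum_congr rfl fun l _ => Finset.sum_congr rfl fun j _ => by ring
  have key2 : ∀ (A B : Matrix (Fin n) (Fin n) k) p,
      Dv A (Dv B (MvPolynomial.X (Sum.inr p))) =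
        ∑ l, MvPolynomial.C ((B * A) p.1 l) * MvPolynomial.X (Sum.inr (l, p.2)) := by
    intro A B p
    rw [Dv_inr, map_neg, map_sum]
    simp only [Dv_mul, Dv_C, Dv_inr, mul_zero, add_zero, Matrix.mul_apply, map_sum, map_mul,
      Finset.mul_sum, Finset.sum_mul, mul_neg, Finset.sum_neg_distrib, neg_neg]
    rw [Finset.sum_comm]
    refine Finset.sum_congr rfl fun l _ => Finset.sum_congr rfl fun j _ => by ring
  apply MvPolynomial.derivation_ext
  rintro (p | p)
  · rw [Derivation.commutator_apply, key, key, Dv_inl, ← Finset.sum_sub_distrib]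
    refine Finset.sum_congr rfl fun l _ => ?_
    rw [Matrix.sub_apply, map_sub, mul_sub]
  · rw [Derivation.commutator_apply, key2, key2, Dv_inr, ← Finset.sum_sub_distrib,
      ← Finset.sum_neg_distrib]
    refine Finset.sum_congr rfl fun l _ => ?_
    rw [Matrix.sub_apply, map_sub, sub_mul]
    ring

lemma Lt_Dv (h : GL (Fin n) k) (A : Matrix (Fin n) (Fin n) k) (f : CRing n k) :
    Lt h (Dv A f) = Dv A (Lt h f) := by
  induction f using MvPolynomial.induction_on with
  | C a => simp [Dv_C, alg_C]
  | add p q hp hq => simp [hp, hq]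
  | mul_X p i hp =>
    simp only [Dv_mul, map_mul, map_add, hp]
    congr 2
    rcases i with p | p
    · simp only [Dv_inl, Lt_inl, map_sum, map_mul, alg_C, Dv_mul, Dv_C, mul_zero, add_zero,
        Finset.mul_sum, Finset.sum_mul]
      rw [Finset.sum_comm]
      refine Finset.sum_congr rfl fun l _ => Finset.sum_congr rfl fun j _ => by ring
    · simp only [Dv_inr, Lt_inr, map_sum, map_mul, alg_C, Dv_mul, Dv_C, mul_zero, zero_add,
        Finset.mul_sum, Finset.sum_mul, map_neg, mul_neg, Finset.sum_neg_distrib]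
      rw [neg_inj, Finset.sum_comm]
      refine Finset.sum_congr rfl fun l _ => Finset.sum_congr rfl fun j _ => by ring

lemma Rt_Dv (g : GL (Fin n) k) (A : Matrix (Fin n) (Fin n) k) (f : CRing n k) :
    Rt g (Dv A f) = Dv ((g : Matrix (Fin n) (Fin n) k) * A *
      ((g⁻¹ : GL (Fin n) k) : Matrix (Fin n) (Fin n) k)) (Rt g f) := by
  have e1 : ((g⁻¹ : GL (Fin n) k) : Matrix (Fin n) (Fin n) k) * (g : Matrix (Fin n) (Fin n) k)
      = 1 := by rw [← Units.val_mul, inv_mul_cancel, Units.val_one]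
  induction f using MvPolynomial.induction_on with
  | C a => simp [Dv_C, alg_C]
  | add p q hp hq => simp [hp, hq]
  | mul_X p i hp =>
    simp only [Dv_mul, map_mul, map_add, hp]
    congr 2
    set B := (g : Matrix (Fin n) (Fin n) k) * A *
      ((g⁻¹ : GL (Fin n) k) : Matrix (Fin n) (Fin n) k) with hB
    have hBg : B * (g : Matrix (Fin n) (Fin n) k) = (g : Matrix (Fin n) (Fin n) k) * A := by
      rw [hB, Matrix.mul_assoc, e1, Matrix.mul_one]
    have hgB : ((g⁻¹ : GL (Fin n) k) : Matrix (Fin n) (Fin n) k) * B =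
        A * ((g⁻¹ : GL (Fin n) k) : Matrix (Fin n) (Fin n) k) := by
      rw [hB, ← Matrix.mul_assoc, ← Matrix.mul_assoc, e1, Matrix.one_mul]
    rcases i with p | p
    · simp only [Dv_inl, Rt_inl, map_sum, map_mul, alg_C, Dv_mul, Dv_C, mul_zero, zero_add,
        Finset.mul_sum, Finset.sum_mul]
      have l1 : ∀ l, ((g : Matrix (Fin n) (Fin n) k) * A) l p.2 =
          (B * (g : Matrix (Fin n) (Fin n) k)) l p.2 := by intro l; rw [hBg]
      simp only [Matrix.mul_apply] at l1
      rw [Finset.sum_comm]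
      conv_rhs => rw [Finset.sum_comm]
      refine Finset.sum_congr rfl fun l _ => ?_
      have := congrArg (fun z => MvPolynomial.X (Sum.inl (p.1, l)) *
        (MvPolynomial.C z : CRing n k)) (l1 l)
      simp only [map_sum, map_mul, Finset.mul_sum] at this
      simp only [mul_assoc]
      rw [this]
      refine Finset.sum_congr rfl fun j _ => by ring
    · simp only [Dv_inr, Rt_inr, map_sum, map_mul, alg_C, Dv_mul, Dv_C, mul_zero, add_zero,
        Finset.mul_sum, Finset.sum_mul, map_neg, mul_neg, Finset.sum_neg_distrib]
      rw [neg_inj]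
      have l1 : ∀ l, (A * ((g⁻¹ : GL (Fin n) k) : Matrix (Fin n) (Fin n) k)) p.1 l =
          (((g⁻¹ : GL (Fin n) k) : Matrix (Fin n) (Fin n) k) * B) p.1 l := by
        intro l; rw [hgB]
      simp only [Matrix.mul_apply] at l1
      rw [Finset.sum_comm]
      conv_rhs => rw [Finset.sum_comm]
      refine Finset.sum_congr rfl fun l _ => ?_
      have := congrArg (fun z => (MvPolynomial.C z : CRing n k) *
        MvPolynomial.X (Sum.inr (l, p.2))) (l1 l)
      simp only [map_sum, map_mul, Finset.sum_mul] at this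
      simp only [← mul_assoc]
      rw [this]

/-- The ideal of polynomials vanishing on a set of group elements. -/
def Iv (H : Set (GL (Fin n) k)) : Ideal (CRing n k) where
  carrier := {f | ∀ g ∈ H, ev g f = 0}
  add_mem' := by intro a b ha hb g hg; rw [map_add, ha g hg, hb g hg, add_zero]
  zero_mem' := by intro g _; exact map_zero _
  smul_mem' := by intro c f hf g hg; rw [smul_eq_mul, map_mul, hf g hg, mul_zero]

lemma mem_Iv {H : Set (GL (Fin n) k)} {f : CRing n k} : f ∈ Iv H ↔ ∀ g ∈ H, ev g f = 0 :=
  Iff.rfl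

/-- `H` is cut out by the polynomials vanishing on it. -/
def ZC (H : Set (GL (Fin n) k)) : Prop := ∀ g, (∀ f ∈ Iv H, ev g f = 0) → g ∈ H

/-- The Lie algebra of `H`. -/
def lieS (H : Set (GL (Fin n) k)) : Submodule k (Matrix (Fin n) (Fin n) k) where
  carrier := {A | ∀ f ∈ Iv H, Dv A f ∈ Iv H}
  add_mem' := by
    intro A B hA hB f hf
    rw [Dv_add, Derivation.add_apply]
    exact add_mem (hA f hf) (hB f hf)
  zero_mem' := by
    intro f hf
    rw [Dv_zero]
    exact zero_mem _
  smul_mem' := by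
    intro c A hA f hf
    rw [Dv_smul, Derivation.smul_apply, MvPolynomial.smul_eq_C_mul]
    exact Ideal.mul_mem_left _ _ (hA f hf)

lemma mem_lieS {H : Set (GL (Fin n) k)} {A : Matrix (Fin n) (Fin n) k} :
    A ∈ lieS H ↔ ∀ f ∈ Iv H, Dv A f ∈ Iv H := Iff.rfl

lemma lieS_lie {H : Set (GL (Fin n) k)} {A B : Matrix (Fin n) (Fin n) k}
    (hA : A ∈ lieS H) (hB : B ∈ lieS H) : A * B - B * A ∈ lieS H := by
  intro f hf
  rw [Dv_lie, Derivation.commutator_apply]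
  exact sub_mem (hA _ (hB f hf)) (hB _ (hA f hf))

lemma Lt_mem {H : Subgroup (GL (Fin n) k)} {h : GL (Fin n) k} (hh : h ∈ H) {f : CRing n k}
    (hf : f ∈ Iv (H : Set (GL (Fin n) k))) : Lt h f ∈ Iv (H : Set (GL (Fin n) k)) := by
  intro g hg
  rw [ev_Lt]
  exact hf _ (H.mul_mem hh hg)

lemma Rt_mem {H : Subgroup (GL (Fin n) k)} {h : GL (Fin n) k} (hh : h ∈ H) {f : CRing n k}
    (hf : f ∈ Iv (H : Set (GL (Fin n) k))) : Rt h f ∈ Iv (H : Set (GL (Fin n) k)) := by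
  intro g hg
  rw [ev_Rt]
  exact hf _ (H.mul_mem hg hh)

lemma lieS_of_tangent {H : Subgroup (GL (Fin n) k)} {A : Matrix (Fin n) (Fin n) k}
    (hA : ∀ f ∈ Iv (H : Set (GL (Fin n) k)), ev 1 (Dv A f) = 0) :
    A ∈ lieS (H : Set (GL (Fin n) k)) := by
  intro f hf g hg
  have := hA _ (Lt_mem hg hf)
  rwa [← Lt_Dv, ev_Lt, mul_one] at this

lemma lieS_conj {H : Subgroup (GL (Fin n) k)} {A : Matrix (Fin n) (Fin n) k}
    (hA : A ∈ lieS (H : Set (GL (Fin n) k))) {g : GL (Fin n) k} (hg : g ∈ H) :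
    (g : Matrix (Fin n) (Fin n) k) * A * ((g⁻¹ : GL (Fin n) k) : Matrix (Fin n) (Fin n) k) ∈
      lieS (H : Set (GL (Fin n) k)) := by
  intro f hf
  have h1 : Rt g (Rt g⁻¹ f) = f := by
    have : (Rt g).comp (Rt g⁻¹) = AlgHom.id k (CRing n k) := by
      have e1 : ((g⁻¹ : GL (Fin n) k) : Matrix (Fin n) (Fin n) k) *
          (g : Matrix (Fin n) (Fin n) k) = 1 := by
        rw [← Units.val_mul, inv_mul_cancel, Units.val_one]
      have e2 : (g : Matrix (Fin n) (Fin n) k) *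
          ((g⁻¹ : GL (Fin n) k) : Matrix (Fin n) (Fin n) k) = 1 := by
        rw [← Units.val_mul, mul_inv_cancel, Units.val_one]
      apply MvPolynomial.algHom_ext
      rintro (p | p)
      · simp only [AlgHom.comp_apply, Rt_inl, map_sum, map_mul, alg_C, Finset.sum_mul,
          AlgHom.id_apply]
        rw [Finset.sum_comm]
        simp only [mul_assoc, ← Finset.mul_sum, ← map_mul, ← map_sum]
        simp only [← Matrix.mul_apply, e2]
        rw [Finset.sum_eq_single p.2]
        · simp
        · intro b _ hb; rw [Matrix.one_apply_ne hb]; simp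
        · simp
      · simp only [AlgHom.comp_apply, Rt_inr, map_sum, map_mul, alg_C, Finset.mul_sum,
          AlgHom.id_apply, inv_inv]
        rw [Finset.sum_comm]
        simp only [← mul_assoc, ← Finset.sum_mul, ← map_mul, ← map_sum]
        simp only [← Matrix.mul_apply, e2]
        rw [Finset.sum_eq_single p.1]
        · simp
        · intro b _ hb; rw [Matrix.one_apply_ne hb.symm]; simp
        · simp
    exact DFunLike.congr_fun this f
  rw [← h1, ← Rt_Dv]
  exact Rt_mem hg (hA _ (Rt_mem (H.inv_mem hg) hf))

end Coord


section Curves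

set_option linter.unusedSimpArgs false
set_option linter.unusedSectionVars false

variable {n : ℕ}

/-- The derivation `Dv A` as an endomorphism. -/
noncomputable def DE (A : Matrix (Fin n) (Fin n) k) : Module.End k (CRing n k) :=
  (Dv A).toLinearMap

lemma DE_apply (A : Matrix (Fin n) (Fin n) k) (f : CRing n k) : DE A f = Dv A f := rfl

lemma DE_pow_mul (A : Matrix (Fin n) (Fin n) k) : ∀ (c a b : ℕ), a + b ≤ c →
    ∀ f g : CRing n k, (DE A ^ a) f = 0 → (DE A ^ b) g = 0 → (DE A ^ c) (f * g) = 0 := by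
  intro c
  induction c with
  | zero =>
    intro a b hab f g hf hg
    obtain rfl : a = 0 := by omega
    simp only [pow_zero, Module.End.one_apply] at hf
    simp [hf]
  | succ c ih =>
    intro a b hab f g hf hg
    rcases a with _ | a
    · simp only [pow_zero, Module.End.one_apply] at hf
      simp [hf]
    rcases b with _ | b
    · simp only [pow_zero, Module.End.one_apply] at hg
      simp [hg]
    rw [pow_succ, Module.End.mul_apply, DE_apply, Dv_mul, map_add]
    have h1 : (DE A ^ c) (f * Dv A g) = 0 := by
      refine ih (a + 1) b (by omega) f _ hf ?_
      rwa [pow_succ, Module.End.mul_apply, DE_apply] at hg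
    have h2 : (DE A ^ c) (g * Dv A f) = 0 := by
      refine ih (b + 1) a (by omega) g _ hg ?_
      rwa [pow_succ, Module.End.mul_apply, DE_apply] at hf
    rw [h1, h2, add_zero]

lemma DE_pow_le {A : Matrix (Fin n) (Fin n) k} {a b : ℕ} (hab : a ≤ b) {f : CRing n k}
    (hf : (DE A ^ a) f = 0) : (DE A ^ b) f = 0 := by
  obtain ⟨c, rfl⟩ := Nat.exists_eq_add_of_le hab
  rw [add_comm, pow_add, Module.End.mul_apply, hf, map_zero]

lemma DE_pow_inl (A : Matrix (Fin n) (Fin n) k) (m : ℕ) (p : Fin n × Fin n) :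
    (DE A ^ m) (MvPolynomial.X (Sum.inl p)) =
      ∑ l, MvPolynomial.X (Sum.inl (p.1, l)) * MvPolynomial.C ((A ^ m) l p.2) := by
  induction m with
  | zero =>
    simp only [pow_zero, Module.End.one_apply]
    rw [Finset.sum_eq_single p.2]
    · simp
    · intro b _ hb; rw [Matrix.one_apply_ne hb]; simp
    · simp
  | succ m ih =>
    rw [pow_succ', Module.End.mul_apply, ih, map_sum]
    simp only [DE_apply, Dv_mul, Dv_C, Dv_inl, mul_zero, zero_add, pow_succ', Matrix.mul_apply,
      map_sum, map_mul, Finset.mul_sum]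
    rw [Finset.sum_comm]
    refine Finset.sum_congr rfl fun l _ => Finset.sum_congr rfl fun j _ => by ring

lemma DE_pow_inr (A : Matrix (Fin n) (Fin n) k) (m : ℕ) (p : Fin n × Fin n) :
    (DE A ^ m) (MvPolynomial.X (Sum.inr p)) =
      ∑ l, MvPolynomial.C (((-A) ^ m) p.1 l) * MvPolynomial.X (Sum.inr (l, p.2)) := by
  induction m with
  | zero =>
    simp only [pow_zero, Module.End.one_apply]
    rw [Finset.sum_eq_single p.1]
    · simp
    · intro b _ hb; rw [Matrix.one_apply_ne hb.symm]; simp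
    · simp
  | succ m ih =>
    rw [pow_succ', Module.End.mul_apply, ih, map_sum]
    simp only [DE_apply, Dv_mul, Dv_C, Dv_inr, mul_zero, add_zero, pow_succ, Matrix.mul_apply,
      map_sum, map_mul, Finset.mul_sum, Finset.sum_mul, mul_neg, Matrix.neg_apply, map_neg,
      neg_mul, Finset.sum_neg_distrib]
    rw [Finset.sum_comm]
    rw [neg_inj]
    refine Finset.sum_congr rfl fun l _ => Finset.sum_congr rfl fun j _ => by ring

lemma DE_locally_nilpotent {N : Matrix (Fin n) (Fin n) k} (hN : IsNilpotent N)
    (f : CRing n k) : ∃ m, (DE N ^ m) f = 0 := by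
  obtain ⟨m, hm⟩ := hN
  induction f using MvPolynomial.induction_on with
  | C a => exact ⟨1, by rw [pow_one, DE_apply, Dv_C]⟩
  | add p q hp hq =>
    obtain ⟨a, ha⟩ := hp
    obtain ⟨b, hb⟩ := hq
    exact ⟨a + b, by rw [map_add, DE_pow_le (by omega) ha, DE_pow_le (by omega) hb, add_zero]⟩
  | mul_X p i hp =>
    obtain ⟨a, ha⟩ := hp
    refine ⟨a + m, DE_pow_mul N _ a m le_rfl _ _ ha ?_⟩
    rcases i with i | i
    · rw [DE_pow_inl, hm]; simp
    · rw [DE_pow_inr, neg_pow, hm]; simp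

/-- Every element lies in a finite dimensional subspace stable under all `Dv A`. -/
lemma locally_finite (f : CRing n k) : ∃ W : Submodule k (CRing n k), W.FG ∧ f ∈ W ∧
    ∀ A, ∀ w ∈ W, Dv A w ∈ W := by
  induction f using MvPolynomial.induction_on with
  | C a =>
    refine ⟨Submodule.span k {1}, Submodule.fg_span_singleton _, ?_, ?_⟩
    · rw [Submodule.mem_span_singleton]
      exact ⟨a, by rw [MvPolynomial.smul_eq_C_mul, mul_one]⟩
    · intro A w hw
      rw [Submodule.mem_span_singleton] at hw
      obtain ⟨c, rfl⟩ := hw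
      simp
  | add p q hp hq =>
    obtain ⟨W, h1, h2, h3⟩ := hp
    obtain ⟨W', h1', h2', h3'⟩ := hq
    refine ⟨W ⊔ W', h1.sup h1', Submodule.add_mem_sup h2 h2', ?_⟩
    intro A w hw
    obtain ⟨a, ha, b, hb, rfl⟩ := Submodule.mem_sup.1 hw
    rw [map_add]
    exact Submodule.add_mem_sup (h3 A a ha) (h3' A b hb)
  | mul_X p i hp =>
    obtain ⟨W, h1, h2, h3⟩ := hp
    have hX : ∀ i, MvPolynomial.X i ∈
      Submodule.span k (Set.range (MvPolynomial.X :
        (Fin n × Fin n) ⊕ (Fin n × Fin n) → CRing n k)) :=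
      fun i => Submodule.subset_span ⟨i, rfl⟩
    refine ⟨W * Submodule.span k (Set.range MvPolynomial.X),
      h1.mul (Submodule.fg_span (Set.finite_range _)), Submodule.mul_mem_mul h2 (hX i), ?_⟩
    intro A w hw
    induction hw using Submodule.mul_induction_on' with
    | add x _ y _ hx hy => rw [map_add]; exact add_mem hx hy
    | mem_mul_mem a ha b hb =>
      rw [Dv_mul, mul_comm b]
      refine add_mem (Submodule.mul_mem_mul ha ?_) (Submodule.mul_mem_mul (h3 A a ha) hb)
      induction hb using Submodule.span_induction with
      | zero => rw [map_zero]; exact zero_mem _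
      | add x y _ _ hx hy => rw [map_add]; exact add_mem hx hy
      | smul c x _ hx => rw [Derivation.map_smul]; exact Submodule.smul_mem _ _ hx
      | mem x hx =>
        obtain ⟨i, rfl⟩ := hx
        rcases i with i | i
        · rw [Dv_inl]
          refine sum_mem fun l _ => ?_
          rw [mul_comm, ← MvPolynomial.smul_eq_C_mul]
          exact Submodule.smul_mem _ _ (hX _)
        · rw [Dv_inr]
          refine neg_mem (sum_mem fun l _ => ?_)
          rw [← MvPolynomial.smul_eq_C_mul]
          exact Submodule.smul_mem _ _ (hX _)

variable [CharZero k]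

/-- The unipotent element `exp (s N)`. -/
noncomputable def uGL (N : Matrix (Fin n) (Fin n) k) (hN : IsNilpotent N) (s : k) :
    GL (Fin n) k :=
  ⟨IsNilpotent.exp (s • N), IsNilpotent.exp (-(s • N)),
    IsNilpotent.exp_mul_exp_neg_self (hN.smul s), IsNilpotent.exp_neg_mul_exp_self (hN.smul s)⟩

lemma uGL_val (N : Matrix (Fin n) (Fin n) k) (hN : IsNilpotent N) (s : k) :
    (uGL N hN s : Matrix (Fin n) (Fin n) k) = IsNilpotent.exp (s • N) := rfl

lemma uGL_inv_val (N : Matrix (Fin n) (Fin n) k) (hN : IsNilpotent N) (s : k) :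
    ((uGL N hN s)⁻¹ : GL (Fin n) k) = IsNilpotent.exp (-(s • N)) := rfl

lemma uGL_zero (N : Matrix (Fin n) (Fin n) k) (hN : IsNilpotent N) : uGL N hN 0 = 1 := by
  apply Units.ext
  rw [uGL_val, zero_smul, IsNilpotent.exp_zero, Units.val_one]

lemma uGL_add (N : Matrix (Fin n) (Fin n) k) (hN : IsNilpotent N) (s t : k) :
    uGL N hN (s + t) = uGL N hN s * uGL N hN t := by
  apply Units.ext
  rw [Units.val_mul, uGL_val, uGL_val, uGL_val, add_smul]
  exact IsNilpotent.exp_add_of_commute (((Commute.refl N).smul_right t).smul_left s)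
    (hN.smul s) (hN.smul t)

/-- Polynomial version of the exponential. -/
noncomputable def expP (N : Matrix (Fin n) (Fin n) k) (M : ℕ) :
    Matrix (Fin n) (Fin n) (Polynomial k) :=
  fun i j => ∑ r ∈ Finset.range M, Polynomial.monomial r (((r.factorial : k))⁻¹ * (N ^ r) i j)

lemma expP_eval {N : Matrix (Fin n) (Fin n) k} {M : ℕ} (hM : N ^ M = 0) (s : k)
    (i j : Fin n) : (expP N M i j).eval s = IsNilpotent.exp (s • N) i j := by
  rw [IsNilpotent.exp_eq_sum (k := M) (by rw [smul_pow, hM, smul_zero])]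
  rw [expP, Polynomial.eval_finsetSum, Matrix.sum_apply]
  refine Finset.sum_congr rfl fun r _ => ?_
  rw [Polynomial.eval_monomial, smul_pow, Matrix.smul_apply, Matrix.smul_apply, Rat.smul_def]
  push_cast
  rw [smul_eq_mul]
  ring

lemma expP_derivative {N : Matrix (Fin n) (Fin n) k} {M : ℕ} (hM : N ^ M = 0)
    (i j : Fin n) : Polynomial.derivative (expP N M i j) =
      ∑ l, expP N M i l * Polynomial.C (N l j) := by
  have h1 : ∀ r, Polynomial.derivative
      (Polynomial.monomial (r + 1) ((((r + 1).factorial : k))⁻¹ * (N ^ (r + 1)) i j)) =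
      Polynomial.monomial r (((r.factorial : k))⁻¹ * (N ^ (r + 1)) i j) := by
    intro r
    rw [Polynomial.derivative_monomial]
    congr 1
    rw [Nat.factorial_succ]
    have : ((r : k) + 1) ≠ 0 := Nat.cast_add_one_ne_zero r
    have h2 : (r.factorial : k) ≠ 0 := by exact_mod_cast r.factorial_ne_zero
    push_cast
    field_simp
  have h2 : ∑ l, expP N M i l * Polynomial.C (N l j) =
      ∑ r ∈ Finset.range M, Polynomial.monomial r (((r.factorial : k))⁻¹ * (N ^ (r + 1)) i j) := by
    simp only [expP, Finset.sum_mul]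
    rw [Finset.sum_comm]
    refine Finset.sum_congr rfl fun r _ => ?_
    rw [pow_succ, Matrix.mul_apply, Finset.mul_sum, map_sum]
    refine Finset.sum_congr rfl fun l _ => ?_
    rw [Polynomial.monomial_mul_C, mul_assoc]
  rw [h2, expP]
  rcases M with _ | M
  · simp
  · rw [Finset.sum_range_succ', Finset.sum_range_succ, hM]
    simp only [map_add, map_sum, h1]
    simp

lemma expP_derivative' {N : Matrix (Fin n) (Fin n) k} {M : ℕ} (hM : N ^ M = 0)
    (i j : Fin n) : Polynomial.derivative (expP N M i j) =
      ∑ l, Polynomial.C (N i l) * expP N M l j := by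
  rw [expP_derivative hM]
  simp only [expP, Finset.sum_mul, Finset.mul_sum, Polynomial.monomial_mul_C,
    Polynomial.C_mul_monomial]
  rw [Finset.sum_comm]
  conv_rhs => rw [Finset.sum_comm]
  refine Finset.sum_congr rfl fun r _ => ?_
  rw [← map_sum, ← map_sum]
  congr 1
  have := congrFun (congrFun ((pow_succ N r).symm.trans (pow_succ' N r)) i) j
  rw [Matrix.mul_apply, Matrix.mul_apply] at this
  have h3 := congrArg (fun z => ((r.factorial : k))⁻¹ * z) this
  simp only [Finset.mul_sum] at h3
  convert h3 using 2 <;> ring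

/-- The restriction of polynomials to the curve `s ↦ g exp (s N)`. -/
noncomputable def QC (g : GL (Fin n) k) (N : Matrix (Fin n) (Fin n) k) (M : ℕ) :
    CRing n k →ₐ[k] Polynomial k :=
  MvPolynomial.aeval (Sum.elim
    (fun p => ∑ l, Polynomial.C ((g : Matrix (Fin n) (Fin n) k) p.1 l) * expP N M l p.2)
    (fun p => ∑ l, expP (-N) M p.1 l *
      Polynomial.C (((g⁻¹ : GL (Fin n) k) : Matrix (Fin n) (Fin n) k) l p.2)))

lemma QC_inl (g : GL (Fin n) k) (N : Matrix (Fin n) (Fin n) k) (M : ℕ) (p : Fin n × Fin n) :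
    QC g N M (MvPolynomial.X (Sum.inl p)) =
      ∑ l, Polynomial.C ((g : Matrix (Fin n) (Fin n) k) p.1 l) * expP N M l p.2 := by
  simp [QC]

lemma QC_inr (g : GL (Fin n) k) (N : Matrix (Fin n) (Fin n) k) (M : ℕ) (p : Fin n × Fin n) :
    QC g N M (MvPolynomial.X (Sum.inr p)) =
      ∑ l, expP (-N) M p.1 l *
      Polynomial.C (((g⁻¹ : GL (Fin n) k) : Matrix (Fin n) (Fin n) k) l p.2) := by
  simp [QC]

lemma QC_C (g : GL (Fin n) k) (N : Matrix (Fin n) (Fin n) k) (M : ℕ) (a : k) :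
    QC g N M (MvPolynomial.C a) = Polynomial.C a := (QC g N M).commutes a

lemma QC_eval (g : GL (Fin n) k) {N : Matrix (Fin n) (Fin n) k} (hN : IsNilpotent N) {M : ℕ}
    (hM : N ^ M = 0) (s : k) (f : CRing n k) :
    (QC g N M f).eval s = ev (g * uGL N hN s) f := by
  have hM' : (-N) ^ M = 0 := by rw [neg_pow, hM, mul_zero]
  induction f using MvPolynomial.induction_on with
  | C a => rw [QC_C, ev_C, Polynomial.eval_C]
  | add p q hp hq => rw [map_add, map_add, Polynomial.eval_add, hp, hq]
  | mul_X p i hp =>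
    rw [map_mul, map_mul, Polynomial.eval_mul, hp]
    congr 1
    rcases i with i | i
    · rw [QC_inl, ev_inl, Units.val_mul, Matrix.mul_apply, Polynomial.eval_finsetSum]
      refine Finset.sum_congr rfl fun l _ => ?_
      rw [Polynomial.eval_mul, Polynomial.eval_C, expP_eval hM, uGL_val]
    · rw [QC_inr, ev_inr, mul_inv_rev, Units.val_mul, Matrix.mul_apply, Polynomial.eval_finsetSum]
      refine Finset.sum_congr rfl fun l _ => ?_
      rw [Polynomial.eval_mul, Polynomial.eval_C, expP_eval hM', uGL_inv_val, smul_neg]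

lemma QC_derivative (g : GL (Fin n) k) {N : Matrix (Fin n) (Fin n) k} {M : ℕ}
    (hM : N ^ M = 0) (f : CRing n k) :
    Polynomial.derivative (QC g N M f) = QC g N M (Dv N f) := by
  have hM' : (-N) ^ M = 0 := by rw [neg_pow, hM, mul_zero]
  induction f using MvPolynomial.induction_on with
  | C a => rw [QC_C, Dv_C, Polynomial.derivative_C, map_zero]
  | add p q hp hq => rw [map_add, map_add, map_add, map_add, hp, hq]
  | mul_X p i hp =>
    have h : Polynomial.derivative (QC g N M (MvPolynomial.X i)) =
        QC g N M (Dv N (MvPolynomial.X i)) := by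
      rcases i with i | i
      · rw [QC_inl, Dv_inl]
        simp only [map_sum, map_mul, QC_inl, QC_C, Polynomial.derivative_mul,
          Polynomial.derivative_C, zero_mul, zero_add, expP_derivative hM, Finset.mul_sum,
          Finset.sum_mul]
        rw [Finset.sum_comm]
        refine Finset.sum_congr rfl fun l _ => Finset.sum_congr rfl fun j _ => by ring
      · rw [QC_inr, Dv_inr]
        simp only [map_sum, map_mul, map_neg, QC_inr, QC_C, Polynomial.derivative_mul,
          Polynomial.derivative_C, mul_zero, add_zero, expP_derivative' hM', Finset.mul_sum,
          Finset.sum_mul, Matrix.neg_apply, neg_mul, Finset.sum_neg_distrib]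
        rw [Finset.sum_comm, neg_inj]
        refine Finset.sum_congr rfl fun l _ => Finset.sum_congr rfl fun j _ => by ring
    rw [map_mul, Polynomial.derivative_mul, Dv_mul, map_add, map_mul, map_mul, hp, h]
    ring

/-- Curve lemma: a polynomial constant on `g exp(sN)` has zero derivative. -/
lemma Dv_eq_zero_of_const (g : GL (Fin n) k) {N : Matrix (Fin n) (Fin n) k}
    (hN : IsNilpotent N) (f : CRing n k)
    (h : ∀ s, ev (g * uGL N hN s) f = ev g f) : ev g (Dv N f) = 0 := by
  obtain ⟨M, hM⟩ := id hN
  have h1 : QC g N M f = Polynomial.C (ev g f) := by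
    apply Polynomial.funext
    intro s
    rw [QC_eval g hN hM, h, Polynomial.eval_C]
  have h2 := QC_derivative g hM f
  rw [h1, Polynomial.derivative_C] at h2
  have h3 := QC_eval g hN hM 0 (Dv N f)
  rw [← h2, uGL_zero, mul_one, Polynomial.eval_zero] at h3
  exact h3.symm

lemma uGL_mem {H : Subgroup (GL (Fin n) k)} (hH : ZC (H : Set (GL (Fin n) k)))
    {N : Matrix (Fin n) (Fin n) k} (hN : IsNilpotent N)
    (hL : N ∈ lieS (H : Set (GL (Fin n) k))) (s : k) : uGL N hN s ∈ H := by
  apply hH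
  intro f hf
  obtain ⟨M, hM⟩ := id hN
  have h1 : ∀ j : ℕ, ∀ f ∈ Iv (H : Set (GL (Fin n) k)), (DE N ^ j) f = 0 → QC 1 N M f = 0 := by
    intro j
    induction j with
    | zero =>
      intro f _ h
      rw [pow_zero, Module.End.one_apply] at h
      rw [h, map_zero]
    | succ j ih =>
      intro f hf h
      rw [pow_succ, Module.End.mul_apply] at h
      have h2 := ih _ (hL f hf) h
      rw [← QC_derivative 1 hM] at h2
      have h3 := Polynomial.derivative_eq_zero.1 h2
      rw [Polynomial.eq_C_of_natDegree_eq_zero h3]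
      have h4 := QC_eval 1 hN hM 0 f
      rw [uGL_zero, mul_one, hf 1 H.one_mem, ← Polynomial.coeff_zero_eq_eval_zero] at h4
      rw [h4, map_zero]
  obtain ⟨m, hm⟩ := DE_locally_nilpotent hN f
  have h5 := QC_eval 1 hN hM s f
  rw [h1 m f hf hm, one_mul, Polynomial.eval_zero] at h5
  exact h5.symm

end Curves


section Grading

set_option linter.unusedSimpArgs false
set_option linter.unusedSectionVars false

lemma le_of_indep {ι V : Type*} [AddCommGroup V] [Module k V] {M T : ι → Submodule k V}
    (hM : iSupIndep M) (hT : ∀ i, T i ≤ M i) (htop : ⨆ i, T i = ⊤) (c : ι) : M c ≤ T c := by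
  intro m hm
  have h1 : m ∈ ⨆ i, T i := htop ▸ Submodule.mem_top
  have h2 : m ∈ T c ⊔ ⨆ j, ⨆ (_ : j ≠ c), T j := by
    refine (iSup_le fun i => ?_ : ⨆ i, T i ≤ _) h1
    by_cases hi : i = c
    · subst hi; exact le_sup_left
    · exact le_sup_of_le_right (le_iSup₂_of_le i hi le_rfl)
  obtain ⟨t, ht, s, hs, rfl⟩ := Submodule.mem_sup.1 h2
  have h3 : s ∈ M c := by
    have := sub_mem hm (hT c ht)
    simpa using this
  have h4 : s ∈ ⨆ j, ⨆ (_ : j ≠ c), M j := iSup₂_mono (fun j _ => hT j) hs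
  have h5 : s = 0 := Submodule.disjoint_def.1 (hM c) s h3 h4
  rw [h5, add_zero]
  exact ht

lemma maxGen_le_eigen {V : Type*} [AddCommGroup V] [Module k V] {T Ts Tn : Module.End k V}
    (hT : T = Ts + Tn) (hc : Commute Ts Tn) (htop : ⨆ c, Ts.eigenspace c = ⊤)
    (hn : ∀ v, ∃ m, (Tn ^ m) v = 0) (c : k) : T.maxGenEigenspace c ≤ Ts.eigenspace c := by
  refine le_of_indep T.independent_maxGenEigenspace (fun c => ?_) htop c
  intro v hv
  rw [Module.End.mem_eigenspace_iff] at hv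
  obtain ⟨m, hm⟩ := hn v
  rw [Module.End.mem_maxGenEigenspace]
  refine ⟨m, ?_⟩
  have key : ∀ m : ℕ, ((T - c • (1 : Module.End k V)) ^ m) v = (Tn ^ m) v ∧
      Ts ((Tn ^ m) v) = c • (Tn ^ m) v := by
    intro m
    induction m with
    | zero => exact ⟨rfl, by simpa using hv⟩
    | succ m ih =>
      constructor
      · rw [pow_succ', pow_succ', Module.End.mul_apply, Module.End.mul_apply, ih.1, hT]
        simp [ih.2]
      · rw [pow_succ', Module.End.mul_apply]
        have := LinearMap.congr_fun hc ((Tn ^ m) v)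
        simp only [Module.End.mul_apply] at this
        rw [this, ih.2, map_smul]
  rw [(key m).1, hm]

lemma stable_decomp [IsAlgClosed k] {V : Type*} [AddCommGroup V] [Module k V]
    (T : Module.End k V) (U : Submodule k V) (hU : ∀ u ∈ U, T u ∈ U)
    (hlf : ∀ v, ∃ W : Submodule k V, W.FG ∧ v ∈ W ∧ ∀ w ∈ W, T w ∈ W) (u : V) (hu : u ∈ U) :
    u ∈ ⨆ c, U ⊓ T.maxGenEigenspace c := by
  obtain ⟨W, hW, huW, hTW⟩ := hlf u
  have hfd : FiniteDimensional k W := Module.Finite.iff_fg.2 hW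
  have hfd' : FiniteDimensional k (U ⊓ W : Submodule k V) :=
    Submodule.finiteDimensional_of_le (inf_le_right : U ⊓ W ≤ W)
  have hst : ∀ w ∈ U ⊓ W, T w ∈ U ⊓ W := fun w hw => ⟨hU w hw.1, hTW w hw.2⟩
  let T' : Module.End k (U ⊓ W : Submodule k V) := T.restrict hst
  have h1 : (⟨u, hu, huW⟩ : (U ⊓ W : Submodule k V)) ∈ ⨆ c, T'.maxGenEigenspace c := by
    rw [Module.End.iSup_maxGenEigenspace_eq_top]
    exact Submodule.mem_top
  have h2 : ∀ w : (U ⊓ W : Submodule k V), w ∈ ⨆ c, T'.maxGenEigenspace c →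
      (w : V) ∈ ⨆ c, U ⊓ T.maxGenEigenspace c := by
    intro w hw
    induction hw using Submodule.iSup_induction' with
    | zero => exact zero_mem _
    | add x y _ _ hx hy => exact add_mem hx hy
    | mem c x hx =>
      refine Submodule.mem_iSup_of_mem c ⟨x.2.1, ?_⟩
      rw [Module.End.mem_maxGenEigenspace] at hx
      rw [SetLike.mem_coe, Module.End.mem_maxGenEigenspace]
      obtain ⟨m, hm⟩ := hx
      refine ⟨m, ?_⟩
      have key : ∀ m : ℕ, ((((T' - c • 1) ^ m) x : (U ⊓ W : Submodule k V)) : V) =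
          ((T - c • 1) ^ m) x := by
        intro m
        induction m with
        | zero => rfl
        | succ m ih =>
          rw [pow_succ', pow_succ', Module.End.mul_apply, Module.End.mul_apply, ← ih]
          simp [T']
      rw [← key, hm]
      rfl
  exact h2 _ h1

variable {n : ℕ}

/-- Conjugated diagonal matrices. -/
noncomputable def cdg (P : GL (Fin n) k) (a : Fin n → k) : Matrix (Fin n) (Fin n) k :=
  (P : Matrix (Fin n) (Fin n) k) * Matrix.diagonal a *
    ((P⁻¹ : GL (Fin n) k) : Matrix (Fin n) (Fin n) k)

/-- Diagonal group elements. -/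
def dGL (t : Fin n → kˣ) : GL (Fin n) k :=
  ⟨Matrix.diagonal fun i => (t i : k), Matrix.diagonal fun i => ((t i)⁻¹ : kˣ),
    by rw [Matrix.diagonal_mul_diagonal]; simp, by rw [Matrix.diagonal_mul_diagonal]; simp⟩

lemma dGL_val (t : Fin n → kˣ) : (dGL t : Matrix (Fin n) (Fin n) k) =
    Matrix.diagonal fun i => (t i : k) := rfl

lemma dGL_inv_val (t : Fin n → kˣ) : ((dGL t)⁻¹ : GL (Fin n) k) =
    (Matrix.diagonal fun i => ((t i)⁻¹ : kˣ) : Matrix (Fin n) (Fin n) k) := rfl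

/-- The multi-weight spaces. -/
def wtS (P : GL (Fin n) k) (v : Fin n → ℤ) : Submodule k (CRing n k) where
  carrier := {f | (∀ a : Fin n → k, Dv (cdg P a) f = (∑ i, (v i : k) * a i) • f) ∧
    ∀ (g : GL (Fin n) k) (t : Fin n → kˣ), ev (g * (P * dGL t * P⁻¹)) f =
      ((∏ i, t i ^ v i : kˣ) : k) * ev g f}
  add_mem' := by
    rintro f g ⟨h1, h2⟩ ⟨h3, h4⟩
    refine ⟨fun a => ?_, fun x t => ?_⟩
    · rw [map_add, h1, h3, smul_add]
    · rw [map_add, map_add, h2, h4, mul_add]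
  zero_mem' := by
    refine ⟨fun a => by simp, fun x t => by simp⟩
  smul_mem' := by
    rintro c f ⟨h1, h2⟩
    refine ⟨fun a => ?_, fun x t => ?_⟩
    · rw [Derivation.map_smul, h1, smul_comm]
    · rw [map_smul, map_smul, h2, smul_eq_mul, smul_eq_mul]; ring

lemma wtS_mul {P : GL (Fin n) k} {v w : Fin n → ℤ} {f g : CRing n k} (hf : f ∈ wtS P v)
    (hg : g ∈ wtS P w) : f * g ∈ wtS P (v + w) := by
  refine ⟨fun a => ?_, fun x t => ?_⟩
  · rw [Dv_mul, hf.1, hg.1, mul_smul_comm, mul_smul_comm, mul_comm g f, ← add_smul]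
    congr 1
    rw [← Finset.sum_add_distrib]
    refine Finset.sum_congr rfl fun i _ => ?_
    rw [Pi.add_apply]; push_cast; ring
  · rw [map_mul, map_mul, hf.2, hg.2]
    simp only [Pi.add_apply, zpow_add, Finset.prod_mul_distrib, Units.val_mul]
    ring

lemma wtS_one (P : GL (Fin n) k) : (1 : CRing n k) ∈ wtS P 0 := by
  refine ⟨fun a => by simp, fun x t => by simp⟩

lemma wtS_inl (P : GL (Fin n) k) (p : Fin n × Fin n) :
    Rt P (MvPolynomial.X (Sum.inl p)) ∈ wtS P (Pi.single p.2 1) := by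
  refine ⟨fun a => ?_, fun x t => ?_⟩
  · rw [cdg, ← Rt_Dv, Dv_inl, Finset.sum_eq_single p.2, Finset.sum_eq_single p.2]
    · rw [Matrix.diagonal_apply_eq, map_mul, alg_C, mul_comm, MvPolynomial.smul_eq_C_mul]
      simp
    · intro b _ hb; simp [Pi.single_apply, hb]
    · simp
    · intro b _ hb; rw [Matrix.diagonal_apply_ne _ hb]; simp
    · simp
  · rw [ev_Rt, ev_Rt, ev_inl, ev_inl]
    have : x * (P * dGL t * P⁻¹) * P = x * P * dGL t := by group
    rw [this, Units.val_mul (x * P), dGL_val, Matrix.mul_diagonal]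
    rw [Finset.prod_eq_single p.2]
    · simp; ring
    · intro b _ hb; simp [Pi.single_apply, hb]
    · simp

lemma wtS_inr (P : GL (Fin n) k) (p : Fin n × Fin n) :
    Rt P (MvPolynomial.X (Sum.inr p)) ∈ wtS P (Pi.single p.1 (-1)) := by
  refine ⟨fun a => ?_, fun x t => ?_⟩
  · rw [cdg, ← Rt_Dv, Dv_inr, Finset.sum_eq_single p.1, Finset.sum_eq_single p.1]
    · rw [Matrix.diagonal_apply_eq, map_neg, map_mul, alg_C, MvPolynomial.smul_eq_C_mul]
      simp
    · intro b _ hb; simp [Pi.single_apply, hb]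
    · simp
    · intro b _ hb; rw [Matrix.diagonal_apply_ne _ hb.symm]; simp
    · simp
  · rw [ev_Rt, ev_Rt, ev_inr, ev_inr]
    have : (x * (P * dGL t * P⁻¹) * P)⁻¹ = (dGL t)⁻¹ * (x * P)⁻¹ := by group
    rw [this, Units.val_mul (dGL t)⁻¹, dGL_inv_val, Matrix.diagonal_mul]
    rw [Finset.prod_eq_single p.1]
    · simp
    · intro b _ hb; simp [Pi.single_apply, hb]
    · simp

lemma Rt_inv_self (g : GL (Fin n) k) (f : CRing n k) : Rt g (Rt g⁻¹ f) = f := by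
  have : (Rt g).comp (Rt g⁻¹) = AlgHom.id k (CRing n k) := by
    have e2 : (g : Matrix (Fin n) (Fin n) k) *
        ((g⁻¹ : GL (Fin n) k) : Matrix (Fin n) (Fin n) k) = 1 := by
      rw [← Units.val_mul, mul_inv_cancel, Units.val_one]
    apply MvPolynomial.algHom_ext
    rintro (p | p)
    · simp only [AlgHom.comp_apply, Rt_inl, map_sum, map_mul, alg_C, Finset.sum_mul,
        AlgHom.id_apply]
      rw [Finset.sum_comm]
      simp only [mul_assoc, ← Finset.mul_sum, ← map_mul, ← map_sum]
      simp only [← Matrix.mul_apply, e2]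
      rw [Finset.sum_eq_single p.2]
      · simp
      · intro b _ hb; rw [Matrix.one_apply_ne hb]; simp
      · simp
    · simp only [AlgHom.comp_apply, Rt_inr, map_sum, map_mul, alg_C, Finset.mul_sum,
        AlgHom.id_apply, inv_inv]
      rw [Finset.sum_comm]
      simp only [← mul_assoc, ← Finset.sum_mul, ← map_mul, ← map_sum]
      simp only [← Matrix.mul_apply, e2]
      rw [Finset.sum_eq_single p.1]
      · simp
      · intro b _ hb; rw [Matrix.one_apply_ne hb.symm]; simp
      · simp
  exact DFunLike.congr_fun this f

lemma wtS_iSup (P : GL (Fin n) k) : ⨆ v, wtS P v = ⊤ := by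
  have key : ∀ f : CRing n k, Rt P f ∈ ⨆ v, wtS P v := by
    intro f
    induction f using MvPolynomial.induction_on with
    | C a =>
      rw [alg_C, ← mul_one (MvPolynomial.C a), ← MvPolynomial.smul_eq_C_mul]
      exact Submodule.smul_mem _ _ (Submodule.mem_iSup_of_mem 0 (wtS_one P))
    | add p q hp hq => rw [map_add]; exact add_mem hp hq
    | mul_X p i hp =>
      rw [map_mul]
      obtain ⟨w, hw⟩ : ∃ w, Rt P (MvPolynomial.X i) ∈ wtS P w := by
        rcases i with i | i
        · exact ⟨_, wtS_inl P i⟩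
        · exact ⟨_, wtS_inr P i⟩
      generalize Rt P p = p' at hp
      induction hp using Submodule.iSup_induction' with
      | zero => rw [zero_mul]; exact zero_mem _
      | add x y _ _ hx hy => rw [add_mul]; exact add_mem hx hy
      | mem v x hx => exact Submodule.mem_iSup_of_mem _ (wtS_mul hx hw)
  rw [eq_top_iff]
  intro f _
  rw [← Rt_inv_self P f]
  exact key _

/-- Eigenvectors of a diagonal derivation are eigenvectors of its replicas. -/
lemma eig_replica (P : GL (Fin n) k) (a : Fin n → k) (φ : k →+ k) (c : k) :
    (DE (cdg P a)).eigenspace c ≤ (DE (cdg P (fun i => φ (a i)))).eigenspace (φ c) := by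
  refine (le_of_indep (DE (cdg P a)).eigenspaces_iSupIndep (T := fun c =>
    (DE (cdg P a)).eigenspace c ⊓ (DE (cdg P (fun i => φ (a i)))).eigenspace (φ c))
    (fun c => inf_le_left) ?_ c).trans inf_le_right
  rw [eq_top_iff, ← wtS_iSup P]
  refine iSup_le fun v => le_iSup_of_le (∑ i, (v i : k) * a i) ?_
  intro f hf
  refine ⟨?_, ?_⟩
  · rw [SetLike.mem_coe, Module.End.mem_eigenspace_iff, DE_apply, hf.1]
  · rw [SetLike.mem_coe, Module.End.mem_eigenspace_iff, DE_apply, hf.1, map_sum]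
    congr 1
    refine Finset.sum_congr rfl fun i _ => ?_
    rw [← zsmul_eq_mul, ← zsmul_eq_mul, map_zsmul]

lemma eig_top (P : GL (Fin n) k) (a : Fin n → k) : ⨆ c, (DE (cdg P a)).eigenspace c = ⊤ := by
  rw [eq_top_iff, ← wtS_iSup P]
  refine iSup_le fun v => le_iSup_of_le (∑ i, (v i : k) * a i) ?_
  intro f hf
  rw [Module.End.mem_eigenspace_iff, DE_apply, hf.1]

/-- The one-parameter subgroup `t ↦ P t^d P⁻¹`. -/
noncomputable def lamGL (P : GL (Fin n) k) (d : Fin n → ℤ) : kˣ →* GL (Fin n) k where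
  toFun t := P * dGL (fun i => t ^ d i) * P⁻¹
  map_one' := by
    have : dGL (fun i => (1 : kˣ) ^ d i) = (1 : GL (Fin n) k) := by
      apply Units.ext
      rw [dGL_val]
      simp
    rw [this]; group
  map_mul' s t := by
    have : dGL (fun i => (s * t) ^ d i) =
        (dGL (fun i => s ^ d i) * dGL (fun i => t ^ d i) : GL (Fin n) k) := by
      apply Units.ext
      rw [Units.val_mul, dGL_val, dGL_val, dGL_val, Matrix.diagonal_mul_diagonal]
      simp [mul_zpow]
    rw [this]; group

lemma lamGL_apply (P : GL (Fin n) k) (d : Fin n → ℤ) (t : kˣ) :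
    lamGL P d t = P * dGL (fun i => t ^ d i) * P⁻¹ := rfl

/-- Integral weight spaces. -/
def iwt (P : GL (Fin n) k) (d : Fin n → ℤ) (j : ℤ) : Submodule k (CRing n k) where
  carrier := {f | Dv (cdg P (fun i => (d i : k))) f = (j : k) • f ∧
    ∀ (g : GL (Fin n) k) (t : kˣ), ev (g * lamGL P d t) f = ((t ^ j : kˣ) : k) * ev g f}
  add_mem' := by
    rintro f g ⟨h1, h2⟩ ⟨h3, h4⟩
    refine ⟨?_, fun x t => ?_⟩
    · rw [map_add, h1, h3, smul_add]
    · rw [map_add, map_add, h2, h4, mul_add]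
  zero_mem' := by
    refine ⟨by simp, fun x t => by simp⟩
  smul_mem' := by
    rintro c f ⟨h1, h2⟩
    refine ⟨?_, fun x t => ?_⟩
    · rw [Derivation.map_smul, h1, smul_comm]
    · rw [map_smul, map_smul, h2, smul_eq_mul, smul_eq_mul]; ring

lemma wtS_le_iwt (P : GL (Fin n) k) (d : Fin n → ℤ) (v : Fin n → ℤ) :
    wtS P v ≤ iwt P d (∑ i, v i * d i) := by
  intro f hf
  refine ⟨?_, fun g t => ?_⟩
  · rw [hf.1]; push_cast; rfl
  · rw [lamGL_apply, hf.2]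
    congr 2
    have hp : ∀ s : Finset (Fin n), ∏ i ∈ s, (t ^ d i) ^ v i = t ^ (∑ i ∈ s, v i * d i) := by
      intro s
      induction s using Finset.induction_on with
      | empty => simp
      | insert a s ha ih =>
        rw [Finset.prod_insert ha, Finset.sum_insert ha, ih, zpow_add, ← zpow_mul, mul_comm (v a)]
    exact hp _

lemma eig_le_iwt (P : GL (Fin n) k) (d : Fin n → ℤ) (c : k) :
    (DE (cdg P (fun i => (d i : k)))).eigenspace c ≤ ⨆ j : {j : ℤ // (j : k) = c}, iwt P d j := by
  refine le_of_indep (DE (cdg P (fun i => (d i : k)))).eigenspaces_iSupIndep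
    (T := fun c => ⨆ j : {j : ℤ // (j : k) = c}, iwt P d j) (fun c => ?_) ?_ c
  · refine iSup_le fun j f hf => ?_
    rw [Module.End.mem_eigenspace_iff, DE_apply, hf.1, j.2]
  · rw [eq_top_iff, ← wtS_iSup P]
    refine iSup_le fun v => (wtS_le_iwt P d v).trans ?_
    exact le_iSup_of_le (((∑ i, v i * d i : ℤ)) : k)
      (le_iSup_of_le (⟨(∑ i, v i * d i : ℤ), rfl⟩ :
        {j : ℤ // (j : k) = ((∑ i, v i * d i : ℤ) : k)}) le_rfl)

lemma commute_DE {A B : Matrix (Fin n) (Fin n) k} (h : Commute A B) : Commute (DE A) (DE B) := by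
  apply LinearMap.ext
  intro f
  have h1 := DFunLike.congr_fun (Dv_lie A B) f
  rw [h.eq, sub_self, Dv_zero, Derivation.commutator_apply] at h1
  exact (sub_eq_zero.1 h1.symm)

variable [IsAlgClosed k]

lemma lieS_decomp {H : Set (GL (Fin n) k)} {P : GL (Fin n) k} {a : Fin n → k}
    {N : Matrix (Fin n) (Fin n) k} (hN : IsNilpotent N) (hc : Commute (cdg P a) N)
    (hA : cdg P a + N ∈ lieS H) {f : CRing n k} (hf : f ∈ Iv H) :
    f ∈ ⨆ c, (Iv H).restrictScalars k ⊓ (DE (cdg P a)).eigenspace c := by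
  have h1 := stable_decomp (DE (cdg P a + N)) ((Iv H).restrictScalars k)
    (fun u hu => hA u hu) (fun v => by
      obtain ⟨W, h1, h2, h3⟩ := locally_finite v
      exact ⟨W, h1, h2, h3 _⟩) f hf
  have hle : (⨆ c, (Iv H).restrictScalars k ⊓ (DE (cdg P a + N)).maxGenEigenspace c) ≤
      ⨆ c, (Iv H).restrictScalars k ⊓ (DE (cdg P a)).eigenspace c := by
    refine iSup_mono fun c => inf_le_inf_left _ ?_
    refine maxGen_le_eigen (Tn := DE N) ?_ (commute_DE hc) (eig_top P a)
      (DE_locally_nilpotent hN) c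
    apply LinearMap.ext
    intro f
    rw [LinearMap.add_apply, DE_apply, DE_apply, DE_apply, Dv_add, Derivation.add_apply]
  exact hle h1

lemma replica {H : Set (GL (Fin n) k)} {P : GL (Fin n) k} {a : Fin n → k}
    {N : Matrix (Fin n) (Fin n) k} (hN : IsNilpotent N) (hc : Commute (cdg P a) N)
    (hA : cdg P a + N ∈ lieS H) (φ : k →+ k) : cdg P (fun i => φ (a i)) ∈ lieS H := by
  intro f hf
  have h1 := lieS_decomp hN hc hA hf
  clear hf
  induction h1 using Submodule.iSup_induction' with
  | zero => rw [map_zero]; exact zero_mem _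
  | add x y _ _ hx hy => rw [map_add]; exact add_mem hx hy
  | mem c x hx =>
    have h2 := eig_replica P a φ c hx.2
    rw [Module.End.mem_eigenspace_iff, DE_apply] at h2
    rw [h2, MvPolynomial.smul_eq_C_mul]
    exact Ideal.mul_mem_left _ _ hx.1

lemma iwt_decomp [CharZero k] {H : Set (GL (Fin n) k)} {P : GL (Fin n) k} {d : Fin n → ℤ}
    (hA : cdg P (fun i => (d i : k)) ∈ lieS H) {f : CRing n k} (hf : f ∈ Iv H) :
    f ∈ ⨆ j, (Iv H).restrictScalars k ⊓ iwt P d j := by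
  have h1 := lieS_decomp (N := 0) IsNilpotent.zero (Commute.zero_right _)
    (by rwa [add_zero]) hf
  have hle : (⨆ c, (Iv H).restrictScalars k ⊓ (DE (cdg P (fun i => (d i : k)))).eigenspace c) ≤
      ⨆ j, (Iv H).restrictScalars k ⊓ iwt P d j := by
    refine iSup_le fun c => ?_
    rintro x ⟨hx, hxe⟩
    have h3 := eig_le_iwt P d _ hxe
    by_cases hj : ∃ j : ℤ, (j : k) = c
    · obtain ⟨j, rfl⟩ := hj
      have hinj : (⨆ i : {i : ℤ // (i : k) = (j : k)}, iwt P d i) ≤ iwt P d j := by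
        refine iSup_le ?_
        rintro ⟨i, hi⟩
        obtain rfl := Int.cast_injective hi
        exact le_rfl
      exact Submodule.mem_iSup_of_mem j ⟨hx, hinj h3⟩
    · have : IsEmpty {j : ℤ // (j : k) = c} := ⟨fun j => hj ⟨j.1, j.2⟩⟩
      rw [iSup_of_empty, Submodule.mem_bot] at h3
      rw [h3]; exact zero_mem _
  exact hle h1

lemma lam_mem [CharZero k] {H : Set (GL (Fin n) k)} (hZ : ZC H) (h1H : 1 ∈ H) {P : GL (Fin n) k}
    {d : Fin n → ℤ} (hA : cdg P (fun i => (d i : k)) ∈ lieS H) (t : kˣ) : lamGL P d t ∈ H := by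
  apply hZ
  intro f hf
  have h1 := iwt_decomp hA hf
  clear hf
  induction h1 using Submodule.iSup_induction' with
  | zero => rw [map_zero]
  | add x y _ _ hx hy => rw [map_add, hx, hy, add_zero]
  | mem j x hx =>
    have h2 := hx.2.2 1 t
    rw [one_mul] at h2
    rw [h2, mem_Iv.1 hx.1 1 h1H, mul_zero]

end Grading


section Jordan

set_option linter.unusedSimpArgs false
set_option linter.unusedSectionVars false

variable {n : ℕ}

lemma jordan [IsAlgClosed k] (A : Matrix (Fin n) (Fin n) k) :
    ∃ (P : GL (Fin n) k) (a : Fin n → k) (N : Matrix (Fin n) (Fin n) k),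
      IsNilpotent N ∧ Commute (cdg P a) N ∧ A = cdg P a + N := by
  obtain ⟨nn, hn, s, hs, hnil, hss, hA⟩ :=
    Module.End.exists_isNilpotent_isSemisimple (f := Matrix.toLin' A)
  have hcomm : Commute nn s :=
    Algebra.commute_of_mem_adjoin_singleton_of_commute hs
      (Algebra.commute_of_mem_adjoin_singleton_of_commute hn (Commute.refl _)).symm
  have htop := hss.iSup_eigenspace_eq_top
  let S : Set (Fin n → k) := {v | ∃ c : k, s v = c • v}
  have hS : Submodule.span k S = ⊤ := by
    rw [eq_top_iff, ← htop]
    refine iSup_le fun c v hv => Submodule.subset_span ⟨c, ?_⟩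
    rwa [Module.End.mem_eigenspace_iff] at hv
  obtain ⟨b, hbS, hbspan, hbli⟩ := exists_linearIndependent k S
  have hbtop : ⊤ ≤ Submodule.span k (Set.range ((↑) : b → Fin n → k)) := by
    rw [Subtype.range_coe, hbspan, hS]
  let B := Module.Basis.mk hbli hbtop
  let e := B.indexEquiv (Pi.basisFun k (Fin n))
  have hli : LinearIndependent k (fun i => ((e.symm i : b) : Fin n → k)) :=
    hbli.comp _ e.symm.injective
  choose c hc using fun i => hbS (e.symm i).2
  let P0 : Matrix (Fin n) (Fin n) k := Matrix.of fun i j => ((e.symm j : b) : Fin n → k) i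
  have hP : IsUnit P0 := by
    rw [← Matrix.linearIndependent_cols_iff_isUnit]
    exact hli
  let P : GL (Fin n) k := hP.unit
  have hPv : (P : Matrix (Fin n) (Fin n) k) = P0 := hP.unit_spec
  have hsP : LinearMap.toMatrix' s * (P : Matrix (Fin n) (Fin n) k) =
      (P : Matrix (Fin n) (Fin n) k) * Matrix.diagonal c := by
    ext i j
    have h1 := congrFun (hc j) i
    rw [Matrix.mul_diagonal, hPv]
    have h2 : s (e.symm j : b) = (LinearMap.toMatrix' s).mulVec ((e.symm j : b) : Fin n → k) := by
      rw [LinearMap.toMatrix'_mulVec]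
    rw [h2] at h1
    simp only [Matrix.mul_apply, P0, Matrix.of_apply]
    simp only [Matrix.mulVec, dotProduct, Pi.smul_apply, smul_eq_mul] at h1
    rw [h1, mul_comm]
  have hs' : LinearMap.toMatrix' s = cdg P c := by
    have e2 : (P : Matrix (Fin n) (Fin n) k) *
        ((P⁻¹ : GL (Fin n) k) : Matrix (Fin n) (Fin n) k) = 1 := by
      rw [← Units.val_mul, mul_inv_cancel, Units.val_one]
    rw [cdg, ← hsP, Matrix.mul_assoc, e2, Matrix.mul_one]
  refine ⟨P, c, LinearMap.toMatrix' nn, ?_, ?_, ?_⟩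
  · obtain ⟨m, hm⟩ := hnil
    refine ⟨m, ?_⟩
    have := (LinearMap.toMatrixAlgEquiv' (R := k) (n := Fin n)).map_pow nn m
    rw [hm, map_zero] at this
    exact this.symm
  · rw [← hs']
    have := hcomm.symm.map (LinearMap.toMatrixAlgEquiv' (R := k) (n := Fin n))
    exact this
  · rw [← hs', ← map_add, add_comm, ← hA, LinearMap.toMatrix'_toLin']

end Jordan


section FiniteImage

set_option linter.unusedSimpArgs false
set_option linter.unusedSectionVars false

variable {n : ℕ}

/-- The maximal ideal at the identity. -/
noncomputable def mI (n : ℕ) (k : Type) [Field k] : Ideal (CRing n k) :=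
  RingHom.ker (ev (1 : GL (Fin n) k))

lemma mem_mI {f : CRing n k} : f ∈ mI n k ↔ ev 1 f = 0 := RingHom.mem_ker

/-- The coordinate `X_p - δ_p`. -/
noncomputable def xc (p : Fin n × Fin n) : CRing n k :=
  MvPolynomial.X (Sum.inl p) - MvPolynomial.C ((1 : Matrix (Fin n) (Fin n) k) p.1 p.2)

lemma xc_mem (p : Fin n × Fin n) : xc p ∈ mI n k := by
  rw [mem_mI, xc, map_sub, ev_inl, ev_C]; simp

/-- The differential at the identity. -/
noncomputable def dif (n : ℕ) (k : Type) [Field k] :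
    CRing n k →ₗ[k] Module.Dual k (Matrix (Fin n) (Fin n) k) :=
  LinearMap.mk₂ k (fun a A => ev 1 (Dv A a))
    (fun a b A => by rw [map_add, map_add]) (fun c a A => by rw [Derivation.map_smul, map_smul])
    (fun a A B => by rw [Dv_add, Derivation.add_apply, map_add])
    (fun c a A => by rw [Dv_smul, Derivation.smul_apply, map_smul])

lemma dif_apply (a : CRing n k) (A : Matrix (Fin n) (Fin n) k) : dif n k a A = ev 1 (Dv A a) := rfl

/-- The linear part of a function. -/
noncomputable def lin (θ : Module.Dual k (Matrix (Fin n) (Fin n) k)) : CRing n k :=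
  ∑ p : Fin n × Fin n, MvPolynomial.C (θ (Matrix.single p.1 p.2 1)) * xc p

lemma lin_add (θ η : Module.Dual k (Matrix (Fin n) (Fin n) k)) :
    lin (θ + η) = lin θ + lin η := by
  simp [lin, add_mul, Finset.sum_add_distrib]

lemma lin_smul (c : k) (θ : Module.Dual k (Matrix (Fin n) (Fin n) k)) :
    lin (c • θ) = MvPolynomial.C c * lin θ := by
  simp [lin, Finset.mul_sum, mul_assoc]

lemma lin_mem (θ : Module.Dual k (Matrix (Fin n) (Fin n) k)) : lin θ ∈ mI n k :=
  Ideal.sum_mem _ fun p _ => Ideal.mul_mem_left _ _ (xc_mem p)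

lemma ev_dual_inl (A : Matrix (Fin n) (Fin n) k) (p : Fin n × Fin n) :
    dif n k (MvPolynomial.X (Sum.inl p)) A = A p.1 p.2 := by
  rw [dif_apply, Dv_inl, map_sum]
  simp only [map_mul, ev_inl, ev_C, Units.val_one]
  rw [← Matrix.mul_apply, Matrix.one_mul]

lemma ev_dual_inr (A : Matrix (Fin n) (Fin n) k) (p : Fin n × Fin n) :
    dif n k (MvPolynomial.X (Sum.inr p)) A = -A p.1 p.2 := by
  rw [dif_apply, Dv_inr, map_neg, map_sum]
  simp only [map_mul, ev_inr, ev_C, Units.val_one, inv_one]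
  rw [← Matrix.mul_apply, Matrix.mul_one]

lemma lin_inl (p : Fin n × Fin n) :
    lin (dif n k (MvPolynomial.X (Sum.inl p))) = xc p := by
  rw [lin, Finset.sum_eq_single p]
  · rw [ev_dual_inl]; simp
  · intro b _ hb
    rw [ev_dual_inl, Matrix.single_apply_of_ne, map_zero, zero_mul]
    rintro ⟨h1, h2⟩
    exact hb (Prod.ext h1 h2)
  · simp

lemma lin_inr (p : Fin n × Fin n) :
    lin (dif n k (MvPolynomial.X (Sum.inr p))) = -xc p := by
  rw [← lin_inl, ← neg_one_mul, ← map_one MvPolynomial.C, ← map_neg, ← lin_smul]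
  congr 1
  ext A
  rw [LinearMap.smul_apply, ev_dual_inr, ev_dual_inl, smul_eq_mul, neg_one_mul]

lemma taylor (H : Set (GL (Fin n) k)) (a : CRing n k) :
    a - MvPolynomial.C (ev 1 a) - lin (dif n k a) ∈ mI n k ^ 2 ⊔ Iv H := by
  induction a using MvPolynomial.induction_on with
  | C a =>
    have : dif n k (MvPolynomial.C a) = 0 := by
      ext A; rw [dif_apply, Dv_C, map_zero]; rfl
    rw [this, ev_C, sub_self, lin]
    simp
  | add p q hp hq =>
    rw [map_add, map_add, map_add, lin_add]
    convert add_mem hp hq using 1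
    ring
  | mul_X p i hp =>
    have hX : MvPolynomial.X i - MvPolynomial.C (ev 1 (MvPolynomial.X i)) -
        lin (dif n k (MvPolynomial.X i)) ∈ mI n k ^ 2 ⊔ Iv H := by
      rcases i with p | p
      · rw [lin_inl, ev_inl, xc, Units.val_one]
        simp
      · rw [lin_inr, ev_inr, inv_one, Units.val_one, sub_neg_eq_add]
        have e : (MvPolynomial.X (Sum.inr p) -
            MvPolynomial.C ((1 : Matrix (Fin n) (Fin n) k) p.1 p.2) + xc p : CRing n k) =
            -(∑ l, xc (p.1, l) * (MvPolynomial.X (Sum.inr (l, p.2)) -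
              MvPolynomial.C ((1 : Matrix (Fin n) (Fin n) k) l p.2))) +
            (∑ l, MvPolynomial.X (Sum.inl (p.1, l)) * MvPolynomial.X (Sum.inr (l, p.2)) -
              MvPolynomial.C ((1 : Matrix (Fin n) (Fin n) k) p.1 p.2)) := by
          have e1 : ∀ l : Fin n, (xc (p.1, l) * (MvPolynomial.X (Sum.inr (l, p.2)) -
              MvPolynomial.C ((1 : Matrix (Fin n) (Fin n) k) l p.2)) : CRing n k) =
              MvPolynomial.X (Sum.inl (p.1, l)) * MvPolynomial.X (Sum.inr (l, p.2)) -
              MvPolynomial.X (Sum.inl (p.1, l)) *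
                MvPolynomial.C ((1 : Matrix (Fin n) (Fin n) k) l p.2) -
              MvPolynomial.C ((1 : Matrix (Fin n) (Fin n) k) p.1 l) *
                MvPolynomial.X (Sum.inr (l, p.2)) +
              MvPolynomial.C ((1 : Matrix (Fin n) (Fin n) k) p.1 l) *
                MvPolynomial.C ((1 : Matrix (Fin n) (Fin n) k) l p.2) := by
            intro l; rw [xc]; ring
          have s1 : ∑ l : Fin n, (MvPolynomial.X (Sum.inl (p.1, l)) *
                MvPolynomial.C ((1 : Matrix (Fin n) (Fin n) k) l p.2) : CRing n k) =
              MvPolynomial.X (Sum.inl p) := by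
            rw [Finset.sum_eq_single p.2]
            · simp
            · intro b _ hb; rw [Matrix.one_apply_ne hb]; simp
            · simp
          have s2 : ∑ l : Fin n, (MvPolynomial.C ((1 : Matrix (Fin n) (Fin n) k) p.1 l) *
                MvPolynomial.X (Sum.inr (l, p.2)) : CRing n k) =
              MvPolynomial.X (Sum.inr p) := by
            rw [Finset.sum_eq_single p.1]
            · simp
            · intro b _ hb; rw [Matrix.one_apply_ne hb.symm]; simp
            · simp
          have s3 : ∑ l : Fin n, (MvPolynomial.C ((1 : Matrix (Fin n) (Fin n) k) p.1 l) *
                MvPolynomial.C ((1 : Matrix (Fin n) (Fin n) k) l p.2) : CRing n k) =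
              MvPolynomial.C ((1 : Matrix (Fin n) (Fin n) k) p.1 p.2) := by
            simp only [← map_mul, ← map_sum]
            rw [← Matrix.mul_apply, Matrix.mul_one]
          simp only [e1, Finset.sum_add_distrib, Finset.sum_sub_distrib, s1, s2, s3]
          rw [xc]
          ring
        rw [e]
        refine Submodule.add_mem_sup (neg_mem (Ideal.sum_mem _ fun l _ => ?_)) ?_
        · rw [pow_two]
          refine Ideal.mul_mem_mul (xc_mem _) ?_
          rw [mem_mI, map_sub, ev_inr, ev_C]
          simp
        · intro g _
          rw [map_sub, map_sum, ev_C]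
          simp only [map_mul, ev_inl, ev_inr]
          rw [← Matrix.mul_apply, ← Units.val_mul, mul_inv_cancel, Units.val_one, sub_self]
    generalize (MvPolynomial.X i : CRing n k) = q at hX ⊢
    have hd : dif n k (p * q) = ev 1 p • dif n k q + ev 1 q • dif n k p := by
      ext A
      simp only [dif_apply, Dv_mul, map_add, map_mul, LinearMap.add_apply, LinearMap.smul_apply,
        smul_eq_mul]
    rw [hd, lin_add, lin_smul, lin_smul, map_mul, map_mul]
    have hl : lin (dif n k p) * lin (dif n k q) ∈ mI n k ^ 2 ⊔ Iv H := by
      refine Submodule.mem_sup_left ?_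
      rw [pow_two]
      exact Ideal.mul_mem_mul (lin_mem _) (lin_mem _)
    have h1 := Ideal.mul_mem_left _ q hp
    have h2 := Ideal.mul_mem_left _ (MvPolynomial.C (ev 1 p) + lin (dif n k p)) hX
    convert add_mem (add_mem h1 h2) hl using 1
    ring

variable [CharZero k]

lemma krull_local (H : Subgroup (GL (Fin n) k)) (f : CRing n k)
    (hf : ∀ A ∈ lieS (H : Set (GL (Fin n) k)), Dv A f ∈ Iv (H : Set (GL (Fin n) k))) :
    ∃ u : CRing n k, ev 1 u = 1 ∧ ∀ h ∈ H, ev h u * (ev h f - ev 1 f) = 0 := by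
  set I := Iv (H : Set (GL (Fin n) k)) with hI
  set L := lieS (H : Set (GL (Fin n) k)) with hL
  obtain ⟨p, hp⟩ := LinearMap.exists_leftInverse_of_injective L.subtype L.ker_subtype
  have hp' : ∀ A (hA : A ∈ L), p A = ⟨A, hA⟩ := fun A hA => LinearMap.congr_fun hp ⟨A, hA⟩
  have hId : ∀ b ∈ I, ∃ c ∈ mI n k ^ 2 ⊔ I, lin (dif n k b) = c := by
    intro b hb
    refine ⟨_, ?_, rfl⟩
    have h1 := taylor (H : Set (GL (Fin n) k)) b
    rw [hb 1 H.one_mem, map_zero, sub_zero] at h1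
    have := sub_mem (Submodule.mem_sup_right hb : b ∈ mI n k ^ 2 ⊔ I) h1
    simpa using this
  -- functionals vanishing on L come from I
  have hann : ∀ θ : Module.Dual k (Matrix (Fin n) (Fin n) k), (∀ A ∈ L, θ A = 0) →
      ∃ b ∈ I, dif n k b = θ := by
    intro θ hθ
    let W : Submodule k (Module.Dual k (Matrix (Fin n) (Fin n) k)) :=
      (I.restrictScalars k).map (dif n k)
    have hW : W.dualCoannihilator = L := by
      ext A
      rw [Submodule.mem_dualCoannihilator]
      constructor
      · intro h
        apply lieS_of_tangent
        intro b hb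
        exact h _ ⟨b, hb, rfl⟩
      · rintro h _ ⟨b, hb, rfl⟩
        exact h b hb 1 H.one_mem
    have hθ' : θ ∈ W := by
      rw [← Subspace.dualCoannihilator_dualAnnihilator_eq (W := W), hW,
        Submodule.mem_dualAnnihilator]
      exact hθ
    obtain ⟨b, hb, rfl⟩ := hθ'
    exact ⟨b, hb, rfl⟩
  let E : Derivation k (CRing n k) (CRing n k) :=
    ∑ q : Fin n × Fin n, (xc q : CRing n k) • Dv (p (Matrix.single q.1 q.2 1) : Matrix (Fin n) (Fin n) k)
  have hE : ∀ a, E a = ∑ q : Fin n × Fin n,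
      (xc q : CRing n k) * Dv (p (Matrix.single q.1 q.2 1) : Matrix (Fin n) (Fin n) k) a := by
    intro a
    simp only [E]
    have h0 := map_sum (Derivation.coeFnAddMonoidHom (R := k) (A := CRing n k) (M := CRing n k))
      (fun q : Fin n × Fin n => (xc q : CRing n k) •
        Dv (p (Matrix.single q.1 q.2 1) : Matrix (Fin n) (Fin n) k)) Finset.univ
    have h1 := congrFun h0 a
    rw [Finset.sum_apply] at h1
    exact h1
  have hEm : ∀ a, E a ∈ mI n k := by
    intro a
    rw [hE]
    exact Ideal.sum_mem _ fun q _ => Ideal.mul_mem_right _ (mI n k) (xc_mem q)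
  have hEI : ∀ a, (∀ A ∈ L, Dv A a ∈ I) → E a ∈ I := by
    intro a ha
    rw [hE]
    exact Ideal.sum_mem _ fun q _ => Ideal.mul_mem_left _ (xc q) (ha _ (p _).2)
  have hE1 : ∀ a ∈ mI n k, E a - a ∈ mI n k ^ 2 ⊔ I := by
    intro a ha
    let θ : Module.Dual k (Matrix (Fin n) (Fin n) k) :=
      (dif n k a).comp (LinearMap.id - L.subtype.comp p)
    obtain ⟨b, hb, hbθ⟩ := hann θ (by
      intro A hA
      simp only [θ, LinearMap.comp_apply, LinearMap.sub_apply, LinearMap.id_apply, hp' A hA]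
      simp)
    obtain ⟨c, hc, hcb⟩ := hId b hb
    have h1 := taylor (H : Set (GL (Fin n) k)) a
    rw [mem_mI.1 ha, map_zero, sub_zero] at h1
    have h2 : E a - lin ((dif n k a).comp (L.subtype.comp p)) ∈ mI n k ^ 2 := by
      rw [hE, lin, ← Finset.sum_sub_distrib]
      refine Ideal.sum_mem _ fun q _ => ?_
      rw [mul_comm (MvPolynomial.C _), ← mul_sub, pow_two]
      refine Ideal.mul_mem_mul (xc_mem q) ?_
      rw [mem_mI, map_sub, ev_C]
      exact sub_self _
    have h3 : dif n k a = θ + (dif n k a).comp (L.subtype.comp p) := by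
      ext A
      simp [θ]
    have h4 : lin (dif n k a) = c + lin ((dif n k a).comp (L.subtype.comp p)) := by
      rw [← hcb, hbθ, ← lin_add, ← h3]
    have h5 := sub_mem (sub_mem (Submodule.mem_sup_left h2 : _ ∈ mI n k ^ 2 ⊔ I) h1) hc
    rw [h4] at h5
    convert h5 using 1
    ring
  have hEr : ∀ r : ℕ, ∀ s ∈ mI n k ^ r, E s - (r : CRing n k) * s ∈ mI n k ^ (r + 1) ⊔ I := by
    intro r
    induction r with
    | zero =>
      intro s _
      refine Submodule.mem_sup_left ?_
      simpa using hEm s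
    | succ r ih =>
      intro s hs
      rw [pow_succ] at hs
      induction hs using Submodule.mul_induction_on' with
      | mem_mul_mem a ha b hb =>
        have h1 := hE1 b hb
        have h2 := ih a ha
        have h3 : a * (E b - b) ∈ mI n k ^ (r + 1 + 1) ⊔ I := by
          obtain ⟨s, hs, i, hi, hsi⟩ := Submodule.mem_sup.1 h1
          rw [← hsi, mul_add]
          refine Submodule.add_mem_sup ?_ (Ideal.mul_mem_left _ _ hi)
          rw [add_assoc, pow_add]
          exact Ideal.mul_mem_mul ha hs
        have h4 : b * (E a - (r : CRing n k) * a) ∈ mI n k ^ (r + 1 + 1) ⊔ I := by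
          obtain ⟨s, hs, i, hi, hsi⟩ := Submodule.mem_sup.1 h2
          rw [← hsi, mul_add]
          refine Submodule.add_mem_sup ?_ (Ideal.mul_mem_left _ _ hi)
          rw [pow_succ _ (r + 1), mul_comm b s]
          exact Ideal.mul_mem_mul hs hb
        convert add_mem h3 h4 using 1
        rw [Derivation.leibniz, smul_eq_mul, smul_eq_mul]
        push_cast
        ring
      | add x _ y _ hx hy =>
        rw [map_add]
        convert add_mem hx hy using 1
        ring
  set f0 := f - MvPolynomial.C (ev 1 f) with hf0
  have hEf : E f0 ∈ I := by
    apply hEI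
    intro A hA
    rw [hf0, map_sub, Dv_C, sub_zero]
    exact hf A hA
  have hfr : ∀ r : ℕ, f0 ∈ mI n k ^ (r + 1) ⊔ I := by
    intro r
    induction r with
    | zero =>
      refine Submodule.mem_sup_left ?_
      rw [zero_add, pow_one, mem_mI, hf0, map_sub, ev_C, sub_self]
    | succ r ih =>
      obtain ⟨s, hs, i, hi, hsi⟩ := Submodule.mem_sup.1 ih
      have h1 := hEr (r + 1) s hs
      have h2 : E s ∈ I := by
        have h3 : E i ∈ I := hEI i fun A hA => hA i hi
        have : E s = E f0 - E i := by rw [← hsi, map_add, add_sub_cancel_right]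
        rw [this]
        exact sub_mem hEf h3
      have h3 : ((r + 1 : ℕ) : CRing n k) * s ∈ mI n k ^ (r + 1 + 1) ⊔ I := by
        have := sub_mem (Submodule.mem_sup_right h2 : _ ∈ mI n k ^ (r + 1 + 1) ⊔ I) h1
        simpa using this
      have h4 : s ∈ mI n k ^ (r + 1 + 1) ⊔ I := by
        have h5 := Ideal.mul_mem_left _ (MvPolynomial.C (((r + 1 : ℕ) : k)⁻¹)) h3
        rw [← mul_assoc, ← map_natCast (MvPolynomial.C : k →+* CRing n k), ← map_mul,
          inv_mul_cancel₀ (Nat.cast_ne_zero.2 (Nat.succ_ne_zero r)), map_one, one_mul] at h5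
        exact h5
      rw [← hsi]
      exact add_mem h4 (Submodule.mem_sup_right hi)
  have hK : (Ideal.Quotient.mk I f0 : CRing n k ⧸ I) ∈
      (⨅ i : ℕ, mI n k ^ i • ⊤ : Submodule (CRing n k) (CRing n k ⧸ I)) := by
    rw [Submodule.mem_iInf]
    intro r
    obtain ⟨s, hs, i, hi, hsi⟩ := Submodule.mem_sup.1 (hfr r)
    have h1 : (Ideal.Quotient.mk I f0 : CRing n k ⧸ I) = s • (1 : CRing n k ⧸ I) := by
      rw [← hsi, map_add, Ideal.Quotient.eq_zero_iff_mem.2 hi, add_zero]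
      change Ideal.Quotient.mk I s = Ideal.Quotient.mk I (s * 1)
      rw [mul_one]
    rw [h1]
    exact Submodule.smul_mem_smul (Ideal.pow_le_pow_right (Nat.le_succ r) hs) trivial
  rw [Ideal.mem_iInf_smul_pow_eq_bot_iff] at hK
  obtain ⟨⟨r, hr⟩, hrf⟩ := hK
  refine ⟨1 - r, ?_, fun h hh => ?_⟩
  · rw [map_sub, map_one, mem_mI.1 hr, sub_zero]
  · have h1 : r * f0 - f0 ∈ I := by
      rw [← Ideal.Quotient.eq_zero_iff_mem, map_sub, sub_eq_zero, map_mul]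
      exact hrf
    have h2 := h1 h hh
    rw [hf0, map_sub, map_mul, map_sub, ev_C] at h2
    rw [map_sub, map_one]
    linear_combination -h2

lemma finite_image (H : Subgroup (GL (Fin n) k)) (f : CRing n k)
    (hf : ∀ A ∈ lieS (H : Set (GL (Fin n) k)), Dv A f ∈ Iv (H : Set (GL (Fin n) k))) :
    ((fun h => ev h f) '' (H : Set (GL (Fin n) k))).Finite := by
  have h1 : ∀ g : H, ∃ w : CRing n k, ev (g : GL (Fin n) k) w = 1 ∧
      ∀ h ∈ H, ev h w * (ev h f - ev (g : GL (Fin n) k) f) = 0 := by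
    intro g
    obtain ⟨u, hu, huh⟩ := krull_local H (Lt (g : GL (Fin n) k) f) (by
      intro A hA
      rw [← Lt_Dv]
      exact Lt_mem g.2 (hf A hA))
    refine ⟨Lt (g : GL (Fin n) k)⁻¹ u, ?_, fun h hh => ?_⟩
    · rw [ev_Lt, inv_mul_cancel, hu]
    · have := huh ((g : GL (Fin n) k)⁻¹ * h) (H.mul_mem (H.inv_mem g.2) hh)
      rw [ev_Lt, ev_Lt, mul_inv_cancel_left, mul_one] at this
      rwa [ev_Lt]
  choose w hw1 hw2 using h1
  obtain ⟨t, ht, hts⟩ := Submodule.fg_span_iff_fg_span_finset_subset (R := CRing n k)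
    (Set.range w) |>.1 (IsNoetherian.noetherian (Submodule.span (CRing n k) (Set.range w)))
  choose c hc using fun q : t => ht q.2
  refine (Set.finite_range fun q : t => ev (c q : GL (Fin n) k) f).subset ?_
  rintro _ ⟨h, hh, rfl⟩
  by_contra hcon
  have h2 : ∀ q ∈ t, ev h q = 0 := by
    intro q hq
    have h3 := hw2 (c ⟨q, hq⟩) h hh
    rw [hc] at h3
    rcases mul_eq_zero.1 h3 with h4 | h4
    · exact h4
    · exact absurd ⟨⟨q, hq⟩, (sub_eq_zero.1 h4).symm⟩ hcon
  have h3 : Submodule.span (CRing n k) (t : Set (CRing n k)) ≤ RingHom.ker (ev h) :=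
    Submodule.span_le.2 h2
  have h4 := h3 (hts ▸ Submodule.subset_span ⟨⟨h, hh⟩, rfl⟩ : w ⟨h, hh⟩ ∈ _)
  rw [RingHom.mem_ker] at h4
  have h5 := hw1 ⟨h, hh⟩
  simp only at h5
  rw [h5] at h4
  exact one_ne_zero h4

end FiniteImage


section LinAlg

set_option linter.unusedSimpArgs false
set_option linter.unusedSectionVars false

lemma pow_comm_aux {R : Type*} [Ring R] {E F H : R} (h1 : E * F - F * E = H)
    (h2 : H * E - E * H = 2 * E) (j : ℕ) :
    E ^ (j + 1) * F - F * E ^ (j + 1) = ((j : R) + 1) * ((H - (j : R)) * E ^ j) := by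
  have h3 : ∀ j : ℕ, E ^ j * H = (H - 2 * (j : R)) * E ^ j := by
    intro j
    induction j with
    | zero => simp
    | succ j ih =>
      have : E * H = H * E - 2 * E := by rw [← h2]; abel
      have t : E ^ (j + 1) * H = E ^ j * H * E - 2 * (E ^ j * E) := by
        rw [pow_succ, mul_assoc, this]; noncomm_ring
      rw [t, ih, pow_succ]
      push_cast
      simp only [mul_add, add_mul, sub_mul, mul_assoc, mul_one, two_mul]
      abel
  induction j with
  | zero => simp [h1]
  | succ j ih =>
    have e1 : E ^ (j + 1 + 1) * F - F * E ^ (j + 1 + 1) =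
        E ^ (j + 1) * (E * F - F * E) + (E ^ (j + 1) * F - F * E ^ (j + 1)) * E := by
      rw [pow_succ E (j + 1)]; noncomm_ring
    have c1 : Commute (j : R) H := Nat.cast_commute j H
    have e2 : (j : R) * H = H * (j : R) := c1.eq
    rw [e1, h1, ih, h3, mul_assoc _ _ E, mul_assoc _ (E ^ j) E, ← pow_succ]
    rw [← mul_assoc, ← add_mul, ← mul_assoc]
    congr 1
    push_cast
    simp only [mul_sub, sub_mul, add_mul, mul_add, one_mul, mul_one, two_mul, e2,
      ← one_add_one_eq_two]
    abel

variable {V : Type*} [AddCommGroup V] [Module k V]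

/-- Primitive vectors modulo a submodule have natural weights. -/
lemma sl2_lite [CharZero k] {E F H : Module.End k V} (h1 : E * F - F * E = H)
    (h2 : H * E - E * H = 2 * E) (U W : Submodule k V)
    (hUE : ∀ u ∈ U, E u ∈ U) (hUF : ∀ u ∈ U, F u ∈ U) (hUH : ∀ u ∈ U, H u ∈ U)
    (hWF : ∀ u ∈ W, F u ∈ W)
    (hnil : ∃ N, ∀ w ∈ W, (E ^ N) w ∈ U) {v : V} (hvW : v ∈ W) (hvU : v ∉ U)
    (hE : E v ∈ U) {μ : k} (hH : H v - μ • v ∈ U) : ∃ j : ℕ, μ = j := by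
  by_contra hcon
  push Not at hcon
  have hUEp : ∀ j : ℕ, ∀ u ∈ U, (E ^ j) u ∈ U := by
    intro j
    induction j with
    | zero => intro u hu; simpa using hu
    | succ j ih => intro u hu; rw [pow_succ', Module.End.mul_apply]; exact hUE _ (ih u hu)
  have key : ∀ j : ℕ, ∃ w ∈ W, v - (E ^ j) w ∈ U := by
    intro j
    induction j with
    | zero => exact ⟨v, hvW, by simp⟩
    | succ j ih =>
      obtain ⟨w, hw, hvw⟩ := ih
      have hc : ((j : k) + 1) * (μ - j) ≠ 0 :=
        mul_ne_zero (Nat.cast_add_one_ne_zero j) (sub_ne_zero.2 (hcon j))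
      refine ⟨(((j : k) + 1) * (μ - j))⁻¹ • F w, W.smul_mem _ (hWF w hw), ?_⟩
      have e1 := LinearMap.congr_fun (pow_comm_aux h1 h2 j) w
      have hEw : (E ^ (j + 1)) w ∈ U := by
        have := U.sub_mem hE (hUE _ hvw)
        rw [map_sub, sub_sub_cancel] at this
        rwa [pow_succ', Module.End.mul_apply]
      have hFEw := hUF _ hEw
      have hHw := hUH _ hvw
      simp only [LinearMap.sub_apply, Module.End.mul_apply, LinearMap.add_apply,
        Module.End.one_apply, Module.End.natCast_apply] at e1
      -- E^{j+1} F w = F E^{j+1} w + (j+1)(H - j) E^j w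
      set y := (E ^ j) w with hy
      have e2 : (E ^ (j + 1)) (F w) = F ((E ^ (j + 1)) w) + ((j : k) + 1) • (H y - (j : k) • y) := by
        rw [add_smul, one_smul, Nat.cast_smul_eq_nsmul, Nat.cast_smul_eq_nsmul, ← e1]
        abel
      rw [map_smul, e2]
      have e3 : v - (((j : k) + 1) * (μ - j))⁻¹ • (F ((E ^ (j + 1)) w) +
          ((j : k) + 1) • (H y - (j : k) • y)) =
          (((j : k) + 1) * (μ - j))⁻¹ • (-F ((E ^ (j + 1)) w) + ((j : k) + 1) •
            (-(H v - μ • v) + H (v - y) - (j : k) • (v - y))) := by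
        have e4 : v = (((j : k) + 1) * (μ - j))⁻¹ • ((((j : k) + 1) * (μ - j)) • v) := by
          rw [smul_smul, inv_mul_cancel₀ hc, one_smul]
        nth_rewrite 1 [e4]
        rw [← smul_sub, map_sub]
        congr 1
        module
      rw [e3]
      refine U.smul_mem _ (U.add_mem (U.neg_mem hFEw) (U.smul_mem _ ?_))
      exact U.sub_mem (U.add_mem (U.neg_mem hH) hHw) (U.smul_mem _ hvw)
  obtain ⟨N, hN⟩ := hnil
  obtain ⟨w, hw, hvw⟩ := key N
  have := U.add_mem hvw (hN w hw)
  rw [sub_add_cancel] at this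
  exact hvU this

lemma leib_aux {R : Type*} [Ring R] {e z w : R} (hw : e * z - z * e = w) (hc : e * w = w * e)
    (j : ℕ) (y : R) (D : R → R) (hD : ∀ y, D y = e * y - y * e) :
    D^[j + 1] (z * y) = z * D^[j + 1] y + ((j + 1 : ℕ) : R) * (w * D^[j] y) := by
  induction j with
  | zero =>
    simp only [zero_add, Function.iterate_one, Function.iterate_zero, id, hD, ← hw, Nat.cast_one]
    noncomm_ring
  | succ j ih =>
    rw [Function.iterate_succ_apply' D (j + 1) (z * y), ih, hD,
      Function.iterate_succ_apply' D (j + 1) y, Function.iterate_succ_apply' D j y, hD, hD]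
    set u := D^[j] y
    have hez : e * z = w + z * e := by rw [← hw]; abel
    have e1 : ((j + 1 : ℕ) : R) * e = e * ((j + 1 : ℕ) : R) := (Nat.cast_commute _ e).eq
    set q := ((j + 1 : ℕ) : R)
    have e2 : ((j + 1 + 1 : ℕ) : R) = q + 1 := by push_cast [q]; rfl
    rw [e2]
    have t1 : e * (z * (e * u - u * e)) = w * (e * u - u * e) + z * (e * (e * u - u * e)) := by
      rw [← mul_assoc, hez, add_mul, mul_assoc]
    have t2 : e * (q * (w * u)) = q * (w * (e * u)) := by
      rw [← mul_assoc, ← e1, mul_assoc, ← mul_assoc e, hc, mul_assoc]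
    rw [mul_add, t1, t2]
    noncomm_ring

/-- Jacobson's lemma. -/
lemma jacobson_nil {R : Type*} [Ring R] [Algebra k R] [CharZero k] {e z w : R}
    (hw : e * z - z * e = w) (hc : e * w = w * e) (he : IsNilpotent e) : IsNilpotent w := by
  let D : R → R := fun y => e * y - y * e
  have hD : ∀ y, D y = e * y - y * e := fun _ => rfl
  have h1 : ∀ j : ℕ, D^[j] (z ^ j) = ((j.factorial : ℕ) : R) * w ^ j := by
    intro j
    induction j with
    | zero => simp
    | succ j ih =>
      rw [pow_succ', leib_aux hw hc j (z ^ j) D hD, Function.iterate_succ_apply', ih, hD]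
      have c1 : e * (((j.factorial : ℕ) : R) * w ^ j) = ((j.factorial : ℕ) : R) * w ^ j * e :=
        ((Nat.cast_commute _ e).symm.mul_right (Commute.pow_right hc j)).eq
      rw [c1, sub_self, mul_zero, zero_add, Nat.factorial_succ, pow_succ']
      push_cast
      rw [← mul_assoc w, ← (Nat.cast_commute (j.factorial) w).eq]
      noncomm_ring
  obtain ⟨N, hN⟩ := he
  -- iterates of D vanish
  have h2 : ∀ (j : ℕ) (y : R), ∃ c : ℕ → ℕ → ℤ, D^[j] y =
      ∑ a ∈ Finset.range (j + 1), (c j a) • (e ^ a * y * e ^ (j - a)) := by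
    intro j y
    have hLR : Commute (LinearMap.mulLeft ℤ e) (LinearMap.mulRight ℤ e) := by
      apply LinearMap.ext; intro x; simp [mul_assoc]
    have hDj : D^[j] y = ((LinearMap.mulLeft ℤ e - LinearMap.mulRight ℤ e) ^ j) y := by
      rw [Module.End.pow_apply]
      congr 1
    refine ⟨fun j a => (-1) ^ (j - a) * (j.choose a), ?_⟩
    rw [hDj, sub_eq_add_neg, hLR.neg_right.add_pow, LinearMap.sum_apply]
    refine Finset.sum_congr rfl fun a _ => ?_
    rw [neg_pow]
    simp only [Module.End.mul_apply, LinearMap.pow_mulLeft, LinearMap.pow_mulRight,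
      Module.End.natCast_apply, LinearMap.mulLeft_apply, LinearMap.mulRight_apply]
    have h3 : ((-1 : Module.End ℤ R) ^ (j - a)) = (((-1 : ℤ) ^ (j - a)) • (1 : Module.End ℤ R)) := by
      rcases neg_one_pow_eq_or ℤ (j - a) with h | h
      · rcases Nat.even_or_odd (j - a) with h' | h'
        · simp [h'.neg_one_pow]
        · simp [h'.neg_one_pow]
      · rcases Nat.even_or_odd (j - a) with h' | h'
        · simp [h'.neg_one_pow]
        · simp [h'.neg_one_pow]
    rw [h3]
    simp only [LinearMap.smul_apply, Module.End.one_apply, mul_smul]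
    simp only [mul_smul_comm, smul_mul_assoc, mul_assoc, natCast_zsmul]
  obtain ⟨c, hc'⟩ := h2 (2 * N) (z ^ (2 * N))
  have h3 : D^[2 * N] (z ^ (2 * N)) = 0 := by
    rw [hc']
    refine Finset.sum_eq_zero fun a _ => ?_
    rcases le_total N a with h | h
    · rw [pow_eq_zero_of_le h hN]; simp
    · rw [pow_eq_zero_of_le (show N ≤ 2 * N - a by omega) hN]; simp
  rw [h1] at h3
  refine ⟨2 * N, ?_⟩
  have h4 : ((((2 * N).factorial : ℕ) : k)) • w ^ (2 * N) = 0 := by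
    rw [Nat.cast_smul_eq_nsmul, nsmul_eq_mul, h3]
  exact (smul_eq_zero_iff_right (Nat.cast_ne_zero.2 (Nat.factorial_ne_zero _))).1 h4

lemma ez_nil {R : Type*} [Ring R] {e z w : R}
    (hw : e * z - z * e = w) (hc : e * w = w * e) (hwn : IsNilpotent w) (i : ℕ) :
    ∀ v : R, e ^ i * v = 0 → ∃ m, (e * z) ^ m * v = 0 := by
  have h1 : ∀ i : ℕ, e ^ i * (e * z) = z * e ^ (i + 1) + ((i + 1 : ℕ) : R) * (w * e ^ i) := by
    intro i
    have hez : e * z = w + z * e := by rw [← hw]; abel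
    induction i with
    | zero => simp [hez, add_comm]
    | succ i ih =>
      have e1 : ((i + 1 : ℕ) : R) * e = e * ((i + 1 : ℕ) : R) := (Nat.cast_commute _ e).eq
      rw [pow_succ', mul_assoc, ih, mul_add, ← mul_assoc e z, hez, ← mul_assoc e _ (w * _), ← e1,
        mul_assoc _ e, ← mul_assoc e w, hc, mul_assoc w e, ← pow_succ' e i, add_mul, mul_assoc z e,
        ← pow_succ' e (i + 1)]
      push_cast
      noncomm_ring
  induction i with
  | zero => intro v hv; exact ⟨0, by simpa using hv⟩
  | succ i ih =>
    intro v hv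
    have h2 : ∀ m : ℕ, e ^ (i + 1) * ((e * z) ^ m * v) = 0 ∧
        e ^ i * ((e * z) ^ m * v) = ((i + 1 : ℕ) : R) ^ m * (w ^ m * (e ^ i * v)) := by
      intro m
      induction m with
      | zero => exact ⟨by simpa using hv, by simp⟩
      | succ m ihm =>
        set y := (e * z) ^ m * v
        have hs : (e * z) ^ (m + 1) * v = (e * z) * y := by rw [pow_succ', mul_assoc]
        have h3 : e ^ i * ((e * z) * y) = ((i + 1 : ℕ) : R) * (w * (e ^ i * y)) := by
          rw [← mul_assoc, h1, add_mul, mul_assoc z, ihm.1, mul_zero, zero_add]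
          simp only [mul_assoc]
        rw [hs]
        constructor
        · rw [pow_succ', mul_assoc, h3, ← mul_assoc e, ← (Nat.cast_commute (i + 1) e).eq, mul_assoc,
            ← mul_assoc e w, hc, mul_assoc w e, ← mul_assoc e, ← pow_succ', ihm.1]
          simp
        · have c1 : w * ((i + 1 : ℕ) : R) ^ m = ((i + 1 : ℕ) : R) ^ m * w :=
            (((Nat.cast_commute (i + 1) w)).pow_left m).symm.eq
          rw [h3, ihm.2, ← mul_assoc w, c1, mul_assoc, ← mul_assoc, ← pow_succ', ← mul_assoc w,
            ← pow_succ']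
    obtain ⟨M, hM⟩ := hwn
    obtain ⟨m, hm⟩ := ih _ (by rw [(h2 M).2, hM]; simp)
    exact ⟨m + M, by rw [pow_add, mul_assoc, hm]⟩

variable {n : ℕ}

lemma trace_zero_of_nil {A : Matrix (Fin n) (Fin n) k} (hA : IsNilpotent A) : A.trace = 0 :=
  (Matrix.isNilpotent_trace_of_isNilpotent hA).eq_zero

lemma trace_ez [CharZero k] {e z : Matrix (Fin n) (Fin n) k} (he : IsNilpotent e)
    (h : e * (e * z - z * e) - (e * z - z * e) * e = 0) : (e * z).trace = 0 := by
  have hc := sub_eq_zero.1 h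
  have hw := jacobson_nil (k := k) rfl hc he
  obtain ⟨N, hN⟩ := he
  obtain ⟨m, hm⟩ := ez_nil rfl hc hw N 1 (by rw [hN, zero_mul])
  exact trace_zero_of_nil ⟨m, by simpa using hm⟩

/-- A weak form of the Jacobson–Morozov theorem. -/
lemma jm_lite [CharZero k] (g : Submodule k (Matrix (Fin n) (Fin n) k))
    (hg : ∀ A ∈ g, ∀ B ∈ g, A * B - B * A ∈ g)
    (hnd : ∀ A ∈ g, (∀ B ∈ g, (A * B).trace = 0) → A = 0)
    {e : Matrix (Fin n) (Fin n) k} (heg : e ∈ g) (he : IsNilpotent e) :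
    ∃ f ∈ g, (e * f - f * e) * e - e * (e * f - f * e) = 2 * e := by
  let ad2 : g →ₗ[k] g :=
    { toFun := fun z => ⟨e * (e * z - z * e) - (e * z - z * e) * e, hg _ heg _ (hg _ heg _ z.2)⟩
      map_add' := fun x y => by
        ext1; simp only [Submodule.coe_add]; noncomm_ring
      map_smul' := fun c x => by
        ext1; simp [mul_sub, sub_mul, smul_sub] }
  have hmem : (⟨e, heg⟩ : g) ∈ LinearMap.range ad2 := by
    by_contra hcon
    obtain ⟨θ, hθ, hθS⟩ := Submodule.exists_le_ker_of_notMem hcon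
    let B : g →ₗ[k] Module.Dual k g := LinearMap.mk₂ k (fun y s => ((s : Matrix (Fin n) (Fin n) k) *
      (y : Matrix (Fin n) (Fin n) k)).trace)
      (fun x y s => by simp [mul_add]) (fun c x s => by simp)
      (fun x y s => by simp [add_mul]) (fun c x s => by simp)
    have hBi : Function.Injective B := by
      rw [injective_iff_map_eq_zero]
      intro y hy
      ext1
      refine hnd y y.2 fun s hs => ?_
      have := LinearMap.congr_fun hy ⟨s, hs⟩
      rw [Matrix.trace_mul_comm]
      exact this
    have hBs : Function.Surjective B :=
      (LinearMap.injective_iff_surjective_of_finrank_eq_finrank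
        (Subspace.dual_finrank_eq (K := k) (V := g)).symm).1 hBi
    obtain ⟨y, rfl⟩ := hBs θ
    have hy : e * (e * (y : Matrix (Fin n) (Fin n) k) - y * e) -
        (e * (y : Matrix (Fin n) (Fin n) k) - y * e) * e = 0 := by
      refine hnd _ (ad2 y).2 fun z hz => ?_
      have h1 : ((ad2 ⟨z, hz⟩ : Matrix (Fin n) (Fin n) k) * y).trace = 0 := hθS ⟨_, rfl⟩
      rw [← h1]
      have e1 : ∀ A B C D : Matrix (Fin n) (Fin n) k, (A * B * C * D).trace = (D * A * B * C).trace := by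
        intro A B C D
        rw [Matrix.trace_mul_comm, ← Matrix.mul_assoc, ← Matrix.mul_assoc]
      change _ = ((e * (e * z - z * e) - (e * z - z * e) * e) * (y : Matrix (Fin n) (Fin n) k)).trace
      set Y := (y : Matrix (Fin n) (Fin n) k)
      have e2 : (e * (e * Y - Y * e) - (e * Y - Y * e) * e) * z =
          e * e * Y * z - e * Y * e * z - e * Y * e * z + Y * e * e * z := by noncomm_ring
      have e3 : (e * (e * z - z * e) - (e * z - z * e) * e) * Y =
          e * e * z * Y - e * z * e * Y - e * z * e * Y + z * e * e * Y := by noncomm_ring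
      rw [e2, e3]
      simp only [Matrix.trace_add, Matrix.trace_sub]
      rw [e1 e e Y z, e1 e Y e z, e1 z e Y e, e1 Y e e z, e1 z Y e e, e1 e z Y e]
      ring
    exact hθ (trace_ez he hy)
  obtain ⟨z, hz⟩ := hmem
  have hz' : e * (e * (z : Matrix (Fin n) (Fin n) k) - z * e) - (e * z - z * e) * e = e :=
    congrArg Subtype.val hz
  refine ⟨(-2 : k) • (z : Matrix (Fin n) (Fin n) k), g.smul_mem _ z.2, ?_⟩
  have : (e * ((-2 : k) • (z : Matrix (Fin n) (Fin n) k)) - ((-2 : k) • (z : Matrix (Fin n) (Fin n) k)) * e) * e -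
      e * (e * ((-2 : k) • (z : Matrix (Fin n) (Fin n) k)) - ((-2 : k) • (z : Matrix (Fin n) (Fin n) k)) * e) =
      (2 : k) • (e * (e * (z : Matrix (Fin n) (Fin n) k) - z * e) - (e * z - z * e) * e) := by
    simp only [Matrix.mul_smul, Matrix.smul_mul, ← smul_sub]
    rw [neg_smul, ← smul_neg]
    congr 1
    abel
  rw [this, hz', two_smul, two_mul]

end LinAlg


section Nondeg

set_option linter.unusedSimpArgs false
set_option linter.unusedSectionVars false

variable {n : ℕ}

lemma cdg_mul (P : GL (Fin n) k) (a b : Fin n → k) : cdg P a * cdg P b = cdg P (fun i => a i * b i) := by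
  unfold cdg
  rw [← Matrix.diagonal_mul_diagonal]
  have : ((P⁻¹ : GL (Fin n) k) : Matrix (Fin n) (Fin n) k) * (P : Matrix (Fin n) (Fin n) k) = 1 := by
    rw [← Units.val_mul]; simp
  calc _ = (P : Matrix (Fin n) (Fin n) k) * Matrix.diagonal a *
      (((P⁻¹ : GL (Fin n) k) : Matrix (Fin n) (Fin n) k) * (P : Matrix (Fin n) (Fin n) k)) *
      Matrix.diagonal b * ((P⁻¹ : GL (Fin n) k) : Matrix (Fin n) (Fin n) k) := by
        simp only [Matrix.mul_assoc]
    _ = _ := by rw [this, Matrix.mul_one]; simp only [Matrix.mul_assoc]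

lemma cdg_trace (P : GL (Fin n) k) (a : Fin n → k) : (cdg P a).trace = ∑ i, a i := by
  unfold cdg
  have : ((P⁻¹ : GL (Fin n) k) : Matrix (Fin n) (Fin n) k) * (P : Matrix (Fin n) (Fin n) k) = 1 := by
    rw [← Units.val_mul]; simp
  rw [Matrix.trace_mul_comm, ← Matrix.mul_assoc, this, Matrix.one_mul, Matrix.trace_diagonal]

lemma cdg_commute {P : GL (Fin n) k} {a : Fin n → k} {N : Matrix (Fin n) (Fin n) k}
    (h : Commute (cdg P a) N) (φ : k → k) : Commute (cdg P (fun i => φ (a i))) N := by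
  have h1 : ((P⁻¹ : GL (Fin n) k) : Matrix (Fin n) (Fin n) k) * (P : Matrix (Fin n) (Fin n) k) = 1 := by
    rw [← Units.val_mul]; simp
  have h2 : (P : Matrix (Fin n) (Fin n) k) * ((P⁻¹ : GL (Fin n) k) : Matrix (Fin n) (Fin n) k) = 1 := by
    rw [← Units.val_mul]; simp
  unfold cdg at *
  set Q := ((P⁻¹ : GL (Fin n) k) : Matrix (Fin n) (Fin n) k)
  set R := (P : Matrix (Fin n) (Fin n) k)
  have key : ∀ b : Fin n → k, Commute (R * Matrix.diagonal b * Q) N ↔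
      Commute (Matrix.diagonal b) (Q * N * R) := by
    intro b
    constructor
    · intro hh
      have := congrArg (fun M => Q * M * R) hh.eq
      beta_reduce at this
      have e1 : Q * (R * Matrix.diagonal b * Q * N) * R = (Q * R) * Matrix.diagonal b * (Q * N * R) := by
        simp only [Matrix.mul_assoc]
      have e2 : Q * (N * (R * Matrix.diagonal b * Q)) * R = (Q * N * R) * Matrix.diagonal b * (Q * R) := by
        simp only [Matrix.mul_assoc]
      rw [e1, e2, h1, Matrix.one_mul, Matrix.mul_one] at this
      exact this
    · intro hh
      have := congrArg (fun M => R * M * Q) hh.eq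
      beta_reduce at this
      have e1 : R * (Matrix.diagonal b * (Q * N * R)) * Q = R * Matrix.diagonal b * Q * N * (R * Q) := by
        simp only [Matrix.mul_assoc]
      have e2 : R * (Q * N * R * Matrix.diagonal b) * Q = (R * Q) * N * (R * Matrix.diagonal b * Q) := by
        simp only [Matrix.mul_assoc]
      rw [e1, e2, h2, Matrix.one_mul, Matrix.mul_one] at this
      exact this
  rw [key] at h ⊢
  ext i j
  have := congrFun (congrFun h.eq i) j
  rw [Matrix.diagonal_mul, Matrix.mul_diagonal] at this ⊢
  by_cases h0 : (Q * N * R) i j = 0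
  · rw [h0]; ring
  · have : a i = a j := by
      apply mul_right_cancel₀ h0
      rw [this]; ring
    rw [this]; ring

lemma rad_nil [IsAlgClosed k] [CharZero k] {H : Set (GL (Fin n) k)} {A : Matrix (Fin n) (Fin n) k}
    (hA : A ∈ lieS H) (htr : ∀ B ∈ lieS H, (A * B).trace = 0) : IsNilpotent A := by
  obtain ⟨P, a, N, hN, hc, rfl⟩ := jordan A
  have h1 : ∀ (ψ : k →ₗ[ℚ] ℚ) (i : Fin n), ψ (a i) = 0 := by
    intro ψ
    let φ : k →+ k := ((algebraMap ℚ k).toAddMonoidHom).comp ψ.toAddMonoidHom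
    have hφ : ∀ c, φ c = ((ψ c : ℚ) : k) := fun c => by simp [φ]
    have hB := replica hN hc hA φ
    have h2 := htr _ hB
    have hcB : Commute N (cdg P fun i => φ (a i)) := (cdg_commute hc φ).symm
    rw [Matrix.add_mul, Matrix.trace_add, cdg_mul, cdg_trace,
      trace_zero_of_nil (hcB.isNilpotent_mul_right hN), add_zero] at h2
    have h3 : ∑ i, ψ (a i) • a i = 0 := by
      rw [← h2]
      refine Finset.sum_congr rfl fun i _ => ?_
      rw [hφ, Rat.smul_def, mul_comm]
    have h4 := congrArg ψ h3
    rw [map_sum, map_zero] at h4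
    simp only [map_smul, smul_eq_mul] at h4
    intro i
    have := (Finset.sum_eq_zero_iff_of_nonneg (fun i _ => mul_self_nonneg (ψ (a i)))).1 h4 i
      (Finset.mem_univ _)
    exact mul_self_eq_zero.1 this
  have ha : a = 0 := by
    funext i
    exact (Module.forall_dual_apply_eq_zero_iff ℚ (a i)).1 fun ψ => h1 ψ i
  have : cdg P a = 0 := by rw [ha]; simp [cdg]
  rw [this, zero_add]
  exact hN

attribute [local instance] LieRing.ofAssociativeRing

/-- Engel theorem in flag form. -/
lemma engel_flag (g : Submodule k (Matrix (Fin n) (Fin n) k))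
    (hg : ∀ A ∈ g, ∀ B ∈ g, A * B - B * A ∈ g) (hnil : ∀ A ∈ g, IsNilpotent A) :
    ∃ F : ℕ → Submodule k (Fin n → k), F 0 = ⊤ ∧ (∃ K, F K = ⊥) ∧ Antitone F ∧
      ∀ A ∈ g, ∀ i, ∀ v ∈ F i, A.mulVec v ∈ F (i + 1) := by
  let L : LieSubalgebra k (Module.End k (Fin n → k)) :=
    { g.map (Matrix.toLin' : _ ≃ₗ[k] _).toLinearMap with
      lie_mem' := by
        rintro _ _ ⟨A, hA, rfl⟩ ⟨B, hB, rfl⟩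
        refine ⟨A * B - B * A, hg A hA B hB, ?_⟩
        simp [LieRing.of_associative_ring_bracket, Matrix.toLin'_mul, Module.End.mul_eq_comp] }
  have hL : LieModule.IsNilpotent L (Fin n → k) := by
    rw [LieModule.isNilpotent_iff_forall (R := k)]
    rintro ⟨_, A, hA, rfl⟩
    obtain ⟨N, hN⟩ := hnil A hA
    refine ⟨N, ?_⟩
    have e : (LieModule.toEnd k L (Fin n → k)) ⟨_, ⟨A, hA, rfl⟩⟩ = Matrix.toLin' A := by
      ext v; rfl
    rw [e, ← Matrix.toLin'_pow, hN, map_zero]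
  obtain ⟨K, hK⟩ := (LieModule.isNilpotent_iff k L (Fin n → k)).1 hL
  refine ⟨fun i => (LieModule.lowerCentralSeries k L (Fin n → k) i).toSubmodule, by simp, ⟨K, by simp [hK]⟩,
    fun i j hij => LieModule.antitone_lowerCentralSeries k L (Fin n → k) hij, ?_⟩
  intro A hA i v hv
  change _ ∈ LieModule.lowerCentralSeries k L (Fin n → k) (i + 1)
  rw [LieModule.lowerCentralSeries_succ]
  exact LieSubmodule.lie_mem_lie (x := (⟨Matrix.toLin' A, ⟨A, hA, rfl⟩⟩ : L)) (LieSubmodule.mem_top _) hv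

lemma flag_exp [CharZero k] {F : ℕ → Submodule k (Fin n → k)} (hF : Antitone F)
    {A : Matrix (Fin n) (Fin n) k} (hA : ∀ i, ∀ v ∈ F i, A.mulVec v ∈ F (i + 1)) (hN : IsNilpotent A)
    (s : k) (i : ℕ) (v : Fin n → k) (hv : v ∈ F i) :
    ((uGL A hN s : Matrix (Fin n) (Fin n) k) - 1).mulVec v ∈ F (i + 1) := by
  have h1 : ∀ r : ℕ, ∀ v ∈ F i, (A ^ (r + 1)).mulVec v ∈ F (i + 1) := by
    intro r
    induction r with
    | zero => intro v hv; simpa using hA i v hv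
    | succ r ih =>
      intro v hv
      rw [pow_succ', ← Matrix.mulVec_mulVec]
      exact hF (Nat.le_succ _) (hA _ _ (ih v hv))
  have h2 : ∀ r : ℕ, ∀ v ∈ F i, ((s • A) ^ (r + 1)).mulVec v ∈ F (i + 1) := by
    intro r v hv
    rw [smul_pow, Matrix.smul_mulVec]
    exact (F (i + 1)).smul_mem _ (h1 r v hv)
  obtain ⟨M, hM⟩ := hN.smul s
  have hM' : (s • A) ^ (M + 1) = 0 := by rw [pow_succ, hM, zero_mul]
  rw [uGL_val, IsNilpotent.exp_eq_sum hM', Finset.sum_range_succ']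
  simp only [pow_zero, Nat.factorial_zero, Nat.cast_one, inv_one, one_smul, add_sub_cancel_right]
  rw [Matrix.sum_mulVec]
  refine Submodule.sum_mem _ fun r _ => ?_
  have : ((((r + 1).factorial : ℚ))⁻¹ • (s • A) ^ (r + 1)) =
      ((((r + 1).factorial : ℚ)⁻¹ : ℚ) : k) • (s • A) ^ (r + 1) := (Rat.cast_smul_eq_qsmul k _ _).symm
  rw [this, Matrix.smul_mulVec]
  exact (F (i + 1)).smul_mem _ (h2 r v hv)

end Nondeg


section Reductive

set_option linter.unusedSimpArgs false
set_option linter.unusedSectionVars false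

variable {n : ℕ}

noncomputable def rinl (f : MvPolynomial (Fin n × Fin n) k) : CRing n k :=
  MvPolynomial.rename Sum.inl f

lemma ev_rinl (g : GL (Fin n) k) (f : MvPolynomial (Fin n × Fin n) k) :
    ev g (rinl f) = MvPolynomial.eval (mat2pt (g : Matrix (Fin n) (Fin n) k)) f := by
  unfold rinl ev
  rw [MvPolynomial.aeval_rename, MvPolynomial.aeval_eq_eval]
  rfl

lemma zc_of_closed (G : AlgGroup k) : ZC (G.toSubgroup : Set (GL (Fin G.n) k)) := by
  obtain ⟨I, hI⟩ := G.closed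
  intro g hg
  refine (hI g).2 fun f hf => ?_
  rw [← ev_rinl]
  refine hg _ ?_
  rw [mem_Iv]
  intro h hh
  rw [ev_rinl]
  exact (hI h).1 hh f hf

variable [CharZero k]

lemma conn_step {U V W : Set (GL (Fin n) k)} (hV : ClosedInGL V) (hW : ClosedInGL W)
    (hcov : U ⊆ V ∪ W) (hdis : U ∩ V ∩ W = ∅) {h : GL (Fin n) k} (hh : h ∈ U) (hhV : h ∈ V)
    {N : Matrix (Fin n) (Fin n) k} (hN : IsNilpotent N) (hU : ∀ s, h * uGL N hN s ∈ U) (s : k) :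
    h * uGL N hN s ∈ V := by
  obtain ⟨M, hM⟩ := hN
  have hN : IsNilpotent N := ⟨M, hM⟩
  have key : ∀ S : Set (GL (Fin n) k), ClosedInGL S → {s : k | h * uGL N hN s ∈ S}.Infinite →
      ∀ s, h * uGL N hN s ∈ S := by
    rintro S ⟨I, rfl⟩ hinf s
    intro f hf
    rw [← ev_rinl, ← QC_eval h hN hM]
    have : QC h N M (rinl f) = 0 := by
      apply Polynomial.eq_zero_of_infinite_isRoot
      refine hinf.mono fun t ht => ?_
      have := ht f hf
      rw [← ev_rinl, ← QC_eval h hN hM] at this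
      exact this
    rw [this, Polynomial.eval_zero]
  have hun : {s : k | h * uGL N hN s ∈ V} ∪ {s : k | h * uGL N hN s ∈ W} = Set.univ := by
    ext s
    simp only [Set.mem_union, Set.mem_ofPred_eq, Set.mem_univ, iff_true]
    exact hcov (hU s)
  have hinf : ({s : k | h * uGL N hN s ∈ V} ∪ {s : k | h * uGL N hN s ∈ W}).Infinite := by
    rw [hun]
    have : Infinite k := CharZero.infinite k
    exact Set.infinite_univ
  rcases Set.infinite_union.1 hinf with h1 | h1
  · exact key V hV h1 s
  · exfalso
    have := key W hW h1 0
    rw [uGL_zero, mul_one] at this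
    have h3 : h ∈ U ∩ V ∩ W := ⟨⟨hh, hhV⟩, this⟩
    rw [hdis] at h3
    exact h3

lemma uGL_conj (g : GL (Fin n) k) {N : Matrix (Fin n) (Fin n) k} (hN : IsNilpotent N) (s : k)
    (hN' : IsNilpotent ((g : Matrix (Fin n) (Fin n) k) * N * ((g⁻¹ : GL (Fin n) k) : Matrix (Fin n) (Fin n) k))) :
    g * uGL N hN s * g⁻¹ = uGL _ hN' s := by
  apply Units.ext
  rw [Units.val_mul, Units.val_mul, uGL_val, uGL_val]
  have h1 : ((g⁻¹ : GL (Fin n) k) : Matrix (Fin n) (Fin n) k) * (g : Matrix (Fin n) (Fin n) k) = 1 := by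
    rw [← Units.val_mul]; simp
  have h2 : (g : Matrix (Fin n) (Fin n) k) * ((g⁻¹ : GL (Fin n) k) : Matrix (Fin n) (Fin n) k) = 1 := by
    rw [← Units.val_mul]; simp
  set Q := ((g⁻¹ : GL (Fin n) k) : Matrix (Fin n) (Fin n) k)
  set R := (g : Matrix (Fin n) (Fin n) k)
  have hp : ∀ r : ℕ, (s • (R * N * Q)) ^ r = R * (s • N) ^ r * Q := by
    intro r
    induction r with
    | zero => simp [h2]
    | succ r ih =>
      rw [pow_succ, ih, pow_succ]
      have : R * (s • N) ^ r * Q * (s • (R * N * Q)) = R * (s • N) ^ r * (Q * R) * (s • N) * Q := by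
        simp only [Matrix.mul_smul, Matrix.smul_mul, Matrix.mul_assoc]
      rw [this, h1, Matrix.mul_one, Matrix.mul_assoc R]
  obtain ⟨M, hM⟩ := hN.smul s
  have hM' : (s • (R * N * Q)) ^ M = 0 := by rw [hp, hM]; simp
  rw [IsNilpotent.exp_eq_sum hM, IsNilpotent.exp_eq_sum hM', Finset.mul_sum, Finset.sum_mul]
  refine Finset.sum_congr rfl fun r _ => ?_
  rw [hp, mul_smul_comm, smul_mul_assoc]

lemma nilp_conj (g : GL (Fin n) k) {N : Matrix (Fin n) (Fin n) k} (hN : IsNilpotent N) :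
    IsNilpotent ((g : Matrix (Fin n) (Fin n) k) * N * ((g⁻¹ : GL (Fin n) k) : Matrix (Fin n) (Fin n) k)) := by
  have h1 : ((g⁻¹ : GL (Fin n) k) : Matrix (Fin n) (Fin n) k) * (g : Matrix (Fin n) (Fin n) k) = 1 := by
    rw [← Units.val_mul]; simp
  have h2 : (g : Matrix (Fin n) (Fin n) k) * ((g⁻¹ : GL (Fin n) k) : Matrix (Fin n) (Fin n) k) = 1 := by
    rw [← Units.val_mul]; simp
  set Q := ((g⁻¹ : GL (Fin n) k) : Matrix (Fin n) (Fin n) k)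
  set R := (g : Matrix (Fin n) (Fin n) k)
  have hp : ∀ r : ℕ, (R * N * Q) ^ r = R * N ^ r * Q := by
    intro r
    induction r with
    | zero => simp [h2]
    | succ r ih =>
      rw [pow_succ, ih, pow_succ]
      have : R * N ^ r * Q * (R * N * Q) = R * N ^ r * (Q * R) * N * Q := by
        simp only [Matrix.mul_assoc]
      rw [this, h1, Matrix.mul_one, Matrix.mul_assoc R]
  obtain ⟨M, hM⟩ := hN
  exact ⟨M, by rw [hp, hM]; simp⟩

variable [IsAlgClosed k]

def radS (H : Set (GL (Fin n) k)) : Submodule k (Matrix (Fin n) (Fin n) k) where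
  carrier := {A | A ∈ lieS H ∧ ∀ B ∈ lieS H, (A * B).trace = 0}
  add_mem' := by
    rintro a b ⟨h1, h2⟩ ⟨h3, h4⟩
    exact ⟨add_mem h1 h3, fun B hB => by rw [Matrix.add_mul, Matrix.trace_add, h2 B hB, h4 B hB, add_zero]⟩
  zero_mem' := ⟨zero_mem _, fun B hB => by simp⟩
  smul_mem' := by
    rintro c a ⟨h1, h2⟩
    exact ⟨Submodule.smul_mem _ _ h1, fun B hB => by rw [Matrix.smul_mul, Matrix.trace_smul, h2 B hB, smul_zero]⟩

lemma nondeg (G : AlgGroup k) (hG : IsReductive G) (A : Matrix (Fin G.n) (Fin G.n) k)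
    (hA : A ∈ lieS (G.toSubgroup : Set (GL (Fin G.n) k)))
    (htr : ∀ B ∈ lieS (G.toSubgroup : Set (GL (Fin G.n) k)), (A * B).trace = 0) : A = 0 := by
  set L := lieS (G.toSubgroup : Set (GL (Fin G.n) k)) with hLdef
  set R := radS (G.toSubgroup : Set (GL (Fin G.n) k)) with hRdef
  have hRnil : ∀ A ∈ R, IsNilpotent A := fun A hA => rad_nil hA.1 hA.2
  have hRlie : ∀ A ∈ R, ∀ B ∈ R, A * B - B * A ∈ R := by
    rintro A ⟨hA, hA'⟩ B ⟨hB, hB'⟩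
    refine ⟨lieS_lie hA hB, fun C hC => ?_⟩
    have h1 := hA' _ (lieS_lie hB hC)
    rw [Matrix.mul_sub, Matrix.trace_sub] at h1
    rw [Matrix.sub_mul, Matrix.trace_sub, ← h1, Matrix.mul_assoc]
    congr 1
    rw [Matrix.mul_assoc, Matrix.trace_mul_comm, Matrix.mul_assoc]
  have hRconj : ∀ g ∈ G.toSubgroup, ∀ A ∈ R, (g : Matrix (Fin G.n) (Fin G.n) k) * A *
      ((g⁻¹ : GL (Fin G.n) k) : Matrix (Fin G.n) (Fin G.n) k) ∈ R := by
    rintro g hg A ⟨hA, hA'⟩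
    refine ⟨lieS_conj hA hg, fun B hB => ?_⟩
    have h1 := hA' _ (lieS_conj hB (G.toSubgroup.inv_mem hg))
    rw [inv_inv] at h1
    rw [← h1, Matrix.mul_assoc, Matrix.mul_assoc, Matrix.trace_mul_comm]
    simp only [Matrix.mul_assoc]
  let S : Set (GL (Fin G.n) k) := {u | ∃ (N : Matrix (Fin G.n) (Fin G.n) k) (hN : IsNilpotent N) (s : k),
    N ∈ R ∧ u = uGL N hN s}
  let U := Subgroup.closure S
  have hinvS : ∀ u ∈ S, u⁻¹ ∈ S := by
    rintro _ ⟨N, hN, s, hR, rfl⟩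
    refine ⟨N, hN, -s, hR, ?_⟩
    rw [inv_eq_iff_mul_eq_one, ← uGL_add, add_neg_cancel, uGL_zero]
  have hUG : U ≤ G.toSubgroup := by
    rw [Subgroup.closure_le]
    rintro _ ⟨N, hN, s, hR, rfl⟩
    exact uGL_mem (zc_of_closed G) hN hR.1 s
  have hconn1 : ∀ V W : Set (GL (Fin G.n) k), ClosedInGL V → ClosedInGL W →
      (U : Set (GL (Fin G.n) k)) ⊆ V ∪ W → (U : Set (GL (Fin G.n) k)) ∩ V ∩ W = ∅ →
      1 ∈ V → (U : Set (GL (Fin G.n) k)) ⊆ V := by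
    intro V W hV hW hcov hdis h1 u hu
    have hmul : ∀ x ∈ U, ∀ y ∈ S, x ∈ V → x * y ∈ V := by
      rintro x hx _ ⟨N, hN, s, hR, rfl⟩ hxV
      exact conn_step hV hW hcov hdis hx hxV hN
        (fun t => U.mul_mem hx (Subgroup.subset_closure ⟨N, hN, t, hR, rfl⟩)) s
    refine Subgroup.closure_induction_right (p := fun x _ => x ∈ V) h1 ?_ ?_ hu
    · intro x hx y hy hxV
      exact hmul x hx y hy hxV
    · intro x hx y hy hxV
      exact hmul x hx _ (hinvS y hy) hxV
  have hconn : IsConnSet (U : Set (GL (Fin G.n) k)) := by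
    intro V W hV hW hcov hdis
    rcases hcov U.one_mem with h | h
    · exact Or.inl (hconn1 V W hV hW hcov hdis h)
    · refine Or.inr (hconn1 W V hW hV (by rwa [Set.union_comm]) ?_ h)
      rw [← hdis, Set.inter_assoc, Set.inter_comm W V, Set.inter_assoc]
  obtain ⟨F, hF0, ⟨K, hK⟩, hFa, hFA⟩ := engel_flag R hRlie hRnil
  have hUflag : ∀ u ∈ U, ∀ i, ∀ v ∈ F i, ((u : Matrix (Fin G.n) (Fin G.n) k) - 1).mulVec v ∈ F (i + 1) := by
    have hmul : ∀ x y : GL (Fin G.n) k,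
        (∀ i, ∀ v ∈ F i, ((x : Matrix (Fin G.n) (Fin G.n) k) - 1).mulVec v ∈ F (i + 1)) →
        (∀ i, ∀ v ∈ F i, ((y : Matrix (Fin G.n) (Fin G.n) k) - 1).mulVec v ∈ F (i + 1)) →
        (∀ i, ∀ v ∈ F i, (((x * y : GL (Fin G.n) k) : Matrix (Fin G.n) (Fin G.n) k) - 1).mulVec v ∈ F (i + 1)) := by
      intro x y hx hy i v hv
      have e : (((x * y : GL (Fin G.n) k) : Matrix (Fin G.n) (Fin G.n) k) - 1) =
          ((x : Matrix (Fin G.n) (Fin G.n) k) - 1) * ((y : Matrix (Fin G.n) (Fin G.n) k) - 1) +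
          ((x : Matrix (Fin G.n) (Fin G.n) k) - 1) + ((y : Matrix (Fin G.n) (Fin G.n) k) - 1) := by
        rw [Units.val_mul]; noncomm_ring
      rw [e, Matrix.add_mulVec, Matrix.add_mulVec, ← Matrix.mulVec_mulVec]
      exact add_mem (add_mem (hFa (Nat.le_succ _) (hx _ _ (hy i v hv))) (hx i v hv)) (hy i v hv)
    have hS : ∀ x ∈ S, (∀ i, ∀ v ∈ F i, ((x : Matrix (Fin G.n) (Fin G.n) k) - 1).mulVec v ∈ F (i + 1)) := by
      rintro _ ⟨N, hN, s, hR, rfl⟩ i v hv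
      exact flag_exp hFa (hFA N hR) hN s i v hv
    intro u hu
    refine Subgroup.closure_induction_right (p := fun (u : GL (Fin G.n) k) _ => ∀ i, ∀ v ∈ F i,
      ((u : Matrix (Fin G.n) (Fin G.n) k) - 1).mulVec v ∈ F (i + 1)) ?_ ?_ ?_ hu
    · intro i v hv; simp
    · intro x hx y hy h; exact hmul x y h (hS y hy)
    · intro x hx y hy h; exact hmul x y⁻¹ h (hS _ (hinvS y hy))
  have hunip : ∀ u ∈ (U : Set (GL (Fin G.n) k)), IsUnipotentEl u := by
    intro u hu
    have h1 : ∀ i, ∀ v, ((((u : Matrix (Fin G.n) (Fin G.n) k) - 1) ^ i).mulVec v) ∈ F i := by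
      intro i
      induction i with
      | zero => intro v; rw [hF0]; trivial
      | succ i ih =>
        intro v
        rw [pow_succ', ← Matrix.mulVec_mulVec]
        exact hUflag u hu i _ (ih v)
    have h2 : IsNilpotent ((u : Matrix (Fin G.n) (Fin G.n) k) - 1) := by
      refine ⟨K, ?_⟩
      apply Matrix.toLin'.injective
      apply LinearMap.ext
      intro v
      have := h1 K v
      rw [hK, Submodule.mem_bot] at this
      rw [Matrix.toLin'_apply, this]
      simp
    have h3 := sub_eq_zero.1 (Matrix.isNilpotent_charpoly_sub_pow_of_isNilpotent h2).eq_zero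
    have h4 := Matrix.aeval_self_charpoly ((u : Matrix (Fin G.n) (Fin G.n) k) - 1)
    rw [h3] at h4
    simpa [IsUnipotentEl] using h4
  have hUtriv := hG (U : Set (GL (Fin G.n) k)) ?_ U.one_mem (fun a ha b hb => U.mul_mem ha hb)
    (fun a ha => U.inv_mem ha) ?_ hconn hunip
  · have hN : IsNilpotent A := hRnil A ⟨hA, htr⟩
    have h1 : ∀ s, uGL A hN s = 1 := by
      intro s
      have : uGL A hN s ∈ (U : Set (GL (Fin G.n) k)) := Subgroup.subset_closure ⟨A, hN, s, ⟨hA, htr⟩, rfl⟩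
      rw [hUtriv] at this
      exact this
    ext i j
    have := Dv_eq_zero_of_const 1 hN (MvPolynomial.X (Sum.inl (i, j))) (fun s => by rw [h1, mul_one])
    rw [← dif_apply, ev_dual_inl] at this
    exact this
  · exact Set.subset_sUnion_of_mem ⟨hUG, U.one_mem, hconn⟩
  · rintro g ⟨C, ⟨hC, _, _⟩, hgC⟩ h hh
    have hg : g ∈ G.toSubgroup := hC hgC
    have : U ≤ U.comap (MulAut.conj g).toMonoidHom := by
      rw [Subgroup.closure_le]
      rintro _ ⟨N, hN, s, hR, rfl⟩
      change g * uGL N hN s * g⁻¹ ∈ U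
      rw [uGL_conj g hN s (nilp_conj g hN)]
      exact Subgroup.subset_closure ⟨_, _, s, hRconj g hg N hR, rfl⟩
    exact this hh

end Reductive


section SL2

set_option linter.unusedSimpArgs false
set_option linter.unusedSectionVars false

variable {V : Type*} [AddCommGroup V] [Module k V]

lemma comp_mem {ι : Type*} (w : ι → k) (hw : Function.Injective w)
    (S : Module.End k V) (U : Submodule k V) (hU : ∀ u ∈ U, S u ∈ U) (s : Finset ι) :
    ∀ v : ι → V, (∀ c, S (v c) = w c • v c) → ∑ c ∈ s, v c ∈ U → ∀ c ∈ s, v c ∈ U := by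
  classical
  induction s using Finset.induction_on with
  | empty => intro v _ _ c hc; simp at hc
  | insert a s ha ih =>
    intro v hv hsum
    have h1 : ∑ c ∈ s, (w c - w a) • v c ∈ U := by
      have h2 := U.sub_mem (hU _ hsum) (U.smul_mem (w a) hsum)
      rw [Finset.sum_insert ha, map_add, hv, smul_add, add_sub_add_left_eq_sub, map_sum, Finset.smul_sum,
        ← Finset.sum_sub_distrib] at h2
      convert h2 using 2 with c _
      rw [hv, sub_smul]
    have h2 : ∀ c ∈ s, v c ∈ U := by
      intro c hc
      have h3 := ih (fun c => (w c - w a) • v c) (fun c => by rw [map_smul, hv, smul_comm]) h1 c hc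
      have hne : w c - w a ≠ 0 := sub_ne_zero.2 (fun h => ha (hw h ▸ hc))
      exact (U.smul_mem_iff hne).1 h3
    intro c hc
    rcases Finset.mem_insert.1 hc with rfl | hc
    · rw [Finset.sum_insert ha] at hsum
      exact (U.add_mem_iff_left (U.sum_mem h2)).1 hsum
    · exact h2 c hc

lemma last_pow (T : Module.End k V) (U : Submodule k V) {v : V} (hv : v ∉ U)
    (hT : ∃ m, (T ^ m) v ∈ U) : ∃ m, (T ^ m) v ∉ U ∧ T ((T ^ m) v) ∈ U := by
  classical
  have h := Nat.find_spec hT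
  rcases hm : Nat.find hT with _ | m
  · rw [hm] at h; exact absurd (by simpa using h) hv
  · refine ⟨m, Nat.find_min hT (by omega), ?_⟩
    rw [hm, pow_succ', Module.End.mul_apply] at h
    exact h

lemma ss_bracket {S T E H : Module.End k V} (hH : H = S + T) (hST : Commute S T)
    (htop : ⨆ c, S.eigenspace c = ⊤) (hT : ∀ v, ∃ m, (T ^ m) v = 0)
    (h2 : H * E - E * H = 2 * E) : S * E - E * S = 2 * E := by
  apply LinearMap.ext
  intro v
  have hv : v ∈ ⨆ c, S.eigenspace c := htop ▸ Submodule.mem_top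
  induction hv using Submodule.iSup_induction' with
  | zero => simp
  | add x y _ _ hx hy => rw [map_add, map_add, hx, hy]
  | mem c v hv =>
    have hSv : S v = c • v := Module.End.mem_eigenspace_iff.1 hv
    have e1 : ∀ m : ℕ, S ((T ^ m) v) = c • (T ^ m) v := by
      intro m
      have := LinearMap.congr_fun (hST.pow_right m).eq v
      simp only [Module.End.mul_apply] at this
      rw [this, hSv, map_smul]
    have e2 : ∀ m : ℕ, ((H - algebraMap k _ c) ^ m) v = (T ^ m) v := by
      intro m
      induction m with
      | zero => simp
      | succ m ih =>
        rw [pow_succ', Module.End.mul_apply, ih, pow_succ', Module.End.mul_apply, hH]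
        simp only [LinearMap.sub_apply, LinearMap.add_apply, Module.algebraMap_end_apply, e1]
        abel
    have e3 : (H - algebraMap k _ (c + 2)) * E = E * (H - algebraMap k _ c) := by
      have : H * E = E * H + 2 * E := by rw [← h2]; abel
      rw [sub_mul, this, mul_sub, map_add, add_mul, ← (Algebra.commutes c E), map_ofNat]
      abel
    have e4 : ∀ m : ℕ, (H - algebraMap k _ (c + 2)) ^ m * E = E * (H - algebraMap k _ c) ^ m := by
      intro m
      induction m with
      | zero => simp
      | succ m ih => rw [pow_succ, mul_assoc, e3, ← mul_assoc, ih, mul_assoc, ← pow_succ]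
    obtain ⟨m, hm⟩ := hT v
    have e5 : E v ∈ H.maxGenEigenspace (c + 2) := by
      rw [Module.End.mem_maxGenEigenspace]
      refine ⟨m, ?_⟩
      rw [← Algebra.algebraMap_eq_smul_one]
      have := LinearMap.congr_fun (e4 m) v
      simp only [Module.End.mul_apply] at this
      rw [this, e2, hm, map_zero]
    have e6 := Module.End.mem_eigenspace_iff.1 (maxGen_le_eigen hH hST htop hT (c + 2) e5)
    simp only [LinearMap.sub_apply, Module.End.mul_apply, e6, hSv, map_smul]
    have : ((2 : Module.End k V)) (E v) = (2 : k) • E v := by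
      rw [show (2 : Module.End k V) = 1 + 1 from one_add_one_eq_two.symm, LinearMap.add_apply, two_smul]
      rfl
    rw [this]
    module

lemma fg_nil (E : Module.End k V) (hE : ∀ v, ∃ m, (E ^ m) v = 0) (W : Submodule k V) (hW : W.FG) :
    ∃ N, ∀ w ∈ W, (E ^ N) w = 0 := by
  obtain ⟨s, rfl⟩ := hW
  choose m hm using hE
  refine ⟨s.sup m, fun w hw => ?_⟩
  have : Submodule.span k (s : Set V) ≤ LinearMap.ker (E ^ (s.sup m)) := by
    rw [Submodule.span_le]
    intro v hv
    rw [SetLike.mem_coe, LinearMap.mem_ker]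
    have hle : m v ≤ s.sup m := Finset.le_sup (f := m) hv
    obtain ⟨d, hd⟩ := Nat.exists_eq_add_of_le hle
    rw [hd, add_comm, pow_add, Module.End.mul_apply, hm, map_zero]
  exact this hw

lemma sub_comm_aux {R : Type*} [Ring R] (a b c : R) :
    (a - b) * c - c * (a - b) = (a * c - c * a) - (b * c - c * b) := by noncomm_ring

variable {n : ℕ}

lemma Dv_inj {A : Matrix (Fin n) (Fin n) k} (h : Dv A = 0) : A = 0 := by
  ext i j
  have := ev_dual_inl A (i, j)
  rw [dif_apply, h] at this
  simpa using this.symm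

lemma DE_lie (A B : Matrix (Fin n) (Fin n) k) : DE (A * B - B * A) = DE A * DE B - DE B * DE A := by
  apply LinearMap.ext
  intro f
  rw [DE_apply, Dv_lie, Derivation.commutator_apply]
  rfl

lemma DE_two (A : Matrix (Fin n) (Fin n) k) : DE (2 * A) = 2 * DE A := by
  apply LinearMap.ext
  intro f
  rw [two_mul, two_mul, DE_apply, Dv_add]
  rfl

lemma DE_add (A B : Matrix (Fin n) (Fin n) k) : DE (A + B) = DE A + DE B := by
  apply LinearMap.ext
  intro f
  rw [DE_apply, Dv_add]
  rfl

variable [CharZero k] [IsAlgClosed k]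

set_option maxHeartbeats 1000000 in
/-- Destabilizing one-parameter subgroup attached to a nilpotent element. -/
lemma sl2_weights {G : Subgroup (GL (Fin n) k)}
    (hnd : ∀ A ∈ lieS (G : Set (GL (Fin n) k)),
      (∀ B ∈ lieS (G : Set (GL (Fin n) k)), (A * B).trace = 0) → A = 0)
    {e : Matrix (Fin n) (Fin n) k} (he : IsNilpotent e) (heL : e ∈ lieS (G : Set (GL (Fin n) k))) :
    ∃ (P : GL (Fin n) k) (d : Fin n → ℤ),
      cdg P (fun i => (d i : k)) ∈ lieS (G : Set (GL (Fin n) k)) ∧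
      cdg P (fun i => (d i : k)) * e - e * cdg P (fun i => (d i : k)) = 2 * e ∧
      ∀ F : CRing n k, Dv e F ∈ Iv (G : Set (GL (Fin n) k)) →
        F ∈ (Iv (G : Set (GL (Fin n) k))).restrictScalars k ⊔ ⨆ j : ℕ, iwt P d j := by
  obtain ⟨f, hf, hfe⟩ := jm_lite _ (fun A hA B hB => lieS_lie hA hB) hnd heL he
  have hhL : e * f - f * e ∈ lieS (G : Set (GL (Fin n) k)) := lieS_lie heL hf
  obtain ⟨P, a, N, hN, hc, hh⟩ := jordan (e * f - f * e)
  set h := e * f - f * e with hdef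
  have hsL : cdg P a ∈ lieS (G : Set (GL (Fin n) k)) :=
    replica hN hc (hh ▸ hhL) (AddMonoidHom.id k)
  have hNL : N ∈ lieS (G : Set (GL (Fin n) k)) := by
    have : N = h - cdg P a := by rw [hh]; abel
    rw [this]; exact sub_mem hhL hsL
  have h1 : DE e * DE f - DE f * DE e = DE h := (DE_lie e f).symm
  have h2 : DE h * DE e - DE e * DE h = 2 * DE e := by rw [← DE_lie, hfe, DE_two]
  have hH : DE h = DE (cdg P a) + DE N := by rw [hh, DE_add]
  have hST : Commute (DE (cdg P a)) (DE N) := commute_DE hc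
  have hT := fun v => DE_locally_nilpotent hN v
  have hS2 := ss_bracket hH hST (eig_top P a) hT h2
  have hse : cdg P a * e - e * cdg P a = 2 * e := by
    have : Dv (cdg P a * e - e * cdg P a - 2 * e) = 0 := by
      apply Derivation.ext
      intro f
      rw [← DE_lie, ← DE_two] at hS2
      have := LinearMap.congr_fun hS2 f
      rw [DE_apply, DE_apply] at this
      rw [Dv_sub, Derivation.sub_apply, this, sub_self]
      rfl
    exact sub_eq_zero.1 (Dv_inj this)
  have hTE : Commute (DE N) (DE e) := by
    have : DE N = DE h - DE (cdg P a) := by rw [hH]; abel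
    have e1 : (DE h - DE (cdg P a)) * DE e - DE e * (DE h - DE (cdg P a)) = 0 := by
      rw [sub_comm_aux, h2, hS2, sub_self]
    rw [this]
    exact sub_eq_zero.1 e1
  -- general eigenvector extraction
  have hext : ∀ (U : Submodule k (CRing n k)) (_ : ∀ A ∈ lieS (G : Set (GL (Fin n) k)), ∀ u ∈ U, Dv A u ∈ U)
      (v : CRing n k) (c : k), v ∉ U → Dv (cdg P a) v = c • v → Dv e v ∈ U → ∃ j : ℕ, c = j := by
    intro U hU v c hv hcv hev
    obtain ⟨m, hm1, hm2⟩ := last_pow (DE N) U hv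
      (by obtain ⟨m, hm⟩ := hT v; exact ⟨m, by rw [hm]; exact U.zero_mem⟩)
    obtain ⟨W, hWfg, hvW, hWst⟩ := locally_finite ((DE N ^ m) v)
    have hUT : ∀ m : ℕ, ∀ u ∈ U, (DE N ^ m) u ∈ U := by
      intro m
      induction m with
      | zero => intro u hu; simpa using hu
      | succ m ih => intro u hu; rw [pow_succ', Module.End.mul_apply]; exact hU N hNL _ (ih u hu)
    refine sl2_lite h1 h2 U W (fun u hu => hU e heL u hu) (fun u hu => hU f hf u hu)
      (fun u hu => hU h hhL u hu) (fun u hu => hWst f u hu) ?_ hvW hm1 ?_ ?_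
    · obtain ⟨M, hM⟩ := fg_nil (DE e) (fun v => DE_locally_nilpotent he v) W hWfg
      exact ⟨M, fun w hw => by rw [hM w hw]; exact U.zero_mem⟩
    · have := LinearMap.congr_fun (hTE.pow_left m).eq v
      simp only [Module.End.mul_apply] at this
      rw [← this]
      exact hUT m _ hev
    · have := LinearMap.congr_fun (hST.pow_right m).eq v
      simp only [Module.End.mul_apply] at this
      rw [hH, LinearMap.add_apply, this, DE_apply _ v, hcv, map_smul, add_sub_cancel_left]
      exact hm2
  have hse' : ∀ (c : k) (v : CRing n k), Dv (cdg P a) v = c • v →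
      Dv (cdg P a) (Dv e v) = (c + 2) • Dv e v := by
    intro c v hv
    have := LinearMap.congr_fun hS2 v
    rw [← DE_two] at this
    simp only [LinearMap.sub_apply, Module.End.mul_apply, DE_apply, hv, Derivation.map_smul, two_mul, Dv_add,
      Derivation.add_apply] at this
    rw [sub_eq_iff_eq_add] at this
    rw [this]
    module
  have hinteg : ∀ i, ∃ z : ℤ, a i = z := by
    intro i
    set v0 : CRing n k := Rt P (MvPolynomial.X (Sum.inl (i, i))) with hv0
    have hv0ne : v0 ≠ 0 := by
      intro h0
      have := Rt_inv_self P⁻¹ (MvPolynomial.X (Sum.inl (i, i)) : CRing n k)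
      rw [inv_inv, ← hv0, h0, map_zero] at this
      exact MvPolynomial.X_ne_zero _ this.symm
    have hw : Dv (cdg P a) v0 = a i • v0 := by
      have := (wtS_inl P (i, i)).1 a
      rw [← hv0] at this
      rw [this]
      congr 1
      rw [Finset.sum_eq_single i]
      · simp
      · intro j _ hj; simp [hj]
      · simp
    obtain ⟨r, hr1, hr2⟩ := last_pow (DE e) ⊥ (v := v0) (by simpa using hv0ne)
      (by obtain ⟨m, hm⟩ := DE_locally_nilpotent he v0; exact ⟨m, by rw [hm]; exact Submodule.zero_mem _⟩)
    have hwr : ∀ r : ℕ, Dv (cdg P a) ((DE e ^ r) v0) = (a i + 2 * r) • (DE e ^ r) v0 := by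
      intro r
      induction r with
      | zero => simp [hw]
      | succ r ih =>
        rw [pow_succ', Module.End.mul_apply, DE_apply, hse' _ _ ih]
        congr 1; push_cast; ring
    obtain ⟨j, hj⟩ := hext ⊥ (fun A _ u hu => by rw [(Submodule.mem_bot k).1 hu, map_zero]; exact Submodule.zero_mem _)
      _ _ hr1 (hwr r) hr2
    exact ⟨j - 2 * r, by push_cast; rw [← hj]; ring⟩
  choose d hd using hinteg
  have had : a = fun i => (d i : k) := funext hd
  subst had
  refine ⟨P, d, hsL, hse, fun F hF => ?_⟩
  have hFtop : F ∈ ⨆ c, (DE (cdg P (fun i => (d i : k)))).eigenspace c := by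
    rw [eig_top]; trivial
  rw [Submodule.mem_iSup_iff_exists_finsupp] at hFtop
  obtain ⟨v, hv, hsum⟩ := hFtop
  have hv' : ∀ c, Dv (cdg P (fun i => (d i : k))) (v c) = c • v c :=
    fun c => Module.End.mem_eigenspace_iff.1 (hv c)
  set I := (Iv (G : Set (GL (Fin n) k))).restrictScalars k with hI
  have hIst : ∀ A ∈ lieS (G : Set (GL (Fin n) k)), ∀ u ∈ I, Dv A u ∈ I := fun A hA u hu => hA u hu
  have hcomp : ∀ c ∈ v.support, Dv e (v c) ∈ I := by
    have h3 := comp_mem id Function.injective_id (DE (cdg P (fun i => (d i : k)))) I (fun u hu => hsL u hu)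
      (v.support.map (addRightEmbedding 2)) (fun c => Dv e (v (c - 2))) (fun c => by
        rw [DE_apply, hse' _ _ (hv' (c - 2)), sub_add_cancel]; rfl) (by
        rw [Finset.sum_map]
        simp only [addRightEmbedding_apply, add_sub_cancel_right]
        rw [← map_sum]
        rw [Finsupp.sum] at hsum
        rw [hsum]
        exact hF)
    intro c hc
    have := h3 (c + 2) (Finset.mem_map.2 ⟨c, hc, rfl⟩)
    simpa using this
  rw [← hsum, Finsupp.sum]
  refine Submodule.sum_mem _ fun c hcs => ?_
  by_cases hcI : v c ∈ I
  · exact Submodule.mem_sup_left hcI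
  · obtain ⟨j, hj⟩ := hext I hIst (v c) c hcI (hv' c) (hcomp c hcs)
    refine Submodule.mem_sup_right ?_
    have h4 := eig_le_iwt P d c (hv c)
    have : (⨆ j : {j : ℤ // (j : k) = c}, iwt P d j) ≤ ⨆ j : ℕ, iwt P d j := by
      refine iSup_le fun z => ?_
      have hz : (z : ℤ) = (j : ℤ) := by
        have := z.2.trans hj
        exact_mod_cast this
      rw [hz]
      exact le_iSup (fun j : ℕ => iwt P d j) j
    exact this h4

end SL2


section Hard

set_option linter.unusedSimpArgs false
set_option linter.unusedSectionVars false

variable {n : ℕ}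

lemma lam_val (P : GL (Fin n) k) (d : Fin n → ℤ) (t : kˣ) :
    (lamGL P d t : Matrix (Fin n) (Fin n) k) = (P : Matrix (Fin n) (Fin n) k) *
      Matrix.diagonal (fun i => ((t ^ d i : kˣ) : k)) * ((P⁻¹ : GL (Fin n) k) : Matrix (Fin n) (Fin n) k) := by
  rw [lamGL_apply, Units.val_mul, Units.val_mul, dGL_val]

/-- The 1PS attached to an integral semisimple element. -/
noncomputable def lamPS (G : AlgGroup k) (P : GL (Fin G.n) k) (d : Fin G.n → ℤ)
    (h : ∀ t, lamGL P d t ∈ G.toSubgroup) : OnePS G where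
  toFun := lamGL P d
  mem := h
  regular := by
    refine ⟨fun ij => ∑ l, MvPolynomial.C ((P : Matrix (Fin G.n) (Fin G.n) k) ij.1 l) *
      (MvPolynomial.X (decide (0 ≤ d l))) ^ (d l).natAbs *
      MvPolynomial.C (((P⁻¹ : GL (Fin G.n) k) : Matrix (Fin G.n) (Fin G.n) k) l ij.2), ?_⟩
    intro t ij
    rw [lam_val, Matrix.mul_apply, map_sum]
    refine Finset.sum_congr rfl fun l _ => ?_
    rw [Matrix.mul_diagonal]
    simp only [map_mul, map_pow, MvPolynomial.eval_C, MvPolynomial.eval_X]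
    congr 2
    by_cases h0 : 0 ≤ d l
    · obtain ⟨m, hm⟩ := Int.eq_ofNat_of_zero_le h0
      simp [hm]
    · obtain ⟨m, hm⟩ := Int.eq_ofNat_of_zero_le (by omega : 0 ≤ - d l)
      have hd : d l = -(m : ℤ) := by omega
      have hm0 : m ≠ 0 := by omega
      have : ¬ (0 ≤ -(m : ℤ)) := by omega
      rw [hd]
      simp [this, hm0]

noncomputable def detY (n : ℕ) (k : Type) [Field k] : CRing n k :=
  (Matrix.of fun i j => (MvPolynomial.X (Sum.inr (i, j)) : CRing n k)).det

lemma ev_detY (g : GL (Fin n) k) : ev g (detY n k) =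
    ((g⁻¹ : GL (Fin n) k) : Matrix (Fin n) (Fin n) k).det := by
  unfold detY
  rw [AlgHom.map_det]
  congr 1
  ext i j
  simp [ev_inr]

lemma exists_orbit_fun {G : AlgGroup k} {m : ℕ} (X : GVariety G m) {x : Fin m → k} (hx : x ∈ X.carrier) :
    ∃ F : Fin m → CRing G.n k, ∀ g ∈ G.toSubgroup, ∀ i, ev g (F i) = X.act g x i := by
  obtain ⟨p, hp⟩ := X.regular
  refine ⟨fun i => MvPolynomial.aeval (Sum.elim (fun q => MvPolynomial.X (Sum.inl q))
    (Sum.elim (fun _ => detY G.n k) (fun j => MvPolynomial.C (x j)))) (p i), fun g hg i => ?_⟩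
  rw [hp g hg x hx i, ← MvPolynomial.aeval_eq_eval, ← AlgHom.comp_apply, MvPolynomial.comp_aeval]
  congr 2
  funext q
  rcases q with q | q | q
  · simp [ev_inl, mat2pt]
  · simp [ev_detY]
  · simp [ev_C]

lemma exists_hom_fun {G G' : AlgGroup k} (pi : AlgGroupHom G G') :
    ∃ F : Fin G'.n × Fin G'.n → CRing G.n k, ∀ g ∈ G.toSubgroup, ∀ ij,
      ev g (F ij) = (pi.toFun g : Matrix (Fin G'.n) (Fin G'.n) k) ij.1 ij.2 := by
  obtain ⟨p, hp⟩ := pi.regular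
  refine ⟨fun i => MvPolynomial.aeval (Sum.elim (fun q => MvPolynomial.X (Sum.inl q))
    (fun _ => detY G.n k)) (p i), fun g hg i => ?_⟩
  rw [hp g hg i, ← MvPolynomial.aeval_eq_eval, ← AlgHom.comp_apply, MvPolynomial.comp_aeval]
  congr 2
  funext q
  rcases q with q | q
  · simp [ev_inl, mat2pt]
  · simp [ev_detY]

def stabG {G : AlgGroup k} {m : ℕ} (X : GVariety G m) {x : Fin m → k} (hx : x ∈ X.carrier) :
    Subgroup (GL (Fin G.n) k) where
  carrier := stabSet X x
  mul_mem' := by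
    rintro a b ⟨h1, h2⟩ ⟨h3, h4⟩
    exact ⟨mul_mem h1 h3, by rw [X.act_mul a h1 b h3 x hx, h4, h2]⟩
  one_mem' := ⟨one_mem _, X.act_one x hx⟩
  inv_mem' := by
    rintro a ⟨h1, h2⟩
    refine ⟨inv_mem h1, ?_⟩
    have := X.act_mul a⁻¹ (inv_mem h1) a h1 x hx
    rw [inv_mul_cancel, X.act_one x hx, h2] at this
    exact this.symm

lemma zc_stab {G : AlgGroup k} {m : ℕ} (X : GVariety G m) {x : Fin m → k} (hx : x ∈ X.carrier) :
    ZC (stabG X hx : Set (GL (Fin G.n) k)) := by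
  intro g hg
  have hgG : g ∈ G.toSubgroup := by
    refine zc_of_closed G g fun f hf => hg f ?_
    rw [mem_Iv] at hf ⊢
    exact fun h hh => hf h hh.1
  obtain ⟨F, hF⟩ := exists_orbit_fun X hx
  refine ⟨hgG, ?_⟩
  funext i
  have := hg (F i - MvPolynomial.C (x i)) (by
    rw [mem_Iv]
    intro h hh
    rw [map_sub, hF h hh.1, ev_C, hh.2, sub_self])
  rw [map_sub, hF g hgG, ev_C, sub_eq_zero] at this
  exact this

variable [CharZero k]

lemma lam_conj {P : GL (Fin n) k} {d : Fin n → ℤ} {e : Matrix (Fin n) (Fin n) k} (he : IsNilpotent e)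
    (h : cdg P (fun i => (d i : k)) * e - e * cdg P (fun i => (d i : k)) = 2 * e) (t : kˣ) (s : k) :
    lamGL P d t * uGL e he s * (lamGL P d t)⁻¹ = uGL e he ((t : k) ^ 2 * s) := by
  have key : (lamGL P d t : Matrix (Fin n) (Fin n) k) * e *
      (((lamGL P d t)⁻¹ : GL (Fin n) k) : Matrix (Fin n) (Fin n) k) = (t : k) ^ 2 • e := by
    have h1 : ((P⁻¹ : GL (Fin n) k) : Matrix (Fin n) (Fin n) k) * (P : Matrix (Fin n) (Fin n) k) = 1 := by
      rw [← Units.val_mul]; simp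
    have h2 : (P : Matrix (Fin n) (Fin n) k) * ((P⁻¹ : GL (Fin n) k) : Matrix (Fin n) (Fin n) k) = 1 := by
      rw [← Units.val_mul]; simp
    rw [← map_inv, lam_val, lam_val]
    unfold cdg at h
    set Q := ((P⁻¹ : GL (Fin n) k) : Matrix (Fin n) (Fin n) k)
    set R := (P : Matrix (Fin n) (Fin n) k)
    have he' : e = R * (Q * e * R) * Q := by
      calc e = (R * Q) * e * (R * Q) := by rw [h2, Matrix.one_mul, Matrix.mul_one]
        _ = _ := by simp only [Matrix.mul_assoc]
    set e' := Q * e * R with he'def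
    have h3 : Matrix.diagonal (fun i => (d i : k)) * e' - e' * Matrix.diagonal (fun i => (d i : k)) = 2 * e' := by
      have := congrArg (fun M => Q * M * R) h
      beta_reduce at this
      rw [Matrix.mul_sub, Matrix.sub_mul] at this
      have a1 : Q * (R * Matrix.diagonal (fun i => (d i : k)) * Q * e) * R =
        (Q * R) * Matrix.diagonal (fun i => (d i : k)) * e' := by
        rw [he'def]; simp only [Matrix.mul_assoc]
      have a2 : Q * (e * (R * Matrix.diagonal (fun i => (d i : k)) * Q)) * R =
        e' * Matrix.diagonal (fun i => (d i : k)) * (Q * R) := by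
        rw [he'def]; simp only [Matrix.mul_assoc]
      have a3 : Q * (2 * e) * R = 2 * e' := by
        rw [he'def, two_mul, two_mul, Matrix.mul_add, Matrix.add_mul]
      rw [a1, a2, a3, h1, Matrix.one_mul, Matrix.mul_one] at this
      exact this
    have h4 : Matrix.diagonal (fun i => ((t ^ d i : kˣ) : k)) * e' *
        Matrix.diagonal (fun i => (((t⁻¹) ^ d i : kˣ) : k)) = (t : k) ^ 2 • e' := by
      ext i j
      rw [Matrix.mul_diagonal, Matrix.diagonal_mul, Matrix.smul_apply, smul_eq_mul]
      by_cases h0 : e' i j = 0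
      · rw [h0]; ring
      · have h5 := congrFun (congrFun h3 i) j
        rw [two_mul, Matrix.sub_apply, Matrix.add_apply, Matrix.mul_diagonal, Matrix.diagonal_mul] at h5
        have h6 : (d i : k) = (d j : k) + 2 := by
          apply mul_right_cancel₀ h0
          linear_combination h5
        have h7 : d i = d j + 2 := by exact_mod_cast h6
        rw [h7]
        have h8 : ((t ^ (d j + 2) : kˣ) : k) * (((t⁻¹) ^ d j : kˣ) : k) = (t : k) ^ 2 := by
          rw [← Units.val_mul, ← Units.val_pow_eq_pow_val]
          congr 1
          rw [zpow_add, inv_zpow, mul_right_comm, mul_inv_cancel, one_mul]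
          rfl
        linear_combination (e' i j) * h8
    calc R * Matrix.diagonal (fun i => ((t ^ d i : kˣ) : k)) * Q * e *
        (R * Matrix.diagonal (fun i => (((t⁻¹) ^ d i : kˣ) : k)) * Q)
        = R * (Matrix.diagonal (fun i => ((t ^ d i : kˣ) : k)) * e' *
        Matrix.diagonal (fun i => (((t⁻¹) ^ d i : kˣ) : k))) * Q := by
          rw [he'def]; simp only [Matrix.mul_assoc]
      _ = _ := by rw [h4, Matrix.mul_smul, Matrix.smul_mul, ← he']
  rw [uGL_conj _ he s (nilp_conj _ he)]
  apply Units.ext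
  rw [uGL_val, uGL_val, key, smul_smul, mul_comm]

variable [IsAlgClosed k]

lemma limit_of_poly {G : AlgGroup k} {m : ℕ} (X : GVariety G m) (lam : OnePS G) {x : Fin m → k}
    (hx : x ∈ X.carrier) (q : Fin m → Polynomial k)
    (hq : ∀ (t : kˣ) (i : Fin m), X.act (lam.toFun t) x i = (q i).eval (t : k)) : InLambda X x lam := by
  refine ⟨fun i => (q i).eval 0, ?_, q, hq, fun i => rfl⟩
  obtain ⟨I, hI⟩ := X.closed
  rw [hI]
  intro f hf
  have h1 : ∀ c : k, (MvPolynomial.aeval q f : Polynomial k).eval c = MvPolynomial.eval (fun i => (q i).eval c) f := by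
    intro c
    rw [← MvPolynomial.aeval_eq_eval, ← Polynomial.coe_aeval_eq_eval, ← AlgHom.comp_apply, MvPolynomial.comp_aeval]
  rw [← h1]
  have h2 : (MvPolynomial.aeval q f : Polynomial k) = 0 := by
    apply Polynomial.eq_zero_of_infinite_isRoot
    have : ({0}ᶜ : Set k).Infinite := (Set.finite_singleton 0).infinite_compl
    refine this.mono fun c hc => ?_
    have hc' : c ≠ 0 := hc
    have h3 := X.act_mem _ (lam.mem (Units.mk0 c hc')) x hx
    rw [hI] at h3
    have h4 := h3 f hf
    change Polynomial.eval c _ = 0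
    rw [h1, ← h4]
    congr 2
    funext i
    rw [hq]; rfl
  rw [h2, Polynomial.eval_zero]

end Hard


section Hard2

set_option linter.unusedSimpArgs false
set_option linter.unusedSectionVars false

variable {n : ℕ} [CharZero k] [IsAlgClosed k]

lemma two_unit_zpow (u : kˣ) (hu : (u : k) = 2) (j : ℤ) (h : ((u ^ j : kˣ) : k) = 1) : j = 0 := by
  have h2 : (2 : k) ^ j = 1 := by rw [← hu, ← Units.val_zpow_eq_zpow_val, h]
  have h3 : ((2 : ℚ) ^ j : ℚ) = 1 := by
    have : (((2 : ℚ) ^ j : ℚ) : k) = ((1 : ℚ) : k) := by push_cast; exact h2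
    exact_mod_cast this
  rcases lt_trichotomy j 0 with h0 | h0 | h0
  · have := zpow_lt_one_of_neg₀ (by norm_num : (1 : ℚ) < 2) h0
    exact absurd h3 this.ne
  · exact h0
  · have := one_lt_zpow₀ (by norm_num : (1 : ℚ) < 2) h0
    exact absurd h3 this.ne'

lemma iwt_iSup (P : GL (Fin n) k) (d : Fin n → ℤ) : ⨆ j : ℤ, iwt P d j = ⊤ := by
  rw [eq_top_iff, ← wtS_iSup P]
  exact iSup_le fun v => (wtS_le_iwt P d v).trans (le_iSup (fun j : ℤ => iwt P d j) _)

lemma good_int {H : Set (GL (Fin n) k)} {P : GL (Fin n) k} {d : Fin n → ℤ}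
    (hA : cdg P (fun i => (d i : k)) ∈ lieS H) (u : kˣ) (hu : (u : k) = 2) (F : CRing n k)
    (hF : ∀ h ∈ H, ev (h * lamGL P d u) F = ev h F) :
    Dv (cdg P (fun i => (d i : k))) F ∈ Iv H := by
  have hmem : F ∈ ⨆ j : ℤ, iwt P d j := by rw [iwt_iSup]; trivial
  obtain ⟨f, hf, hsum⟩ := (Submodule.mem_iSup_iff_exists_finsupp _ _).1 hmem
  rw [Finsupp.sum] at hsum
  set c : ℤ → k := fun j => ((u ^ j : kˣ) : k) - 1 with hc
  have h1 : ∑ j ∈ f.support, c j • f j ∈ (Iv H).restrictScalars k := by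
    change _ ∈ Iv H
    rw [mem_Iv]
    intro h hh
    have h2 := hF h hh
    rw [← hsum, map_sum, map_sum, ← sub_eq_zero, ← Finset.sum_sub_distrib] at h2
    rw [map_sum, ← h2]
    refine Finset.sum_congr rfl fun j _ => ?_
    rw [(hf j).2, map_smul, smul_eq_mul, hc]
    ring
  have h2 := comp_mem (fun j : ℤ => (j : k)) Int.cast_injective (DE (cdg P (fun i => (d i : k))))
    ((Iv H).restrictScalars k) (fun v hv => by
      rw [DE_apply]; exact hA v hv) f.support (fun j => c j • f j) (fun j => by
      rw [map_smul, DE_apply, (hf j).1, smul_comm]) h1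
  have h3 : ∀ j ∈ f.support, Dv (cdg P (fun i => (d i : k))) (f j) ∈ Iv H := by
    intro j hj
    rw [(hf j).1]
    by_cases h0 : j = 0
    · rw [h0]; simp
    · have hne : c j ≠ 0 := fun h => h0 (two_unit_zpow u hu j (sub_eq_zero.1 h))
      have h4 : f j ∈ (Iv H).restrictScalars k := by
        have := Submodule.smul_mem _ (c j)⁻¹ (h2 j hj)
        beta_reduce at this
        rwa [smul_smul, inv_mul_cancel₀ hne, one_smul] at this
      exact Submodule.smul_mem ((Iv H).restrictScalars k) _ h4
  rw [← hsum, map_sum]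
  exact Ideal.sum_mem _ h3

/-- functions which are polynomial along `lam` -/
def polS (lam : kˣ →* GL (Fin n) k) : Submodule k (CRing n k) where
  carrier := {F | ∃ q : Polynomial k, ∀ t, ev (lam t) F = q.eval (t : k)}
  add_mem' := by
    rintro a b ⟨q, hq⟩ ⟨r, hr⟩
    exact ⟨q + r, fun t => by rw [map_add, hq, hr, Polynomial.eval_add]⟩
  zero_mem' := ⟨0, fun t => by simp⟩
  smul_mem' := by
    rintro c a ⟨q, hq⟩
    exact ⟨c • q, fun t => by rw [map_smul, hq, Polynomial.eval_smul]⟩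

lemma pol_of_weights {H : Set (GL (Fin n) k)} {P : GL (Fin n) k} {d : Fin n → ℤ}
    (hl : ∀ t, lamGL P d t ∈ H) {F : CRing n k}
    (hF : F ∈ (Iv H).restrictScalars k ⊔ ⨆ j : ℕ, iwt P d j) : F ∈ polS (lamGL P d) := by
  refine (sup_le ?_ (iSup_le ?_) : _ ≤ polS (lamGL P d)) hF
  · intro f hf
    exact ⟨0, fun t => by rw [Polynomial.eval_zero]; exact hf _ (hl t)⟩
  · intro j f hf
    refine ⟨Polynomial.C (ev 1 f) * Polynomial.X ^ j, fun t => ?_⟩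
    have := hf.2 1 t
    rw [one_mul] at this
    rw [this, Polynomial.eval_mul, Polynomial.eval_C, Polynomial.eval_pow, Polynomial.eval_X, zpow_natCast,
      Units.val_pow_eq_pow_val, mul_comm]

lemma lie_of_nil {G : Subgroup (GL (Fin n) k)} {N : Matrix (Fin n) (Fin n) k} (hN : IsNilpotent N)
    (h : ∀ s, uGL N hN s ∈ G) : N ∈ lieS (G : Set (GL (Fin n) k)) := by
  apply lieS_of_tangent
  intro f hf
  apply Dv_eq_zero_of_const 1 hN
  intro s
  rw [one_mul, hf _ (h s), hf _ (one_mem G)]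

variable {G G' : AlgGroup k} {m : ℕ} (X : GVariety G m) {x : Fin m → k}

lemma good_nil (hG : IsReductive G) (hx : x ∈ X.carrier) (hS : OnePSStable X x)
    (pi : AlgGroupHom G G') (hker : ∀ g ∈ G.toSubgroup, (pi.toFun g = 1 ↔ g ∈ actionCenter X))
    {F : CRing G.n k} {ij : Fin G'.n × Fin G'.n}
    (hF : ∀ g ∈ G.toSubgroup, ev g F = (pi.toFun g : Matrix (Fin G'.n) (Fin G'.n) k) ij.1 ij.2)
    {N : Matrix (Fin G.n) (Fin G.n) k} (hN : IsNilpotent N)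
    (hL : N ∈ lieS (stabG X hx : Set (GL (Fin G.n) k))) :
    Dv N F ∈ Iv (stabG X hx : Set (GL (Fin G.n) k)) := by
  have hu : ∀ s, uGL N hN s ∈ stabG X hx := fun s => uGL_mem (zc_stab X hx) hN hL s
  have huG : ∀ s, uGL N hN s ∈ G.toSubgroup := fun s => (hu s).1
  have hNG := lie_of_nil hN huG
  obtain ⟨P, d, hd, hcomm, hw⟩ := sl2_weights (nondeg G hG) hN hNG
  have hlam : ∀ t, lamGL P d t ∈ G.toSubgroup := fun t =>
    lam_mem (zc_of_closed G) (one_mem G.toSubgroup) hd t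
  obtain ⟨Fx, hFx⟩ := exists_orbit_fun X hx
  have hpol : ∀ i, Fx i ∈ polS (lamGL P d) := by
    intro i
    apply pol_of_weights hlam
    apply hw
    rw [mem_Iv]
    intro g hg
    apply Dv_eq_zero_of_const g hN
    intro s
    rw [hFx _ (mul_mem hg (huG s)), hFx _ hg, X.act_mul g hg _ (huG s) x hx, (hu s).2]
  choose q hq using hpol
  have hlim : InLambda X x (lamPS G P d hlam) := limit_of_poly X _ hx q fun t i => by
    rw [← hq i t, hFx _ (hlam t)]; rfl
  have hK : ∀ t, lamGL P d t ∈ actionCenter X := by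
    by_contra hcon
    exact hS.2 (lamPS G P d hlam) hcon hlim
  have hpl : ∀ t, pi.toFun (lamGL P d t) = 1 := fun t => (hker _ (hlam t)).2 (hK t)
  have h4 : ∀ s, pi.toFun (uGL N hN (4 * s)) = pi.toFun (uGL N hN s) := by
    intro s
    have h := lam_conj hN hcomm (Units.mk0 (2 : k) two_ne_zero) s
    rw [Units.val_mk0, show (2 : k) ^ 2 = 4 by norm_num] at h
    rw [← h, ← map_inv, pi.map_mul _ (mul_mem (hlam _) (huG _)) _ (hlam _), pi.map_mul _ (hlam _) _ (huG _),
      hpl, hpl, one_mul, mul_one]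
  have h1 : ∀ s, pi.toFun (uGL N hN s) = 1 := by
    intro s
    have h := h4 (s / 3)
    rw [show 4 * (s / 3) = s + s / 3 by ring, uGL_add, pi.map_mul _ (huG _) _ (huG _)] at h
    exact mul_eq_right.1 h
  rw [mem_Iv]
  intro g hg
  apply Dv_eq_zero_of_const g hN
  intro s
  rw [hF _ (mul_mem hg.1 (huG s)), hF _ hg.1, pi.map_mul _ hg.1 _ (huG s), h1, mul_one]

lemma good_int' (hx : x ∈ X.carrier) (hS : OnePSStable X x)
    (pi : AlgGroupHom G G') (hker : ∀ g ∈ G.toSubgroup, (pi.toFun g = 1 ↔ g ∈ actionCenter X))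
    {F : CRing G.n k} {ij : Fin G'.n × Fin G'.n}
    (hF : ∀ g ∈ G.toSubgroup, ev g F = (pi.toFun g : Matrix (Fin G'.n) (Fin G'.n) k) ij.1 ij.2)
    {P : GL (Fin G.n) k} {d : Fin G.n → ℤ}
    (hL : cdg P (fun i => (d i : k)) ∈ lieS (stabG X hx : Set (GL (Fin G.n) k))) :
    Dv (cdg P (fun i => (d i : k))) F ∈ Iv (stabG X hx : Set (GL (Fin G.n) k)) := by
  have hH : ∀ t, lamGL P d t ∈ stabG X hx := fun t =>
    lam_mem (zc_stab X hx) (one_mem (stabG X hx)) hL t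
  have hlam : ∀ t, lamGL P d t ∈ G.toSubgroup := fun t => (hH t).1
  have hlim : InLambda X x (lamPS G P d hlam) :=
    limit_of_poly X _ hx (fun i => Polynomial.C (x i)) fun t i => by
      rw [Polynomial.eval_C]; exact congrFun (hH t).2 i
  have hK : ∀ t, lamGL P d t ∈ actionCenter X := by
    by_contra hcon
    exact hS.2 (lamPS G P d hlam) hcon hlim
  refine good_int hL (Units.mk0 (2 : k) two_ne_zero) rfl F fun h hh => ?_
  rw [hF _ (mul_mem hh.1 (hlam _)), hF _ hh.1, pi.map_mul _ hh.1 _ (hlam _),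
    (hker _ (hlam _)).2 (hK _), mul_one]

lemma cdg_smul (P : GL (Fin n) k) (c : k) (a : Fin n → k) :
    cdg P (fun i => c * a i) = c • cdg P a := by
  unfold cdg
  rw [← Matrix.smul_mul, ← Matrix.mul_smul]
  congr 2
  ext i j
  by_cases h : i = j <;> simp [Matrix.diagonal, h]

lemma cdg_sum {ι : Type} (s : Finset ι) (P : GL (Fin n) k) (a : ι → Fin n → k) :
    cdg P (fun i => ∑ r ∈ s, a r i) = ∑ r ∈ s, cdg P (a r) := by
  unfold cdg
  rw [← Matrix.sum_mul, ← Matrix.mul_sum]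
  congr 2
  ext i j
  rw [Matrix.sum_apply]
  by_cases h : i = j <;> simp [Matrix.diagonal, h]

lemma rat_common (r : Fin n → ℚ) : ∃ (D : ℕ) (d : Fin n → ℤ), D ≠ 0 ∧ ∀ i, (D : ℚ) * r i = d i := by
  refine ⟨∏ i, (r i).den, fun i => (∏ l ∈ Finset.univ.erase i, (r l).den : ℕ) * (r i).num, ?_, fun i => ?_⟩
  · exact Finset.prod_ne_zero_iff.2 fun i _ => (r i).den_nz
  · rw [← Finset.mul_prod_erase Finset.univ _ (Finset.mem_univ i)]
    push_cast
    have := Rat.mul_den_eq_num (r i)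
    linear_combination (∏ l ∈ Finset.univ.erase i, ((r l).den : ℚ)) * this

lemma good_all (hG : IsReductive G) (hx : x ∈ X.carrier) (hS : OnePSStable X x)
    (pi : AlgGroupHom G G') (hker : ∀ g ∈ G.toSubgroup, (pi.toFun g = 1 ↔ g ∈ actionCenter X))
    {F : CRing G.n k} {ij : Fin G'.n × Fin G'.n}
    (hF : ∀ g ∈ G.toSubgroup, ev g F = (pi.toFun g : Matrix (Fin G'.n) (Fin G'.n) k) ij.1 ij.2)
    {A : Matrix (Fin G.n) (Fin G.n) k}
    (hL : A ∈ lieS (stabG X hx : Set (GL (Fin G.n) k))) :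
    Dv A F ∈ Iv (stabG X hx : Set (GL (Fin G.n) k)) := by
  obtain ⟨P, a, N, hN, hc, rfl⟩ := jordan A
  have hS1 : cdg P a ∈ lieS (stabG X hx : Set (GL (Fin G.n) k)) := replica hN hc hL (AddMonoidHom.id k)
  have hN1 : N ∈ lieS (stabG X hx : Set (GL (Fin G.n) k)) := by
    have := sub_mem hL hS1
    rwa [add_sub_cancel_left] at this
  rw [Dv_add, Derivation.add_apply]
  refine add_mem ?_ (good_nil X hG hx hS pi hker hF hN hN1)
  classical
  let B := Module.Basis.ofVectorSpace ℚ k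
  let s : Finset _ := Finset.univ.biUnion fun i => (B.repr (a i)).support
  have ha : a = fun i => ∑ r ∈ s, B r * (algebraMap ℚ k (B.repr (a i) r)) := by
    funext i
    conv_lhs => rw [← B.linearCombination_repr (a i), Finsupp.linearCombination_apply]
    rw [Finsupp.sum_of_support_subset (s := s)]
    · refine Finset.sum_congr rfl fun r _ => ?_
      rw [Algebra.smul_def, mul_comm]
    · exact Finset.subset_biUnion_of_mem (fun i => (B.repr (a i)).support) (Finset.mem_univ i)
    · intro r _; simp
  rw [ha, cdg_sum]
  have hterm : ∀ r ∈ s, Dv (cdg P fun i => B r * (algebraMap ℚ k (B.repr (a i) r))) F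
      ∈ Iv (stabG X hx : Set (GL (Fin G.n) k)) := by
    intro r _
    let φ : k →+ k := (algebraMap ℚ k).toAddMonoidHom.comp (B.coord r).toAddMonoidHom
    have hφ : cdg P (fun i => algebraMap ℚ k (B.repr (a i) r)) ∈
      lieS (stabG X hx : Set (GL (Fin G.n) k)) := replica hN hc hL φ
    obtain ⟨D, d, hD, hd⟩ := rat_common fun i => B.repr (a i) r
    have hdk : ∀ i, (d i : k) = (D : k) * algebraMap ℚ k (B.repr (a i) r) := by
      intro i
      have := congrArg (algebraMap ℚ k) (hd i)
      rw [map_mul] at this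
      simpa using this.symm
    have h1 : cdg P (fun i => (d i : k)) = (D : k) • cdg P (fun i => algebraMap ℚ k (B.repr (a i) r)) := by
      rw [← cdg_smul]; congr 1; funext i; exact hdk i
    have h2 : cdg P (fun i => (d i : k)) ∈ lieS (stabG X hx : Set (GL (Fin G.n) k)) := by
      rw [h1]; exact Submodule.smul_mem _ _ hφ
    have h3 := good_int' X hx hS pi hker hF h2
    have hDk : (D : k) ≠ 0 := Nat.cast_ne_zero.2 hD
    have h4 : (cdg P fun i => B r * (algebraMap ℚ k (B.repr (a i) r))) =
        (B r * (D : k)⁻¹) • cdg P (fun i => (d i : k)) := by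
      rw [h1, smul_smul, mul_assoc, inv_mul_cancel₀ hDk, mul_one, cdg_smul]
    rw [h4, Dv_smul, Derivation.smul_apply]
    exact Submodule.smul_mem ((Iv (stabG X hx : Set (GL (Fin G.n) k))).restrictScalars k) _ h3
  clear_value s
  clear ha
  induction s using Finset.cons_induction with
  | empty => rw [Finset.sum_empty, Dv_zero]; simp
  | cons r s hr ih =>
    rw [Finset.sum_cons, Dv_add, Derivation.add_apply]
    exact add_mem (hterm r (Finset.mem_cons_self r s))
      (ih fun r' hr' => hterm r' (Finset.mem_cons_of_mem hr'))

lemma pi_image_finite (hG : IsReductive G) (hx : x ∈ X.carrier) (hS : OnePSStable X x)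
    (pi : AlgGroupHom G G') (hker : ∀ g ∈ G.toSubgroup, (pi.toFun g = 1 ↔ g ∈ actionCenter X)) :
    (pi.toFun '' stabSet X x).Finite := by
  obtain ⟨F, hF⟩ := exists_hom_fun pi
  have hfin : ∀ ij, ((fun h => ev h (F ij)) '' (stabG X hx : Set (GL (Fin G.n) k))).Finite := fun ij =>
    finite_image _ _ fun A hA => good_all X hG hx hS pi hker (fun g hg => hF g hg ij) hA
  have h1 := Set.Finite.pi' hfin
  refine Set.Finite.of_finite_image
    (f := fun (M : GL (Fin G'.n) k) (ij : Fin G'.n × Fin G'.n) => (M : Matrix (Fin G'.n) (Fin G'.n) k) ij.1 ij.2)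
    (h1.subset ?_) ?_
  · rintro _ ⟨_, ⟨g, hg, rfl⟩, rfl⟩
    intro ij
    exact ⟨g, hg, hF g hg.1 ij⟩
  · intro M _ M' _ h
    apply Units.ext
    ext i j
    exact congrFun h (i, j)

lemma pi_coset (pi : AlgGroupHom G G') (hker : ∀ g ∈ G.toSubgroup, (pi.toFun g = 1 ↔ g ∈ actionCenter X))
    {g : GL (Fin G.n) k} (hg : g ∈ G.toSubgroup) :
    (fun h => g * h) '' actionCenter X = {h | h ∈ G.toSubgroup ∧ pi.toFun h = pi.toFun g} := by
  ext h
  constructor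
  · rintro ⟨c, hc, rfl⟩
    refine ⟨mul_mem hg hc.1, ?_⟩
    rw [pi.map_mul g hg c hc.1, (hker c hc.1).2 hc, mul_one]
  · rintro ⟨h1, h2⟩
    have h3 : g⁻¹ * h ∈ G.toSubgroup := mul_mem (inv_mem hg) h1
    refine ⟨g⁻¹ * h, (hker _ h3).1 ?_, by simp⟩
    have h4 := pi.map_mul g hg (g⁻¹ * h) h3
    rw [mul_inv_cancel_left, h2] at h4
    exact left_eq_mul.1 h4

lemma coset_finite_iff (pi : AlgGroupHom G G')
    (hker : ∀ g ∈ G.toSubgroup, (pi.toFun g = 1 ↔ g ∈ actionCenter X)) :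
    Set.Finite ((fun g => (fun h => g * h) '' actionCenter X) '' stabSet X x) ↔
      (pi.toFun '' stabSet X x).Finite := by
  have h1 : (fun g => (fun h => g * h) '' actionCenter X) '' stabSet X x =
      (fun p => {h | h ∈ G.toSubgroup ∧ pi.toFun h = p}) '' (pi.toFun '' stabSet X x) := by
    rw [Set.image_image]
    exact Set.image_congr fun g hg => pi_coset X pi hker hg.1
  rw [h1]
  refine Set.finite_image_iff ?_
  rintro _ ⟨g, hg, rfl⟩ _ ⟨g', hg', rfl⟩ h
  beta_reduce at h
  have h2 : g ∈ {h | h ∈ G.toSubgroup ∧ pi.toFun h = pi.toFun g} := ⟨hg.1, rfl⟩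
  rw [h] at h2
  exact h2.2

lemma hard_dir (hG : IsReductive G) (hx : x ∈ X.carrier) (hS : OnePSStable X x)
    (pi : AlgGroupHom G G') (hker : ∀ g ∈ G.toSubgroup, (pi.toFun g = 1 ↔ g ∈ actionCenter X)) :
    Stable X x :=
  ⟨hS.1, (coset_finite_iff X pi hker).2 (pi_image_finite X hG hx hS pi hker)⟩

end Hard2


section Easy

set_option linter.unusedSimpArgs false
set_option linter.unusedSectionVars false

variable [IsAlgClosed k]

lemma poly_zero_of_units (f : Polynomial k) (h : ∀ t : kˣ, f.eval (t : k) = 0) : f = 0 := by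
  apply Polynomial.eq_zero_of_infinite_isRoot
  have : ({0}ᶜ : Set k).Infinite := (Set.finite_singleton 0).infinite_compl
  refine this.mono fun c hc => ?_
  exact h (Units.mk0 c hc)

lemma eval_aeval_poly {σ : Type} (q : σ → Polynomial k) (f : MvPolynomial σ k) (c : k) :
    (MvPolynomial.aeval q f : Polynomial k).eval c = MvPolynomial.eval (fun i => (q i).eval c) f := by
  rw [← MvPolynomial.aeval_eq_eval, ← Polynomial.coe_aeval_eq_eval, ← AlgHom.comp_apply,
    MvPolynomial.comp_aeval]

lemma closed_limit {σ : Type} {S : Set (σ → k)} (hS : IsZClosed S) (q : σ → Polynomial k)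
    (h : ∀ t : kˣ, (fun i => (q i).eval (t : k)) ∈ S) : (fun i => (q i).eval 0) ∈ S := by
  obtain ⟨I, rfl⟩ := hS
  intro f hf
  have h0 : (MvPolynomial.aeval q f : Polynomial k) = 0 := poly_zero_of_units _ fun t => by
    rw [eval_aeval_poly]
    exact h t f hf
  rw [← eval_aeval_poly, h0, Polynomial.eval_zero]

variable {G G' : AlgGroup k} {m : ℕ} (X : GVariety G m) {x : Fin m → k}

lemma limit_fixed (hx : x ∈ X.carrier) {lam : OnePS G} {y : Fin m → k} (hy : XLimit X lam x y) (s : kˣ) :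
    X.act (lam.toFun s) y = y := by
  obtain ⟨hyc, q, hq, hq0⟩ := hy
  obtain ⟨p, hp⟩ := X.regular
  have hy0 : y = fun i => (q i).eval 0 := funext hq0
  funext i
  have hzc : ∀ t : kˣ, X.act (lam.toFun t) x = fun i => (q i).eval (t : k) := fun t => funext (hq t)
  let e : (Fin G.n × Fin G.n) ⊕ (Unit ⊕ Fin m) → Polynomial k :=
    Sum.elim (fun ab => Polynomial.C (mat2pt (lam.toFun s : Matrix (Fin G.n) (Fin G.n) k) ab))
      (Sum.elim (fun _ => Polynomial.C
        (((lam.toFun s)⁻¹ : GL (Fin G.n) k) : Matrix (Fin G.n) (Fin G.n) k).det) q)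
  have he : ∀ c : k, (fun a => (e a).eval c) =
      Sum.elim (mat2pt (lam.toFun s : Matrix (Fin G.n) (Fin G.n) k))
        (Sum.elim (fun _ => (((lam.toFun s)⁻¹ : GL (Fin G.n) k) : Matrix (Fin G.n) (Fin G.n) k).det)
          (fun j => (q j).eval c)) := by
    intro c
    funext a
    rcases a with a | a | a
    · exact Polynomial.eval_C
    · exact Polynomial.eval_C
    · rfl
  have hE : (MvPolynomial.aeval e (p i) : Polynomial k) - (q i).comp (Polynomial.C (s : k) * Polynomial.X) = 0 := by
    apply poly_zero_of_units
    intro t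
    have h1 := X.act_mem _ (lam.mem t) x hx
    have h2 := hp _ (lam.mem s) _ h1 i
    rw [← X.act_mul _ (lam.mem s) _ (lam.mem t) x hx, ← map_mul, hq, hzc t, ← he, ← eval_aeval_poly] at h2
    rw [Polynomial.eval_sub, ← h2, Polynomial.eval_comp, Polynomial.eval_mul, Polynomial.eval_C,
      Polynomial.eval_X, Units.val_mul, sub_self]
  have h3 := congrArg (Polynomial.eval 0) hE
  rw [Polynomial.eval_sub, eval_aeval_poly, he, Polynomial.eval_comp, Polynomial.eval_mul, Polynomial.eval_C,
      Polynomial.eval_X, mul_zero, Polynomial.eval_zero, sub_eq_zero, ← hy0, ← hp _ (lam.mem s) y hyc] at h3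
  rw [h3, hq0]

lemma center_conj {g c : GL (Fin G.n) k} (hg : g ∈ G.toSubgroup) (hc : c ∈ actionCenter X) :
    g * c * g⁻¹ ∈ actionCenter X := by
  refine ⟨mul_mem (mul_mem hg hc.1) (inv_mem hg), fun z hz => ?_⟩
  have h1 := X.act_mem _ (inv_mem hg) z hz
  rw [X.act_mul _ (mul_mem hg hc.1) _ (inv_mem hg) z hz, X.act_mul _ hg _ hc.1 _ h1, hc.2 _ h1,
    ← X.act_mul _ hg _ (inv_mem hg) z hz, mul_inv_cancel, X.act_one z hz]

lemma center_mul {a b : GL (Fin G.n) k} (ha : a ∈ actionCenter X) (hb : b ∈ actionCenter X) :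
    a * b ∈ actionCenter X :=
  ⟨mul_mem ha.1 hb.1, fun z hz => by rw [X.act_mul _ ha.1 _ hb.1 z hz, hb.2 z hz, ha.2 z hz]⟩

lemma center_one : (1 : GL (Fin G.n) k) ∈ actionCenter X := ⟨one_mem _, X.act_one⟩

lemma center_inv {a : GL (Fin G.n) k} (ha : a ∈ actionCenter X) : a⁻¹ ∈ actionCenter X := by
  refine ⟨inv_mem ha.1, fun z hz => ?_⟩
  have := X.act_mul a⁻¹ (inv_mem ha.1) a ha.1 z hz
  rw [inv_mul_cancel, X.act_one z hz, ha.2 z hz] at this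
  exact this.symm

lemma stable_onePS (hx : x ∈ X.carrier) (h : Stable X x) : OnePSStable X x := by
  refine ⟨h.1, ?_⟩
  rintro lam hlam ⟨y, hy⟩
  apply hlam
  have hfix := limit_fixed X hx hy
  obtain ⟨hyc, q, hq, hq0⟩ := hy
  have hyo : y ∈ orbitSet X x := by
    have : y = fun i => (q i).eval 0 := funext hq0
    rw [this]
    refine closed_limit h.1 q fun t => ⟨lam.toFun t, lam.mem t, ?_⟩
    funext i
    exact (hq t i).symm
  obtain ⟨g, hg, hgy⟩ := hyo
  have hst : ∀ t, g⁻¹ * lam.toFun t * g ∈ stabSet X x := by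
    intro t
    refine ⟨mul_mem (mul_mem (inv_mem hg) (lam.mem t)) hg, ?_⟩
    rw [X.act_mul _ (mul_mem (inv_mem hg) (lam.mem t)) _ hg x hx, ← hgy,
      X.act_mul _ (inv_mem hg) _ (lam.mem t) y hyc, hfix, hgy, ← X.act_mul _ (inv_mem hg) _ hg x hx,
      inv_mul_cancel, X.act_one x hx]
  let T : Subgroup kˣ :=
    { carrier := {t | lam.toFun t ∈ actionCenter X}
      mul_mem' := fun {a b} ha hb => by
        change lam.toFun (a * b) ∈ actionCenter X
        rw [map_mul]; exact center_mul X ha hb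
      one_mem' := by
        change lam.toFun 1 ∈ actionCenter X
        rw [map_one]; exact center_one X
      inv_mem' := fun {a} ha => by
        change lam.toFun a⁻¹ ∈ actionCenter X
        rw [map_inv]; exact center_inv X ha }
  let S := (fun g => (fun h => g * h) '' actionCenter X) '' stabSet X x
  have hSf : Finite S := h.2
  let φ : kˣ → S := fun t => ⟨_, Set.mem_image_of_mem _ (hst t)⟩
  have hφ : ∀ a b, φ a = φ b → a⁻¹ * b ∈ T := by
    intro a b hab
    have h1 : (fun h => (g⁻¹ * lam.toFun a * g) * h) '' actionCenter X =
      (fun h => (g⁻¹ * lam.toFun b * g) * h) '' actionCenter X := congrArg Subtype.val hab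
    have h2 : (g⁻¹ * lam.toFun b * g) ∈ (fun h => (g⁻¹ * lam.toFun b * g) * h) '' actionCenter X :=
      ⟨1, center_one X, mul_one _⟩
    rw [← h1] at h2
    obtain ⟨c, hc, hcb⟩ := h2
    beta_reduce at hcb
    change lam.toFun (a⁻¹ * b) ∈ actionCenter X
    rw [map_mul, map_inv]
    have h3 : (lam.toFun a)⁻¹ * lam.toFun b = g * c * g⁻¹ := by
      have : lam.toFun b = g * (g⁻¹ * lam.toFun b * g) * g⁻¹ := by group
      rw [this, ← hcb]; group
    rw [h3]
    exact center_conj X hg hc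
  have hfq : Finite (kˣ ⧸ T) := by
    refine Finite.of_injective (fun c : kˣ ⧸ T => φ c.out) fun c c' hcc => ?_
    have := QuotientGroup.eq.2 (hφ _ _ hcc)
    rwa [QuotientGroup.out_eq', QuotientGroup.out_eq'] at this
  have hfi : T.FiniteIndex := Subgroup.finiteIndex_of_finite_quotient
  intro t
  obtain ⟨z, hz⟩ := IsAlgClosed.exists_pow_nat_eq (t : k) (Nat.pos_of_ne_zero hfi.index_ne_zero)
  have hz0 : z ≠ 0 := by
    rintro rfl
    rw [zero_pow hfi.index_ne_zero] at hz
    exact t.ne_zero hz.symm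
  have h5 := T.pow_index_mem (Units.mk0 z hz0)
  have h6 : (Units.mk0 z hz0) ^ T.index = t := Units.ext hz
  rw [h6] at h5
  exact h5

lemma properly_stable (h : ProperlyStable X x) : Stable X x := ⟨h.1, h.2.image _⟩

lemma pi_inv (pi : AlgGroupHom G G') {g : GL (Fin G.n) k} (hg : g ∈ G.toSubgroup) :
    pi.toFun g⁻¹ = (pi.toFun g)⁻¹ := by
  have := pi.map_mul g⁻¹ (inv_mem hg) g hg
  rw [inv_mul_cancel, pi.map_one] at this
  exact eq_inv_of_mul_eq_one_left this.symm

/-- Composition of a 1PS with a morphism. -/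
noncomputable def compPS (pi : AlgGroupHom G G') (lam : OnePS G) : OnePS G' where
  toFun :=
    { toFun := fun t => pi.toFun (lam.toFun t)
      map_one' := by rw [map_one, pi.map_one]
      map_mul' := fun a b => by rw [map_mul, pi.map_mul _ (lam.mem a) _ (lam.mem b)] }
  mem := fun t => pi.mem _ (lam.mem t)
  regular := by
    obtain ⟨p, hp⟩ := lam.regular
    obtain ⟨r, hr⟩ := pi.regular
    let sw : MvPolynomial Bool k →ₐ[k] MvPolynomial Bool k := MvPolynomial.rename not
    let D : MvPolynomial Bool k := (Matrix.of fun i j => sw (p (i, j))).det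
    let e : (Fin G.n × Fin G.n) ⊕ Unit → MvPolynomial Bool k := Sum.elim p (fun _ => D)
    refine ⟨fun ij => MvPolynomial.aeval e (r ij), fun t ij => ?_⟩
    change (pi.toFun (lam.toFun t) : Matrix (Fin G'.n) (Fin G'.n) k) ij.1 ij.2 = _
    rw [hr _ (lam.mem t)]
    set v : Bool → k := fun b => if b then (t : k) else ((t⁻¹ : kˣ) : k) with hv
    have h1 : MvPolynomial.eval v (MvPolynomial.aeval e (r ij)) =
        MvPolynomial.eval (fun a => MvPolynomial.eval v (e a)) (r ij) := by
      rw [← MvPolynomial.aeval_eq_eval, ← MvPolynomial.aeval_eq_eval, ← AlgHom.comp_apply,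
        MvPolynomial.comp_aeval]
    rw [h1]
    congr 2
    funext a
    rcases a with a | a
    · exact hp t a
    · change _ = MvPolynomial.eval v D
      rw [RingHom.map_det, ← map_inv]
      change Matrix.det _ = _
      congr 1
      ext i j
      have h2 := hp t⁻¹ (i, j)
      rw [h2]
      change _ = MvPolynomial.eval v (MvPolynomial.rename not (p (i, j)))
      rw [MvPolynomial.eval_rename]
      congr 2
      funext b
      cases b <;> simp [hv]

variable {Ghat : AlgGroup k} (Xhat : GVariety Ghat m)

lemma orbit_eq (pi : AlgGroupHom G Ghat) (hsurj : pi.Surj)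
    (hact : ∀ g ∈ G.toSubgroup, ∀ y ∈ X.carrier, Xhat.act (pi.toFun g) y = X.act g y)
    (hx : x ∈ X.carrier) : orbitSet Xhat x = orbitSet X x := by
  ext y
  constructor
  · rintro ⟨g', hg', rfl⟩
    obtain ⟨g, hg, rfl⟩ := hsurj g' hg'
    exact ⟨g, hg, hact g hg x hx⟩
  · rintro ⟨g, hg, rfl⟩
    exact ⟨pi.toFun g, pi.mem g hg, (hact g hg x hx).symm⟩

lemma stab_eq (pi : AlgGroupHom G Ghat) (hsurj : pi.Surj)
    (hact : ∀ g ∈ G.toSubgroup, ∀ y ∈ X.carrier, Xhat.act (pi.toFun g) y = X.act g y)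
    (hx : x ∈ X.carrier) : stabSet Xhat x = pi.toFun '' stabSet X x := by
  ext y
  constructor
  · rintro ⟨hg', h⟩
    obtain ⟨g, hg, rfl⟩ := hsurj y hg'
    exact ⟨g, ⟨hg, by rw [← hact g hg x hx, h]⟩, rfl⟩
  · rintro ⟨g, hg, rfl⟩
    exact ⟨pi.mem g hg.1, by rw [hact g hg.1 x hx, hg.2]⟩

lemma onePS_down (hcar : Xhat.carrier = X.carrier) (pi : AlgGroupHom G Ghat) (hsurj : pi.Surj)
    (hact : ∀ g ∈ G.toSubgroup, ∀ y ∈ X.carrier, Xhat.act (pi.toFun g) y = X.act g y)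
    (hx : x ∈ X.carrier) (h : OnePSStable Xhat x) : OnePSStable X x := by
  refine ⟨?_, ?_⟩
  · have := h.1
    unfold Polystable at this ⊢
    rwa [orbit_eq X Xhat pi hsurj hact hx] at this
  · rintro lam hlam ⟨y, hyc, q, hq, hq0⟩
    refine h.2 (compPS pi lam) (fun hcon => hlam fun t => ⟨lam.mem t, fun z hz => ?_⟩)
      ⟨y, by rw [hcar]; exact hyc, q, fun t i => ?_, hq0⟩
    · rw [← hact _ (lam.mem t) z hz]
      exact (hcon t).2 z (by rw [hcar]; exact hz)
    · rw [← hq t i, ← hact _ (lam.mem t) x hx]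
      rfl

end Easy

/-- Theorem 3.12 of the paper. For a point `x` of an affine
`G`-variety `X`, the following are equivalent: (1) `x` is stable; (2) `x` is
properly stable for the reduced action of `G/G_X`; (3) `x` is 1PS stable for
the reduced action of `G/G_X`; (4) `x` is 1PS stable for the `G`-action.
The quotient `G/G_X` is modelled by an affine algebraic group `Ĝ` together
with a surjective morphism `π : G → Ĝ` with kernel `G_X`, acting on the same
underlying variety compatibly with the `G`-action. -/
theorem stable_tfae_reduced_action
    {k : Type} [Field k] [IsAlgClosed k] [CharZero k]
    (G Ghat : AlgGroup k) (hG : IsReductive G)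
    {m : ℕ} (X : GVariety G m) (Xhat : GVariety Ghat m)
    (hcar : Xhat.carrier = X.carrier)
    (pi : AlgGroupHom G Ghat) (hsurj : pi.Surj)
    (hker : ∀ g ∈ G.toSubgroup, (pi.toFun g = 1 ↔ g ∈ actionCenter X))
    (hact : ∀ g ∈ G.toSubgroup, ∀ y ∈ X.carrier, Xhat.act (pi.toFun g) y = X.act g y)
    (x : Fin m → k) (hx : x ∈ X.carrier) :
    (Stable X x ↔ ProperlyStable Xhat x) ∧
    (Stable X x ↔ OnePSStable Xhat x) ∧
    (Stable X x ↔ OnePSStable X x) := by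
  have h12 : Stable X x ↔ ProperlyStable Xhat x := by
    unfold Stable ProperlyStable Polystable
    rw [orbit_eq X Xhat pi hsurj hact hx, stab_eq X Xhat pi hsurj hact hx, coset_finite_iff X pi hker]
  have hxh : x ∈ Xhat.carrier := by rw [hcar]; exact hx
  have h23 : ProperlyStable Xhat x → OnePSStable Xhat x := fun h =>
    stable_onePS Xhat hxh (properly_stable Xhat h)
  have h34 : OnePSStable Xhat x → OnePSStable X x := onePS_down X Xhat hcar pi hsurj hact hx
  have h41 : OnePSStable X x → Stable X x := fun h => hard_dir X hG hx h pi hker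
  exact ⟨h12, ⟨fun h => h23 (h12.1 h), fun h => h41 (h34 h)⟩,
    ⟨fun h => h34 (h23 (h12.1 h)), h41⟩⟩

end PaperGIT
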